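/- arXiv:1312.6819 — 2 statements merged into one kernel-verified Lean document; each statement's English description precedes it below -/
import Mathlib

section
/- If p is a prime number with τ(p) = 0, then there exists a positive integer h such that p = h·M − 1 where M = 2^14·3^7·5^3·691, the Legendre symbol of (h+1) modulo 23 equals 1, and h mod 49 is one of 0, 30, 48. -/
open Polynomial

/-- The Ramanujan tau function: `ramanujanTau n` is the coefficient of `X ^ n` in the
polynomial `X * ∏_{i=1}^{n} (1 - X ^ i) ^ 24 ∈ ℤ[X]`. -/
noncomputable def ramanujanTau (n : ℕ) : ℤ :=
  ((X : ℤ[X]) * ∏ i ∈ Finset.Icc 1 n, (1 - (X : ℤ[X]) ^ i) ^ 24).coeff n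

instance : Fact (Nat.Prime 23) := ⟨by norm_num⟩


open Polynomial

namespace SerreTau

open Complex Filter Topology
open UpperHalfPlane hiding I

/-- absolutely convergent on the unit disc -/
def QC (F : PowerSeries ℂ) : Prop :=
  ∀ r : ℝ, 0 ≤ r → r < 1 → Summable (fun n => ‖PowerSeries.coeff n F‖ * r ^ n)

/-- value of a power series -/
noncomputable def evq (F : PowerSeries ℂ) (q : ℂ) : ℂ := ∑' n, PowerSeries.coeff n F * q ^ n

/-- the nome -/
noncomputable def qq (z : ℂ) : ℂ := cexp (2 * Real.pi * I * z)

/-- the value at a point of the upper half plane -/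
noncomputable def ev (F : PowerSeries ℂ) (z : ℂ) : ℂ := evq F (qq z)

lemma norm_qq (z : ℂ) : ‖qq z‖ = Real.exp (-(2 * Real.pi * z.im)) := by
  rw [qq, Complex.norm_exp]
  congr 1
  simp

lemma qq_lt {z : ℂ} (hz : 0 < z.im) : ‖qq z‖ < 1 := by
  rw [norm_qq]
  have := mul_pos Real.pi_pos hz
  rw [Real.exp_lt_one_iff]
  nlinarith

lemma QC.summable_norm {F : PowerSeries ℂ} (h : QC F) {q : ℂ} (hq : ‖q‖ < 1) :
    Summable (fun n => ‖PowerSeries.coeff n F * q ^ n‖) := by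
  simpa [norm_mul, norm_pow] using h ‖q‖ (norm_nonneg _) hq

lemma QC.summable {F : PowerSeries ℂ} (h : QC F) {q : ℂ} (hq : ‖q‖ < 1) :
    Summable (fun n => PowerSeries.coeff n F * q ^ n) :=
  (h.summable_norm hq).of_norm

lemma QC.hasSum {F : PowerSeries ℂ} (h : QC F) {q : ℂ} (hq : ‖q‖ < 1) :
    HasSum (fun n => PowerSeries.coeff n F * q ^ n) (evq F q) :=
  (h.summable hq).hasSum

lemma QC.of_summable {F : PowerSeries ℂ}
    (h : ∀ r : ℝ, 0 < r → r < 1 → Summable (fun n => PowerSeries.coeff n F * (r : ℂ) ^ n)) :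
    QC F := by
  intro r h0 h1
  rcases h0.eq_or_lt with rfl | h0
  · exact summable_of_ne_finset_zero (s := {0}) (fun n hn => by
      simp at hn; simp [hn])
  · have := (h r h0 h1).norm
    simpa [norm_mul, norm_pow, abs_of_pos h0] using this

lemma QC.add {F G : PowerSeries ℂ} (hF : QC F) (hG : QC G) : QC (F + G) := by
  intro r h0 h1
  refine Summable.of_nonneg_of_le (fun n => by positivity) (fun n => ?_) ((hF r h0 h1).add (hG r h0 h1))
  rw [map_add, ← add_mul]
  gcongr
  exact norm_add_le _ _

lemma QC.mul {F G : PowerSeries ℂ} (hF : QC F) (hG : QC G) : QC (F * G) := by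
  intro r h0 h1
  have := summable_norm_sum_mul_antidiagonal_of_summable_norm
    (f := fun n => ‖PowerSeries.coeff n F‖ * r ^ n) (g := fun n => ‖PowerSeries.coeff n G‖ * r ^ n)
    (by simpa [abs_of_nonneg h0] using hF r h0 h1) (by simpa [abs_of_nonneg h0] using hG r h0 h1)
  refine Summable.of_nonneg_of_le (fun n => by positivity) (fun n => ?_) this
  rw [PowerSeries.coeff_mul, Real.norm_eq_abs]
  refine le_trans ?_ (le_abs_self _)
  calc _ ≤ (∑ p ∈ Finset.HasAntidiagonal.antidiagonal n, ‖PowerSeries.coeff p.1 F‖ * ‖PowerSeries.coeff p.2 G‖) * r ^ n := by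
        gcongr
        refine (norm_sum_le _ _).trans (le_of_eq ?_)
        exact Finset.sum_congr rfl (fun p _ => norm_mul _ _)
    _ = _ := by
        rw [Finset.sum_mul]
        refine Finset.sum_congr rfl (fun p hp => ?_)
        rw [← Finset.HasAntidiagonal.mem_antidiagonal.mp hp, pow_add]
        ring

lemma QC.C (c : ℂ) : QC (PowerSeries.C c) := by
  intro r _ _
  exact summable_of_ne_finset_zero (s := {0}) (fun n hn => by
      simp at hn; simp [PowerSeries.coeff_C, hn])

lemma QC.X : QC (PowerSeries.X) := by
  intro r _ _
  exact summable_of_ne_finset_zero (s := {1}) (fun n hn => by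
      simp at hn; simp [PowerSeries.coeff_X, hn])

lemma QC.one : QC 1 := by simpa using QC.C 1
lemma QC.ofNat (n : ℕ) [n.AtLeastTwo] : QC (OfNat.ofNat n) := by
  have h := QC.C (OfNat.ofNat n)
  rwa [show (PowerSeries.C (OfNat.ofNat n : ℂ) : PowerSeries ℂ) = OfNat.ofNat n from map_ofNat _ n] at h

lemma QC.neg {F : PowerSeries ℂ} (hF : QC F) : QC (-F) := by
  intro r h0 h1
  simpa using hF r h0 h1

lemma QC.sub {F G : PowerSeries ℂ} (hF : QC F) (hG : QC G) : QC (F - G) := by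
  rw [sub_eq_add_neg]; exact hF.add hG.neg

lemma QC.pow {F : PowerSeries ℂ} (hF : QC F) (n : ℕ) : QC (F ^ n) := by
  induction n with
  | zero => simpa using QC.one
  | succ n ih => rw [pow_succ]; exact ih.mul hF

lemma QC.expand {F : PowerSeries ℂ} (hF : QC F) (m : ℕ) (hm : m ≠ 0) : QC (F.expand m hm) := by
  intro r h0 h1
  have hinj : Function.Injective (fun n : ℕ => m * n) :=
    fun a b h => Nat.eq_of_mul_eq_mul_left (Nat.pos_of_ne_zero hm) h
  rw [← hinj.summable_iff]
  · have := hF (r ^ m) (by positivity) (pow_lt_one₀ h0 h1 hm)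
    refine this.congr (fun n => ?_)
    simp [PowerSeries.coeff_expand_mul, pow_mul]
  · intro x hx
    rw [PowerSeries.coeff_expand_of_not_dvd]
    · simp
    · rintro ⟨k, rfl⟩
      exact hx ⟨k, rfl⟩

lemma evq_add {F G : PowerSeries ℂ} (hF : QC F) (hG : QC G) {q : ℂ} (hq : ‖q‖ < 1) :
    evq (F + G) q = evq F q + evq G q := by
  rw [evq, evq, evq, ← (hF.summable hq).tsum_add (hG.summable hq)]
  simp [add_mul]

lemma evq_mul {F G : PowerSeries ℂ} (hF : QC F) (hG : QC G) {q : ℂ} (hq : ‖q‖ < 1) :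
    evq (F * G) q = evq F q * evq G q := by
  rw [evq, evq, evq, tsum_mul_tsum_eq_tsum_sum_antidiagonal_of_summable_norm
    (hF.summable_norm hq) (hG.summable_norm hq)]
  refine tsum_congr (fun n => ?_)
  rw [PowerSeries.coeff_mul, Finset.sum_mul]
  refine Finset.sum_congr rfl (fun p hp => ?_)
  rw [← Finset.HasAntidiagonal.mem_antidiagonal.mp hp, pow_add]
  ring

lemma evq_C (c : ℂ) (q : ℂ) : evq (PowerSeries.C c) q = c := by
  rw [evq, tsum_eq_single 0]
  · simp
  · intro n hn; simp [PowerSeries.coeff_C, hn]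

lemma evq_X (q : ℂ) : evq (PowerSeries.X) q = q := by
  rw [evq, tsum_eq_single 1]
  · simp
  · intro n hn; simp [PowerSeries.coeff_X, hn]

lemma evq_neg (F : PowerSeries ℂ) (q : ℂ) : evq (-F) q = - evq F q := by
  simp [evq, tsum_neg]

lemma evq_expand (F : PowerSeries ℂ) (m : ℕ) (hm : m ≠ 0) (q : ℂ) :
    evq (F.expand m hm) q = evq F (q ^ m) := by
  have hinj : Function.Injective (fun n : ℕ => m * n) :=
    fun a b h => Nat.eq_of_mul_eq_mul_left (Nat.pos_of_ne_zero hm) h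
  rw [evq, evq, ← hinj.tsum_eq]
  · refine tsum_congr (fun n => ?_)
    simp [PowerSeries.coeff_expand_mul, pow_mul]
  · intro x hx
    by_contra h
    apply hx
    show PowerSeries.coeff x (F.expand m hm) * q ^ x = 0
    rw [PowerSeries.coeff_expand_of_not_dvd]
    · simp
    · rintro ⟨k, rfl⟩
      exact h ⟨k, rfl⟩

/-- the subring of convergent series evaluated: additive and multiplicative laws at z -/
lemma ev_add {F G : PowerSeries ℂ} (hF : QC F) (hG : QC G) {z : ℂ} (hz : 0 < z.im) :
    ev (F + G) z = ev F z + ev G z := evq_add hF hG (qq_lt hz)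
lemma ev_mul {F G : PowerSeries ℂ} (hF : QC F) (hG : QC G) {z : ℂ} (hz : 0 < z.im) :
    ev (F * G) z = ev F z * ev G z := evq_mul hF hG (qq_lt hz)
lemma ev_C (c z : ℂ) : ev (PowerSeries.C c) z = c := evq_C c _
lemma ev_one (z : ℂ) : ev 1 z = 1 := by simpa using ev_C 1 z
lemma ev_ofNat (n : ℕ) [n.AtLeastTwo] (z : ℂ) : ev (OfNat.ofNat n) z = OfNat.ofNat n := by
  have h := ev_C (OfNat.ofNat n) z
  rwa [show (PowerSeries.C (OfNat.ofNat n : ℂ) : PowerSeries ℂ) = OfNat.ofNat n from map_ofNat _ n] at h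
lemma ev_X (z : ℂ) : ev PowerSeries.X z = qq z := evq_X _
lemma ev_neg (F : PowerSeries ℂ) (z : ℂ) : ev (-F) z = - ev F z := evq_neg F _
lemma ev_sub {F G : PowerSeries ℂ} (hF : QC F) (hG : QC G) {z : ℂ} (hz : 0 < z.im) :
    ev (F - G) z = ev F z - ev G z := by
  rw [sub_eq_add_neg, ev_add hF hG.neg hz, ev_neg, sub_eq_add_neg]
lemma ev_pow {F : PowerSeries ℂ} (hF : QC F) (n : ℕ) {z : ℂ} (hz : 0 < z.im) :
    ev (F ^ n) z = ev F z ^ n := by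
  induction n with
  | zero => simp [ev_one]
  | succ n ih => rw [pow_succ, ev_mul (hF.pow n) hF hz, ih, pow_succ]
lemma ev_expand (F : PowerSeries ℂ) (m : ℕ) (hm : m ≠ 0) (z : ℂ) :
    ev (F.expand m hm) z = ev F (m * z) := by
  rw [ev, evq_expand, ev, qq, qq, ← Complex.exp_nat_mul]
  congr 2
  ring

/-- the Euler derivation -/
noncomputable def th (R : Type*) [CommRing R] : Derivation R (PowerSeries R) (PowerSeries R) :=
  (PowerSeries.X : PowerSeries R) • PowerSeries.derivative R

lemma coeff_th {R : Type*} [CommRing R] (F : PowerSeries R) (n : ℕ) :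
    PowerSeries.coeff n (th R F) = n * PowerSeries.coeff n F := by
  cases n with
  | zero => simp [th]
  | succ n => simp [th, PowerSeries.coeff_succ_X_mul, PowerSeries.coeff_derivative, mul_comm]

lemma QC.th {F : PowerSeries ℂ} (hF : QC F) : QC (th ℂ F) := by
  intro r h0 h1
  obtain ⟨s, hs, hs1⟩ := exists_between h1
  have hs0 : 0 < s := lt_of_le_of_lt h0 hs
  have h2 := hF s hs0.le hs1
  have h3 : Tendsto (fun n : ℕ => (n : ℝ) ^ 1 * (r / s) ^ n) atTop (𝓝 0) :=
    tendsto_pow_const_mul_const_pow_of_lt_one 1 (by positivity) ((div_lt_one hs0).2 hs)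
  have h4 : ∀ᶠ n : ℕ in atTop, (n : ℝ) ^ 1 * (r / s) ^ n < 1 := h3.eventually (gt_mem_nhds one_pos)
  refine Summable.of_norm_bounded_eventually_nat h2 ?_
  filter_upwards [h4] with n hn
  rw [coeff_th]
  have : r ^ n = (r / s) ^ n * s ^ n := by rw [← mul_pow, div_mul_cancel₀ _ hs0.ne']
  simp only [norm_mul, Complex.norm_natCast, norm_pow, Real.norm_eq_abs, abs_norm, Nat.abs_cast,
    abs_of_nonneg h0]
  rw [this]
  calc _ = ((n : ℝ) ^ 1 * (r / s) ^ n) * (‖PowerSeries.coeff n F‖ * s ^ n) := by ring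
    _ ≤ 1 * (‖PowerSeries.coeff n F‖ * s ^ n) := by gcongr
    _ = _ := one_mul _

lemma ev_eq_tsum (F : PowerSeries ℂ) (z : ℂ) :
    ev F z = ∑' n : ℕ, PowerSeries.coeff n F * cexp (n * (2 * Real.pi * I * z)) := by
  simp [ev, evq, qq, Complex.exp_nat_mul]

lemma hasDerivAt_ev {F : PowerSeries ℂ} (hF : QC F) {z : ℂ} (hz : 0 < z.im) :
    HasDerivAt (ev F) (2 * Real.pi * I * ev (th ℂ F) z) z := by
  obtain ⟨c, hc0, hc⟩ := exists_between hz
  have hU : IsOpen {w : ℂ | c < w.im} := isOpen_lt continuous_const Complex.continuous_im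
  set f : ℕ → ℂ → ℂ := fun n w => PowerSeries.coeff n F * cexp (n * (2 * Real.pi * I * w)) with hf
  have hfe : ev F = fun w => ∑' n, f n w := by
    funext w; rw [ev_eq_tsum]
  have hd : ∀ n w, HasDerivAt (f n)
      (PowerSeries.coeff n F * (cexp (n * (2 * Real.pi * I * w)) * (n * (2 * Real.pi * I)))) w := by
    intro n w
    refine HasDerivAt.const_mul _ (HasDerivAt.cexp ?_)
    simpa using ((hasDerivAt_id w).const_mul (2 * Real.pi * I)).const_mul (n : ℂ)
  have hr : ‖qq (c * I)‖ < 1 := qq_lt (by simpa using hc0)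
  have hu := hF _ (norm_nonneg _) hr
  have hle : ∀ (n : ℕ) (w : ℂ), w ∈ {w : ℂ | c < w.im} →
      ‖f n w‖ ≤ ‖PowerSeries.coeff n F‖ * ‖qq (c * I)‖ ^ n := by
    intro n w hw
    rw [hf]
    simp only [norm_mul, Complex.exp_nat_mul, norm_pow]
    gcongr
    change ‖qq w‖ ≤ _
    rw [norm_qq, norm_qq]
    simp only [Set.mem_ofPred_eq] at hw
    simp
    have := Real.pi_pos
    nlinarith
  have hdiff : ∀ n, DifferentiableOn ℂ (f n) {w : ℂ | c < w.im} :=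
    fun n w _ => (hd n w).differentiableAt.differentiableWithinAt
  have h1 := Complex.hasSum_deriv_of_summable_norm hu hdiff hU hle (z := z) hc
  have h2 := Complex.differentiableOn_tsum_of_summable_norm hu hdiff hU hle
  have h3 := (h2.differentiableAt (hU.mem_nhds hc)).hasDerivAt
  rw [← hfe] at h1 h3
  suffices h4 : deriv (ev F) z = 2 * Real.pi * I * ev (th ℂ F) z by
    rw [← h4]; exact h3
  rw [← h1.tsum_eq, ev_eq_tsum, ← tsum_mul_left]
  refine tsum_congr (fun n => ?_)
  rw [(hd n z).deriv, coeff_th]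
  ring

end SerreTau

open Polynomial

namespace SerreTau

open Complex Filter Topology
open UpperHalfPlane hiding I
open ModularForm SlashInvariantForm MatrixGroups

/-- transformation of weight `k` under inversion -/
def SW (k : ℕ) (F : PowerSeries ℂ) : Prop :=
  ∀ z : ℂ, 0 < z.im → ev F (-1 / z) = z ^ k * ev F z

/-- restriction to the upper half plane -/
noncomputable def evH (F : PowerSeries ℂ) : ℍ → ℂ := fun τ => ev F (τ : ℂ)

lemma evH_hasSum {F : PowerSeries ℂ} (hF : QC F) (τ : ℍ) :
    HasSum (fun m => (PowerSeries.coeff m F) • (Function.Periodic.qParam 1 (τ : ℂ)) ^ m) (evH F τ) := by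
  have := hF.hasSum (qq_lt τ.im_pos)
  simpa [evH, ev, qq, Function.Periodic.qParam] using this

lemma qq_add_one (z : ℂ) : qq (z + 1) = qq z := by
  rw [qq, qq, mul_add, mul_one, Complex.exp_periodic]

lemma ev_add_one (F : PowerSeries ℂ) (z : ℂ) : ev F (z + 1) = ev F z := by
  rw [ev, ev, qq_add_one]

lemma evH_slash_T (F : PowerSeries ℂ) (k : ℤ) : (evH F ∣[k] ModularGroup.T) = evH F := by
  ext z
  rw [SL_slash_apply, modular_T_smul]
  have hd : denom (ModularGroup.T : GL (Fin 2) ℝ) (z : ℂ) = 1 := by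
    rw [ModularGroup.denom_apply]
    simp [ModularGroup.T]
  rw [hd]
  have : ((((1 : ℝ) +ᵥ z : ℍ)) : ℂ) = z + 1 := by rw [coe_vadd]; push_cast; ring
  simp [evH, this, ev_add_one]

lemma evH_slash_S {F : PowerSeries ℂ} {k : ℕ} (h : SW k F) :
    (evH F ∣[(k : ℤ)] ModularGroup.S) = evH F := by
  ext z
  rw [SL_slash_apply, UpperHalfPlane.modular_S_smul]
  have h1 := h z z.im_pos
  have h2 : (-1 / (z : ℂ)) = (-(z : ℂ))⁻¹ := by rw [neg_div, one_div, inv_neg]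
  rw [h2] at h1
  have : (z : ℂ) ≠ 0 := z.ne_zero
  rw [ModularGroup.denom_S]
  simp only [evH]
  simp at h1 ⊢
  rw [h1]
  field_simp

/-- modular form attached to a series -/
noncomputable def toMF {F : PowerSeries ℂ} (hF : QC F) {k : ℕ} (h : SW k F) :
    ModularForm 𝒮ℒ (k : ℤ) where
  toFun := evH F
  slash_action_eq' A hA := by
    obtain ⟨A, rfl⟩ := hA
    exact slash_action_generators_SL2Z (evH_slash_S h) (evH_slash_T F k) A
  holo' := by
    rw [UpperHalfPlane.mdifferentiable_iff]
    refine .congr (fun z hz ↦ (hasDerivAt_ev hF hz).differentiableAt.differentiableWithinAt)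
      fun z hz ↦ ?_
    simp [evH, ofComplex_apply_of_im_pos hz]
  bdd_at_cusps' hc := by
    rw [Subgroup.IsArithmetic.isCusp_iff_isCusp_SL2Z] at hc
    rw [OnePoint.isBoundedAt_iff_forall_SL2Z hc]
    intro γ _
    rw [slash_action_generators_SL2Z (evH_slash_S h) (evH_slash_T F k)]
    exact isBoundedAtImInfty_of_hasSum_qExpansion one_pos (evH_hasSum hF)

lemma toMF_qExpansion {F : PowerSeries ℂ} (hF : QC F) {k : ℕ} (h : SW k F) :
    qExpansion 1 (toMF hF h) = F := by
  ext m
  exact (ModularFormClass.qExpansion_coeff_unique one_pos one_mem_strictPeriods_SL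
    (f := toMF hF h) (evH_hasSum hF) m).symm

lemma ev_inj {F G : PowerSeries ℂ} (hF : QC F) (hG : QC G)
    (h : ∀ z : ℂ, 0 < z.im → ev F z = ev G z) : F = G := by
  suffices h0 : F - G = 0 from sub_eq_zero.mp h0
  have hFG := hF.sub hG
  have h1 : ∀ z : ℂ, 0 < z.im → ev (F - G) z = 0 := fun z hz => by
    rw [ev_sub hF hG hz, h z hz, sub_self]
  have hS : SW 0 (F - G) := by
    intro z hz
    rw [h1 z hz, h1 _ ?_, mul_zero]
    rw [neg_div, one_div, ← inv_neg, Complex.inv_im]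
    have : 0 < normSq (-z) := normSq_pos.mpr (by rintro h; rw [neg_eq_zero] at h; simp [h] at hz)
    simp only [neg_im, neg_neg]
    positivity
  rw [← toMF_qExpansion hFG hS]
  have : toMF hFG hS = 0 := by
    ext τ
    exact h1 τ τ.im_pos
  rw [this]
  exact qExpansion_zero 1

lemma sturm {F : PowerSeries ℂ} (hF : QC F) {k : ℕ} (h : SW k F)
    (h0 : ∀ n ≤ k / 12, PowerSeries.coeff n F = 0) : F = 0 := by
  have h1 : ((k / 12 : ℕ) : ℕ∞) < (qExpansion 1 (toMF hF h)).order := by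
    rw [toMF_qExpansion]
    refine lt_of_lt_of_le (b := ((k / 12 + 1 : ℕ) : ℕ∞)) (by exact_mod_cast Nat.lt_succ_self _) ?_
    exact PowerSeries.nat_le_order _ _ (fun i hi => h0 i (Nat.lt_succ_iff.mp hi))
  have h2 := ModularForm.sturm_bound_levelOne_nat h1
  rw [← toMF_qExpansion hF h, h2]
  exact qExpansion_zero 1

lemma im_S {z : ℂ} (hz : 0 < z.im) : 0 < (-1 / z).im := by
  rw [neg_div, one_div, ← inv_neg, Complex.inv_im]
  have : 0 < normSq (-z) := normSq_pos.mpr (by rintro h; rw [neg_eq_zero] at h; simp [h] at hz)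
  simp only [neg_im, neg_neg]
  positivity

/-- modular form gives SW and QC -/
lemma MF_QC {k : ℤ} (f : ModularForm 𝒮ℒ k) : QC (qExpansion 1 f) := by
  apply QC.of_summable
  intro r h0 h1
  have := UpperHalfPlane.hasSum_qExpansion_of_norm_lt (f := f) one_pos
    (SlashInvariantFormClass.periodic_comp_ofComplex f one_mem_strictPeriods_SL)
    (ModularFormClass.holo f) (ModularFormClass.bdd_at_infty f) (q := (r : ℂ))
    (by simpa [abs_of_pos h0] using h1)
  simpa using this.summable

lemma MF_ev {k : ℤ} (f : ModularForm 𝒮ℒ k) (τ : ℍ) : ev (qExpansion 1 f) τ = f τ := by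
  have h1 := ModularForm.hasSum_qExpansion f one_pos one_mem_strictPeriods_SL τ
  have h2 := evH_hasSum (MF_QC f) τ
  exact h2.unique (by simpa using h1)

lemma MF_SW {k : ℕ} (f : ModularForm 𝒮ℒ (k : ℤ)) : SW k (qExpansion 1 f) := by
  intro z hz
  have h1 := MF_ev f ⟨z, hz⟩
  have h2 := MF_ev f ⟨-1 / z, im_S hz⟩
  simp only [UpperHalfPlane.coe_mk] at h1 h2
  rw [h1, h2]
  have h3 := congrFun (SlashInvariantForm.slash_action_eqn f (ModularGroup.S : GL (Fin 2) ℝ)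
    ⟨ModularGroup.S, rfl⟩) ⟨z, hz⟩
  have hz0 : z ≠ 0 := by rintro rfl; simp at hz
  have h4 := h3
  change (⇑f ∣[(k:ℤ)] ModularGroup.S) _ = _ at h4
  rw [SL_slash_apply, UpperHalfPlane.modular_S_smul] at h4
  rw [← h4]
  have h5 : (-1 / z) = (-z)⁻¹ := by rw [neg_div, one_div, inv_neg]
  rw [ModularGroup.denom_S]
  simp [h5]
  field_simp

end SerreTau

open Polynomial

namespace SerreTau

open Complex Filter Topology
open UpperHalfPlane hiding I
open ModularForm SlashInvariantForm MatrixGroups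

/-- divisor-sum series -/
noncomputable def Sg (k : ℕ) : PowerSeries ℤ := PowerSeries.mk fun n => (ArithmeticFunction.sigma k n : ℤ)

lemma coeff_Sg (k n : ℕ) : PowerSeries.coeff n (Sg k) = (ArithmeticFunction.sigma k n : ℤ) := by
  simp [Sg]

/-- base change to the complex numbers -/
noncomputable def cz : PowerSeries ℤ →+* PowerSeries ℂ := PowerSeries.map (Int.castRingHom ℂ)

lemma coeff_cz (F : PowerSeries ℤ) (n : ℕ) :
    PowerSeries.coeff n (cz F) = ((PowerSeries.coeff n F : ℤ) : ℂ) := by simp [cz]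

lemma cz_inj {F G : PowerSeries ℤ} (h : cz F = cz G) : F = G := by
  ext n
  have := congrArg (PowerSeries.coeff n) h
  rw [coeff_cz, coeff_cz] at this
  exact_mod_cast this

lemma cz_th (F : PowerSeries ℤ) : cz (th ℤ F) = th ℂ (cz F) := by
  ext n
  simp [coeff_cz, coeff_th]

lemma cz_expand (F : PowerSeries ℤ) (m : ℕ) (hm : m ≠ 0) :
    cz (F.expand m hm) = (cz F).expand m hm := by
  simp [cz, PowerSeries.map_expand]

lemma cz_X : cz PowerSeries.X = PowerSeries.X := by simp [cz]

lemma QC_Sg (k : ℕ) : QC (cz (Sg k)) := by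
  intro r h0 h1
  refine Summable.of_nonneg_of_le (fun n => by positivity) (fun n => ?_)
    (summable_pow_mul_geometric_of_norm_lt_one (k + 1) (r := r) (by simpa [abs_of_nonneg h0] using h1))
  rw [coeff_cz, coeff_Sg]
  gcongr
  have := ArithmeticFunction.sigma_le_pow_succ k n
  simp only [Int.cast_natCast, Complex.norm_natCast]
  exact_mod_cast this

/-- weight-two Eisenstein series -/
noncomputable def eP : PowerSeries ℤ := 1 - 24 * Sg 1
/-- weight-four Eisenstein series -/
noncomputable def eQ : PowerSeries ℤ := 1 + 240 * Sg 3
/-- weight-six Eisenstein series -/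
noncomputable def eR : PowerSeries ℤ := 1 - 504 * Sg 5

lemma QC_P : QC (cz eP) := by
  simp only [eP, map_sub, map_one, map_mul, map_ofNat]
  exact QC.one.sub ((QC.ofNat _).mul (QC_Sg 1))

/-- convergent and modular -/
def Md (k : ℕ) (F : PowerSeries ℂ) : Prop := QC F ∧ SW k F

lemma Md.add {k : ℕ} {F G : PowerSeries ℂ} (hF : Md k F) (hG : Md k G) : Md k (F + G) :=
  ⟨hF.1.add hG.1, fun z hz => by
    rw [ev_add hF.1 hG.1 (im_S hz), ev_add hF.1 hG.1 hz, hF.2 z hz, hG.2 z hz, mul_add]⟩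

lemma Md.sub {k : ℕ} {F G : PowerSeries ℂ} (hF : Md k F) (hG : Md k G) : Md k (F - G) :=
  ⟨hF.1.sub hG.1, fun z hz => by
    rw [ev_sub hF.1 hG.1 (im_S hz), ev_sub hF.1 hG.1 hz, hF.2 z hz, hG.2 z hz, mul_sub]⟩

lemma Md.mul {k l : ℕ} {F G : PowerSeries ℂ} (hF : Md k F) (hG : Md l G) : Md (k + l) (F * G) :=
  ⟨hF.1.mul hG.1, fun z hz => by
    rw [ev_mul hF.1 hG.1 (im_S hz), ev_mul hF.1 hG.1 hz, hF.2 z hz, hG.2 z hz, pow_add]; ring⟩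

lemma Md.pow {k : ℕ} {F : PowerSeries ℂ} (hF : Md k F) (n : ℕ) : Md (k * n) (F ^ n) :=
  ⟨hF.1.pow n, fun z hz => by
    rw [ev_pow hF.1 n (im_S hz), ev_pow hF.1 n hz, hF.2 z hz, mul_pow, pow_mul]⟩

lemma Md.one : Md 0 1 := ⟨QC.one, fun z _ => by simp [ev_one]⟩
lemma Md.C (c : ℂ) : Md 0 (PowerSeries.C c) := ⟨QC.C c, fun z _ => by simp [ev_C]⟩
lemma Md.ofNat (n : ℕ) [n.AtLeastTwo] : Md 0 (OfNat.ofNat n) :=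
  ⟨QC.ofNat n, fun z _ => by simp [ev_ofNat]⟩
lemma Md.cmul {k : ℕ} {F : PowerSeries ℂ} (n : ℕ) [n.AtLeastTwo] (hF : Md k F) :
    Md k (OfNat.ofNat n * F) := by
  have := (Md.ofNat n).mul hF
  rwa [zero_add] at this

lemma Md.zero_of {k : ℕ} {F : PowerSeries ℂ} (h : Md k F)
    (h0 : ∀ n ≤ k / 12, PowerSeries.coeff n F = 0) : F = 0 := sturm h.1 h.2 h0

open EisensteinSeries in
lemma E_eq {k : ℕ} (hk : 3 ≤ k) (hk2 : Even k) : qExpansion 1 (ModularForm.E hk) =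
    1 + PowerSeries.C (-(2 * k / _root_.bernoulli k : ℂ)) * cz (Sg (k - 1)) := by
  ext n
  rw [E_qExpansion_coeff hk hk2, map_add, PowerSeries.coeff_C_mul, coeff_cz, coeff_Sg,
    PowerSeries.coeff_one]
  split_ifs with h
  · simp [h]
  · simp

lemma Md_E {k : ℕ} (hk : 3 ≤ k) (hk2 : Even k) {c : ℂ} (hc : -(2 * k / _root_.bernoulli k : ℂ) = c) :
    Md k (1 + PowerSeries.C c * cz (Sg (k - 1))) := by
  rw [← hc, ← E_eq hk hk2]
  exact ⟨MF_QC _, MF_SW _⟩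

lemma bern4 : _root_.bernoulli 4 = -1/30 := by decide +kernel
lemma bern6 : _root_.bernoulli 6 = 1/42 := by decide +kernel
lemma bern8 : _root_.bernoulli 8 = -1/30 := by decide +kernel
lemma bern10 : _root_.bernoulli 10 = 5/66 := by decide +kernel
lemma bern12 : _root_.bernoulli 12 = -691/2730 := by decide +kernel

lemma Md_Q : Md 4 (cz eQ) := by
  have := Md_E (k := 4) (c := 240) (by norm_num) (by decide) (by rw [bern4]; push_cast; norm_num)
  rw [map_ofNat] at this
  rw [eQ, map_add, map_one, map_mul, map_ofNat]; exact this

lemma Md_R : Md 6 (cz eR) := by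
  have := Md_E (k := 6) (c := -504) (by norm_num) (by decide) (by rw [bern6]; push_cast; norm_num)
  rw [map_neg, map_ofNat, neg_mul, ← sub_eq_add_neg] at this
  rw [eR, map_sub, map_one, map_mul, map_ofNat]; exact this

lemma Md_8 : Md 8 (cz (1 + 480 * Sg 7)) := by
  have := Md_E (k := 8) (c := 480) (by norm_num) (by decide) (by rw [bern8]; push_cast; norm_num)
  rw [map_ofNat] at this
  rw [map_add, map_one, map_mul, map_ofNat]; exact this

lemma Md_10 : Md 10 (cz (1 - 264 * Sg 9)) := by
  have := Md_E (k := 10) (c := -264) (by norm_num) (by decide) (by rw [bern10]; push_cast; norm_num)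
  rw [map_neg, map_ofNat, neg_mul, ← sub_eq_add_neg] at this
  rw [map_sub, map_one, map_mul, map_ofNat]; exact this

lemma Md_12 : Md 12 (cz (691 + 65520 * Sg 11)) := by
  have := Md_E (k := 12) (c := 65520 / 691) (by norm_num) (by decide) (by rw [bern12]; push_cast; norm_num)
  have h2 := Md.cmul 691 this
  have h3 : (OfNat.ofNat 691 : PowerSeries ℂ) * (1 + PowerSeries.C (65520 / 691) * cz (Sg (12 - 1)))
      = cz (691 + 65520 * Sg 11) := by
    have : (691 : PowerSeries ℂ) * PowerSeries.C (65520 / 691) = 65520 := by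
      rw [← map_ofNat (PowerSeries.C (R := ℂ)) 691, ← map_mul, ← map_ofNat (PowerSeries.C (R := ℂ)) 65520]
      norm_num
    simp only [map_add, map_mul, map_ofNat]
    linear_combination (cz (Sg 11)) * this
  rwa [h3] at h2

open EisensteinSeries in
lemma ev_P (τ : ℍ) : ev (cz eP) τ = E2 τ := by
  have h1 := hasSum_qExpansion_E2 (z := τ)
  have h2 := QC_P.hasSum (qq_lt τ.im_pos)
  refine h2.unique ?_
  convert h1 using 1
  ext n
  have : cz eP = 1 - PowerSeries.C 24 * cz (Sg 1) := by
    rw [eP, map_sub, map_one, map_mul, map_ofNat, map_ofNat]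
  rw [this, map_sub, PowerSeries.coeff_C_mul, coeff_cz, coeff_Sg, PowerSeries.coeff_one, qq, smul_eq_mul]
  split_ifs with h
  · simp [h]
  · simp

open EisensteinSeries in
lemma P_S {z : ℂ} (hz : 0 < z.im) :
    ev (cz eP) (-1 / z) = z ^ 2 * ev (cz eP) z + 6 * z / (Real.pi * I) := by
  have h2 := ev_P ⟨-1 / z, im_S hz⟩
  obtain ⟨τ, rfl⟩ : ∃ τ : ℍ, (τ : ℂ) = z := ⟨⟨z, hz⟩, rfl⟩
  simp only at h2
  rw [ev_P, h2]
  have hz0 : (τ : ℂ) ≠ 0 := τ.ne_zero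
  have h4 := congrFun (E2_slash_action ModularGroup.S) τ
  rw [SL_slash_apply, UpperHalfPlane.modular_S_smul, ModularGroup.denom_S] at h4
  have h5 : (-1 / (τ : ℂ)) = (-(τ : ℂ))⁻¹ := by rw [neg_div, one_div, inv_neg]
  simp only [h5]
  simp only [Pi.sub_apply, Pi.smul_apply, D2, ModularGroup.denom_S, smul_eq_mul, riemannZeta_two,
    show ModularGroup.S 1 0 = 1 by simp [ModularGroup.S]] at h4
  have hpi : (Real.pi : ℂ) ≠ 0 := by exact_mod_cast Real.pi_ne_zero
  rw [zpow_neg, ← div_eq_mul_inv, div_eq_iff (zpow_ne_zero _ hz0)] at h4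
  rw [h4, zpow_ofNat]
  have hI := I_ne_zero
  field_simp
  push_cast
  linear_combination (-6 : ℂ) * I_sq

/-- differentiating the inversion formula -/
lemma th_S {F : PowerSeries ℂ} (hF : QC F) {φ : ℂ → ℂ} {d z : ℂ} (hz : 0 < z.im)
    (h : ∀ w : ℂ, 0 < w.im → ev F (-1 / w) = φ w) (hd : HasDerivAt φ d z) :
    2 * Real.pi * I * ev (th ℂ F) (-1 / z) = z ^ 2 * d := by
  have hz0 : z ≠ 0 := by rintro rfl; simp at hz
  have h1 : HasDerivAt (fun w : ℂ => -1 / w) (1 / z ^ 2) z := by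
    have := (hasDerivAt_inv hz0).neg
    refine (this.congr_deriv ?_).congr_of_eventuallyEq ?_
    · field_simp; 
    · refine Filter.Eventually.of_forall (fun w => ?_)
      simp [neg_div]
  have h2 := (hasDerivAt_ev hF (im_S hz)).comp z h1
  have h3 : (ev F ∘ fun w : ℂ => -1 / w) =ᶠ[𝓝 z] φ := by
    filter_upwards [(isOpen_lt continuous_const Complex.continuous_im).mem_nhds hz] with w hw
    exact h w hw
  have h4 := (h2.congr_of_eventuallyEq h3.symm).unique hd
  rw [← h4]
  field_simp

lemma Md.serre {k : ℕ} {F : PowerSeries ℂ} (hF : Md k F) :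
    Md (k + 2) (12 * th ℂ F - PowerSeries.C (k : ℂ) * (cz eP * F)) := by
  have q1 := (QC.ofNat 12).mul hF.1.th
  have q2 := QC_P.mul hF.1
  have q3 := (QC.C (k : ℂ)).mul q2
  refine ⟨q1.sub q3, fun z hz => ?_⟩
  have hz0 : z ≠ 0 := by rintro rfl; simp at hz
  have hd : HasDerivAt (fun w => w ^ k * ev F w)
      (k * z ^ (k - 1) * ev F z + z ^ k * (2 * Real.pi * I * ev (th ℂ F) z)) z :=
    (hasDerivAt_pow k z).mul (hasDerivAt_ev hF.1 hz)
  have h1 := th_S hF.1 hz hF.2 hd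
  have e : ∀ w : ℂ, 0 < w.im → ev (12 * th ℂ F - PowerSeries.C (k : ℂ) * (cz eP * F)) w
      = 12 * ev (th ℂ F) w - k * (ev (cz eP) w * ev F w) := by
    intro w hw
    rw [ev_sub q1 q3 hw, ev_mul (QC.ofNat 12) hF.1.th hw, ev_mul (QC.C _) q2 hw, ev_mul QC_P hF.1 hw,
      ev_ofNat, ev_C]
  rw [e _ (im_S hz), e _ hz, P_S hz, hF.2 z hz]
  have hpi : (Real.pi : ℂ) ≠ 0 := by exact_mod_cast Real.pi_ne_zero
  have hI := I_ne_zero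
  have h2 : ev (th ℂ F) (-1 / z) =
      z ^ 2 * (k * z ^ (k - 1) * ev F z + z ^ k * (2 * Real.pi * I * ev (th ℂ F) z)) / (2 * Real.pi * I) := by
    rw [← h1]; field_simp
  rw [h2]
  have h3 : (k : ℂ) * z ^ (k - 1) * z = k * z ^ k := by
    cases k with
    | zero => simp
    | succ n => simp [pow_succ]; ring
  have h4 : z ^ 2 * (k * z ^ (k - 1) * ev F z + z ^ k * (2 * Real.pi * I * ev (th ℂ F) z))
     = z * (k * z ^ k) * ev F z + z ^ 2 * z ^ k * (2 * Real.pi * I * ev (th ℂ F) z) := by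
    rw [← h3]; ring
  rw [h4]
  field_simp
  ring

lemma Md_thP : Md 4 (12 * th ℂ (cz eP) - (cz eP) ^ 2) := by
  have q1 := (QC.ofNat 12).mul QC_P.th
  have q2 := QC_P.pow 2
  refine ⟨q1.sub q2, fun z hz => ?_⟩
  have hz0 : z ≠ 0 := by rintro rfl; simp at hz
  have hd : HasDerivAt (fun w => w ^ 2 * ev (cz eP) w + 6 * w / (Real.pi * I))
      (2 * z * ev (cz eP) z + z ^ 2 * (2 * Real.pi * I * ev (th ℂ (cz eP)) z)
        + 6 / (Real.pi * I)) z := by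
    have a := (hasDerivAt_pow 2 z).mul (hasDerivAt_ev QC_P hz)
    have b := ((hasDerivAt_id z).const_mul 6).div_const (Real.pi * I)
    refine (a.add b).congr_deriv ?_
    simp
  have h1 := th_S QC_P hz (fun w hw => P_S hw) hd
  have e : ∀ w : ℂ, 0 < w.im → ev (12 * th ℂ (cz eP) - (cz eP) ^ 2) w
      = 12 * ev (th ℂ (cz eP)) w - (ev (cz eP) w) ^ 2 := by
    intro w hw
    rw [ev_sub q1 q2 hw, ev_mul (QC.ofNat 12) QC_P.th hw, ev_pow QC_P 2 hw,
      ev_ofNat]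
  rw [e _ (im_S hz), e _ hz, P_S hz]
  have hpi : (Real.pi : ℂ) ≠ 0 := by exact_mod_cast Real.pi_ne_zero
  have hI := I_ne_zero
  have h2 : ev (th ℂ (cz eP)) (-1 / z) =
      z ^ 2 * (2 * z * ev (cz eP) z + z ^ 2 * (2 * Real.pi * I * ev (th ℂ (cz eP)) z)
        + 6 / (Real.pi * I)) / (2 * Real.pi * I) := by
    rw [← h1]; field_simp
  rw [h2]
  field_simp
  ring

end SerreTau

open Polynomial

namespace SerreTau

open Complex Filter Topology

instance instCharZeroPS : CharZero (PowerSeries ℤ) :=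
  charZero_of_injective_algebraMap (R := ℤ) (PowerSeries.C_injective)

lemma coeff_ofNat_mul {R : Type*} [CommRing R] (m n : ℕ) [n.AtLeastTwo] (F : PowerSeries R) :
    PowerSeries.coeff m ((no_index (OfNat.ofNat n : PowerSeries R)) * F)
      = OfNat.ofNat n * PowerSeries.coeff m F := by
  rw [← map_ofNat (PowerSeries.C (R := R)) n, PowerSeries.coeff_C_mul]

lemma sig1 (k : ℕ) : ArithmeticFunction.sigma k 1 = 1 := by simp

lemma c0_Sg (k : ℕ) : PowerSeries.constantCoeff (Sg k) = 0 := by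
  rw [← PowerSeries.coeff_zero_eq_constantCoeff_apply, coeff_Sg]; simp
lemma c1_Sg (k : ℕ) : PowerSeries.coeff 1 (Sg k) = 1 := by
  rw [coeff_Sg]; simp

/-- integral Sturm bound -/
lemma zsturm {k : ℕ} {F : PowerSeries ℤ} (h : Md k (cz F)) (hk : k < 24)
    (h0 : PowerSeries.constantCoeff F = 0) (h1 : k < 12 ∨ PowerSeries.coeff 1 F = 0) : F = 0 := by
  apply cz_inj
  rw [map_zero]
  apply h.zero_of
  intro n hn
  rw [coeff_cz]
  have : n = 0 ∨ (n = 1 ∧ 12 ≤ k) := by omega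
  rcases this with rfl | ⟨rfl, h2⟩
  · simp [h0]
  · rcases h1 with h1 | h1
    · omega
    · simp [h1]

lemma cc_th (F : PowerSeries ℤ) : PowerSeries.constantCoeff (th ℤ F) = 0 := by
  rw [← PowerSeries.coeff_zero_eq_constantCoeff_apply, coeff_th]; simp

lemma cc_ofNat (n : ℕ) [n.AtLeastTwo] :
    PowerSeries.constantCoeff (no_index (OfNat.ofNat n : PowerSeries ℤ)) = OfNat.ofNat n := map_ofNat _ n

lemma coeff1_mul (F G : PowerSeries ℤ) : PowerSeries.coeff 1 (F * G) =
    PowerSeries.constantCoeff F * PowerSeries.coeff 1 G + PowerSeries.coeff 1 F * PowerSeries.constantCoeff G := by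
  rw [PowerSeries.coeff_mul]
  simp [Finset.Nat.antidiagonal_succ]

lemma coeff1_ofNat (n : ℕ) [n.AtLeastTwo] :
    PowerSeries.coeff 1 (no_index (OfNat.ofNat n : PowerSeries ℤ)) = 0 := by
  rw [← map_ofNat (PowerSeries.C (R := ℤ)) n, PowerSeries.coeff_C]; simp

lemma coeff1_one : PowerSeries.coeff 1 (1 : PowerSeries ℤ) = 0 := by
  rw [PowerSeries.coeff_one]; simp

lemma Qsq : eQ ^ 2 = 1 + 480 * Sg 7 := by
  rw [← sub_eq_zero]
  refine zsturm (k := 8) ?_ (by norm_num) ?_ (Or.inl (by norm_num))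
  · rw [map_sub, map_pow]; exact (Md_Q.pow 2).sub Md_8
  · simp [eQ, c0_Sg]

lemma QRmul : eQ * eR = 1 - 264 * Sg 9 := by
  rw [← sub_eq_zero]
  refine zsturm (k := 10) ?_ (by norm_num) ?_ (Or.inl (by norm_num))
  · rw [map_sub, map_mul]; exact (Md_Q.mul Md_R).sub Md_10
  · simp [eQ, eR, c0_Sg]

lemma E12 : 441 * eQ ^ 3 + 250 * eR ^ 2 = 691 + 65520 * Sg 11 := by
  rw [← sub_eq_zero]
  refine zsturm (k := 12) ?_ (by norm_num) ?_ (Or.inr ?_)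
  · rw [map_sub, map_add, map_mul, map_mul, map_pow, map_pow, map_ofNat, map_ofNat]
    exact (((Md_Q.pow 3).cmul 441).add ((Md_R.pow 2).cmul 250)).sub Md_12
  · simp only [eQ, eR, map_sub, map_add, map_mul, map_pow, c0_Sg, cc_ofNat, map_one]; norm_num
  · simp only [eQ, eR, map_sub, map_add, coeff1_mul, pow_succ, pow_zero, c0_Sg, c1_Sg, cc_ofNat, map_one,
      coeff1_ofNat, coeff1_one, map_mul]
    norm_num

lemma thQ : 3 * th ℤ eQ = eP * eQ - eR := by
  have h : 12 * th ℤ eQ - 4 * (eP * eQ) + 4 * eR = 0 := by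
    refine zsturm (k := 6) ?_ (by norm_num) ?_ (Or.inl (by norm_num))
    · have := (Md_Q.serre).add (Md_R.cmul 4)
      simp only [Nat.cast_ofNat, map_ofNat] at this
      simp only [map_sub, map_add, map_mul, map_ofNat, cz_th]
      exact this
    · simp only [eQ, eR, eP, map_sub, map_add, map_mul, map_pow, c0_Sg, cc_ofNat, map_one, cc_th]; norm_num
  have h4 : (4 : PowerSeries ℤ) * (3 * th ℤ eQ - (eP * eQ - eR)) = 0 := by linear_combination h
  have h5 : (4 : PowerSeries ℤ) ≠ 0 := by norm_num
  exact sub_eq_zero.mp ((mul_eq_zero.mp h4).resolve_left h5)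

lemma thR : 2 * th ℤ eR = eP * eR - eQ ^ 2 := by
  have h : 12 * th ℤ eR - 6 * (eP * eR) + 6 * eQ ^ 2 = 0 := by
    refine zsturm (k := 8) ?_ (by norm_num) ?_ (Or.inl (by norm_num))
    · have := (Md_R.serre).add ((Md_Q.pow 2).cmul 6)
      simp only [Nat.cast_ofNat, map_ofNat] at this
      simp only [map_sub, map_add, map_mul, map_ofNat, cz_th, map_pow]
      exact this
    · simp only [eQ, eR, eP, map_sub, map_add, map_mul, map_pow, c0_Sg, cc_ofNat, map_one, cc_th]; norm_num
  have h4 : (6 : PowerSeries ℤ) * (2 * th ℤ eR - (eP * eR - eQ ^ 2)) = 0 := by linear_combination h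
  have h5 : (6 : PowerSeries ℤ) ≠ 0 := by norm_num
  exact sub_eq_zero.mp ((mul_eq_zero.mp h4).resolve_left h5)

lemma thP : 12 * th ℤ eP = eP ^ 2 - eQ := by
  rw [← sub_eq_zero]
  have : 12 * th ℤ eP - (eP ^ 2 - eQ) = 12 * th ℤ eP - eP ^ 2 + eQ := by ring
  rw [this]
  refine zsturm (k := 4) ?_ (by norm_num) ?_ (Or.inl (by norm_num))
  · simp only [map_sub, map_add, map_mul, map_ofNat, cz_th, map_pow]
    exact Md_thP.add Md_Q
  · simp only [eQ, eR, eP, map_sub, map_add, map_mul, map_pow, c0_Sg, cc_ofNat, map_one, cc_th]; norm_num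

end SerreTau

open Polynomial
namespace SerreTau

/-- the series `i X^i/(1-X^i)` -/
noncomputable def Mi (i : ℕ) : PowerSeries ℤ := PowerSeries.mk fun n => if n ≠ 0 ∧ i ∣ n then (i : ℤ) else 0

lemma Mi_mul {i : ℕ} (hi : i ≠ 0) : (1 - PowerSeries.X ^ i) * Mi i = (i : PowerSeries ℤ) * PowerSeries.X ^ i := by
  ext n
  have hC : ((i : ℕ) : PowerSeries ℤ) = PowerSeries.C (i : ℤ) := by simp
  rw [sub_mul, one_mul, map_sub, PowerSeries.coeff_X_pow_mul', hC, PowerSeries.coeff_C_mul,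
    PowerSeries.coeff_X_pow, Mi, PowerSeries.coeff_mk]
  by_cases h : i ≤ n
  · rw [if_pos h, PowerSeries.coeff_mk]
    obtain ⟨m, rfl⟩ := Nat.exists_eq_add_of_le h
    by_cases hm : m = 0
    · subst hm; simp [hi]
    · have : i + m ≠ i := by omega
      simp [hi, hm]
  · rw [if_neg h]
    have h1 : ¬ (n ≠ 0 ∧ i ∣ n) := fun hh => h (Nat.le_of_dvd (Nat.pos_of_ne_zero hh.1) hh.2)
    have h2 : n ≠ i := by omega
    simp [h2]
    intro h3 h4
    exact absurd ⟨h3, h4⟩ h1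

lemma th_X : th ℤ PowerSeries.X = PowerSeries.X := by
  ext n; rw [coeff_th, PowerSeries.coeff_X]; split_ifs with h <;> simp [h]

lemma th_Xpow (i : ℕ) : th ℤ (PowerSeries.X ^ i) = (i : PowerSeries ℤ) * PowerSeries.X ^ i := by
  ext n
  have hC : ((i : ℕ) : PowerSeries ℤ) = PowerSeries.C (i : ℤ) := by simp
  rw [coeff_th, hC, PowerSeries.coeff_C_mul, PowerSeries.coeff_X_pow]
  split_ifs with h <;> simp [h]

/-- finite product as power series -/
noncomputable def DN (N : ℕ) : PowerSeries ℤ :=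
  PowerSeries.X * ∏ i ∈ Finset.Icc 1 N, (1 - PowerSeries.X ^ i) ^ 24

lemma DN_succ (N : ℕ) : DN (N + 1) = DN N * (1 - PowerSeries.X ^ (N + 1)) ^ 24 := by
  rw [DN, DN, Finset.prod_Icc_succ_top (by omega), mul_assoc]

lemma th_DN (N : ℕ) : th ℤ (DN N) = DN N * (1 - 24 * ∑ i ∈ Finset.Icc 1 N, Mi i) := by
  induction N with
  | zero => simp [DN, th_X]
  | succ N ih =>
    rw [DN_succ, Derivation.leibniz, ih, Derivation.leibniz_pow, Finset.sum_Icc_succ_top (by omega),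
      map_sub, th_Xpow, Derivation.map_one_eq_zero, ← Mi_mul (show N + 1 ≠ 0 by omega)]
    simp only [smul_eq_mul, nsmul_eq_mul]
    generalize (1 - PowerSeries.X ^ (N + 1) : PowerSeries ℤ) = W
    push_cast
    ring

lemma coeff_sum_Mi {N n : ℕ} (hn : n ≤ N) :
    PowerSeries.coeff n (∑ i ∈ Finset.Icc 1 N, Mi i) = PowerSeries.coeff n (Sg 1) := by
  rw [map_sum, coeff_Sg, ArithmeticFunction.sigma_one_apply]
  simp only [Mi, PowerSeries.coeff_mk]
  by_cases h0 : n = 0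
  · simp [h0]
  rw [Finset.sum_ite, Finset.sum_const_zero, add_zero]
  push_cast
  refine Finset.sum_congr ?_ (fun _ _ => rfl)
  ext i
  simp only [Finset.mem_filter, Finset.mem_Icc, Nat.mem_divisors]
  constructor
  · rintro ⟨_, h1, h2⟩; exact ⟨h2, h1⟩
  · rintro ⟨h1, h2⟩
    exact ⟨⟨Nat.pos_of_dvd_of_pos h1 (Nat.pos_of_ne_zero h2), (Nat.le_of_dvd (Nat.pos_of_ne_zero h2) h1).trans hn⟩, h2, h1⟩

lemma tau_eq_DN (n : ℕ) : ramanujanTau n = PowerSeries.coeff n (DN n) := by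
  rw [ramanujanTau, ← Polynomial.coeff_coe, DN]
  congr 1
  rw [← Polynomial.coeToPowerSeries.ringHom_apply]
  simp only [map_mul, map_prod, map_pow, map_sub, map_one, Polynomial.coeToPowerSeries.ringHom_apply,
    Polynomial.coe_X]

lemma th_delta : th ℤ (eQ ^ 3 - eR ^ 2) = eP * (eQ ^ 3 - eR ^ 2) := by
  rw [map_sub, Derivation.leibniz_pow, Derivation.leibniz_pow]
  simp only [smul_eq_mul, nsmul_eq_mul]
  push_cast
  linear_combination eQ ^ 2 * thQ - eR * thR

lemma delta_c0 : PowerSeries.constantCoeff (eQ ^ 3 - eR ^ 2) = 0 := by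
  simp only [eQ, eR, map_sub, map_add, map_mul, map_pow, c0_Sg, cc_ofNat, map_one]; norm_num
lemma delta_c1 : PowerSeries.coeff 1 (eQ ^ 3 - eR ^ 2) = 1728 := by
  simp only [eQ, eR, map_sub, map_add, coeff1_mul, pow_succ, pow_zero, c0_Sg, c1_Sg, cc_ofNat, map_one,
      coeff1_ofNat, coeff1_one, map_mul]
  norm_num

lemma DN_c1 {N : ℕ} : PowerSeries.coeff 1 (DN N) = 1 := by
  induction N with
  | zero => simp [DN]
  | succ N ih =>
    have h0 : PowerSeries.constantCoeff (DN N) = 0 := by simp [DN]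
    rw [DN_succ, coeff1_mul, ih, h0]; simp

lemma tau_main (n : ℕ) : 1728 * ramanujanTau n = PowerSeries.coeff n (eQ ^ 3 - eR ^ 2) := by
  rw [tau_eq_DN]
  set H := 1728 * DN n - (eQ ^ 3 - eR ^ 2) with hH
  have h1 : th ℤ H = H * eP + 1728 * (DN n * (24 * (Sg 1 - ∑ i ∈ Finset.Icc 1 n, Mi i))) := by
    have h2 : th ℤ (1728 * DN n) = 1728 * th ℤ (DN n) := by
      rw [Derivation.leibniz, show th ℤ (1728 : PowerSeries ℤ) = 0 from Derivation.map_natCast _ 1728]; simp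
    rw [hH, map_sub, th_delta, h2, th_DN, eP]
    ring
  have hz : ∀ m ≤ n, PowerSeries.coeff m (DN n * (24 * (Sg 1 - ∑ i ∈ Finset.Icc 1 n, Mi i))) = 0 := by
    intro m hm
    rw [PowerSeries.coeff_mul]
    refine Finset.sum_eq_zero (fun p hp => ?_)
    have := Finset.HasAntidiagonal.mem_antidiagonal.mp hp
    rw [coeff_ofNat_mul, map_sub, coeff_sum_Mi (by omega)]
    simp
  have key : ∀ m ≤ n, PowerSeries.coeff m H = 0 := by
    intro m
    induction m using Nat.strong_induction_on with
    | _ m ih =>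
      intro hm
      rcases Nat.lt_or_ge m 2 with h | h
      · interval_cases m
        · simp only [hH]
          rw [PowerSeries.coeff_zero_eq_constantCoeff_apply, map_sub, delta_c0, map_mul]; simp [DN]
        · simp only [hH]
          rw [map_sub, delta_c1, coeff_ofNat_mul, DN_c1]; norm_num
      · have h3 := congrArg (PowerSeries.coeff m) h1
        rw [coeff_th, map_add, coeff_ofNat_mul, hz m hm, mul_zero, add_zero, PowerSeries.coeff_mul,
          Finset.sum_eq_single (m, 0)] at h3
        · have h4 : PowerSeries.coeff 0 eP = 1 := by
            rw [PowerSeries.coeff_zero_eq_constantCoeff_apply]; simp [eP, c0_Sg]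
          rw [h4] at h3
          have h5 : ((m : ℤ) - 1) * PowerSeries.coeff m H = 0 := by linear_combination h3
          rcases mul_eq_zero.mp h5 with h6 | h6
          · omega
          · exact h6
        · intro p hp hne
          have := Finset.HasAntidiagonal.mem_antidiagonal.mp hp
          have h7 : p.1 < m := by
            rcases p with ⟨a, b⟩
            simp at this hne ⊢
            omega
          rw [ih p.1 h7 (by omega), zero_mul]
        · intro hh; exact absurd (Finset.HasAntidiagonal.mem_antidiagonal.mpr (by simp)) hh
  have := key n le_rfl
  rw [hH, map_sub, coeff_ofNat_mul] at this
  linarith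

/-- The generating series of tau -/
noncomputable def De : PowerSeries ℤ := PowerSeries.mk ramanujanTau

lemma De_eq : 1728 * De = eQ ^ 3 - eR ^ 2 := by
  ext n
  rw [coeff_ofNat_mul, De, PowerSeries.coeff_mk, tau_main]

end SerreTau

open Polynomial
namespace SerreTau

lemma Sg_p {p : ℕ} (hp : p.Prime) (k : ℕ) : PowerSeries.coeff p (Sg k) = 1 + (p : ℤ) ^ k := by
  rw [coeff_Sg, ArithmeticFunction.sigma_apply, Nat.Prime.divisors hp, Finset.sum_pair hp.one_lt.ne]
  push_cast; simp

lemma one_p {p : ℕ} (hp : p.Prime) : PowerSeries.coeff p (1 : PowerSeries ℤ) = 0 := by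
  rw [PowerSeries.coeff_one, if_neg hp.ne_zero]

lemma ofNat_p {p : ℕ} (hp : p.Prime) (n : ℕ) [n.AtLeastTwo] :
    PowerSeries.coeff p (no_index (OfNat.ofNat n : PowerSeries ℤ)) = 0 := by
  rw [← map_ofNat (PowerSeries.C (R := ℤ)) n, PowerSeries.coeff_C, if_neg hp.ne_zero]

lemma De_p {p : ℕ} (h0 : ramanujanTau p = 0) : PowerSeries.coeff p De = 0 := by
  rw [De, PowerSeries.coeff_mk, h0]

lemma crit691 {p : ℕ} (hp : p.Prime) (h0 : ramanujanTau p = 0) : (691 : ℤ) ∣ p + 1 := by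
  have h1 : 762048 * De = 691 + 65520 * Sg 11 - 691 * eR ^ 2 := by
    linear_combination 441 * De_eq + E12
  have h2 := congrArg (PowerSeries.coeff p) h1
  simp only [map_add, map_sub, coeff_ofNat_mul, De_p h0, Sg_p hp, ofNat_p hp] at h2
  have h3 : (691 : ℤ) ∣ 65520 * (1 + (p : ℤ) ^ 11) := ⟨PowerSeries.coeff p (eR ^ 2), by linarith⟩
  have hpr : Nat.Prime 691 := by norm_num
  have h5 : ((65520 : ZMod 691)) ≠ 0 := by decide
  have h5' : ¬ ((1 : ZMod 691) + 0 ^ 11 = 0) := by decide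
  have : Fact (Nat.Prime 691) := ⟨hpr⟩
  have h3' := (ZMod.intCast_zmod_eq_zero_iff_dvd (65520 * (1 + (p : ℤ) ^ 11)) 691).mpr (by exact_mod_cast h3)
  push_cast at h3'
  have h6 := (mul_eq_zero.mp h3').resolve_left h5
  have hx : (p : ZMod 691) ≠ 0 := by
    intro h; rw [h] at h6; exact h5' h6
  have h7 := ZMod.pow_card_sub_one_eq_one hx
  have h8 : (p : ZMod 691) ^ 11 = -1 := by linear_combination h6
  have h9 : (p : ZMod 691) = -1 := by
    calc (p : ZMod 691) = ((p : ZMod 691) ^ (691 - 1)) ^ 4 * p := by rw [h7]; ring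
      _ = ((p : ZMod 691) ^ 11) ^ 251 := by
        rw [← pow_mul, ← pow_mul, ← pow_succ]
      _ = -1 := by rw [h8]; exact Odd.neg_one_pow (by decide)
  have h10 := (ZMod.intCast_zmod_eq_zero_iff_dvd ((p : ℤ) + 1) 691).mp (by push_cast; rw [h9]; ring)
  exact_mod_cast h10

/-- supported on multiples -/
def Sup (l : ℕ) (F : PowerSeries ℤ) : Prop := ∀ n, ¬ l ∣ n → PowerSeries.coeff n F = 0

lemma Sup.mul {l : ℕ} {F G : PowerSeries ℤ} (hF : Sup l F) (hG : Sup l G) : Sup l (F * G) := by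
  intro n hn
  rw [PowerSeries.coeff_mul]
  refine Finset.sum_eq_zero (fun p hp => ?_)
  have := Finset.HasAntidiagonal.mem_antidiagonal.mp hp
  by_cases h1 : l ∣ p.1
  · have h2 : ¬ l ∣ p.2 := fun h2 => hn (this ▸ dvd_add h1 h2)
    rw [hG _ h2, mul_zero]
  · rw [hF _ h1, zero_mul]

lemma split_mod (l : ℕ) (F G : PowerSeries ℤ)
    (h : ∀ n, ¬ l ∣ n → (l : ℤ) ∣ PowerSeries.coeff n F - PowerSeries.coeff n G) :
    ∃ W U : PowerSeries ℤ, Sup l W ∧ F = G - W + PowerSeries.C (l : ℤ) * U := by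
  refine ⟨PowerSeries.mk fun n => if l ∣ n then PowerSeries.coeff n (G - F) else 0,
    PowerSeries.mk fun n => if l ∣ n then 0 else (PowerSeries.coeff n F - PowerSeries.coeff n G) / l,
    fun n hn => by simp [hn], ?_⟩
  ext n
  rw [map_add, map_sub, PowerSeries.coeff_C_mul, PowerSeries.coeff_mk, PowerSeries.coeff_mk]
  split_ifs with h1
  · rw [map_sub]; ring
  · rw [Int.mul_ediv_cancel' (h n h1)]; ring

lemma sigma_cast (l k n : ℕ) : ((ArithmeticFunction.sigma k n : ℕ) : ZMod l) = ∑ d ∈ n.divisors, (d : ZMod l) ^ k := by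
  rw [ArithmeticFunction.sigma_apply]; push_cast; rfl

lemma n_sigma (l : ℕ) [Fact l.Prime] (k : ℕ) (hk : k + 2 = l) {n : ℕ} (hn : ¬ l ∣ n) :
    (n : ZMod l) * (ArithmeticFunction.sigma k n : ℕ) = (ArithmeticFunction.sigma 1 n : ℕ) := by
  rw [sigma_cast, sigma_cast, Finset.mul_sum, ← Nat.sum_div_divisors n (fun d => (d : ZMod l) ^ 1)]
  refine Finset.sum_congr rfl (fun d hd => ?_)
  have hdn := Nat.dvd_of_mem_divisors hd
  have h1 : (d : ZMod l) ≠ 0 := by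
    rw [Ne, ZMod.natCast_eq_zero_iff]
    exact fun h => hn (h.trans hdn)
  have h2 := ZMod.pow_card_sub_one_eq_one h1
  obtain ⟨e, rfl⟩ := hdn
  have hd0 : 0 < d := Nat.pos_of_ne_zero (by rintro rfl; simp at hd)
  rw [Nat.mul_div_cancel_left _ hd0]
  have h3 : l - 1 = k + 1 := by omega
  rw [h3] at h2
  push_cast
  linear_combination (e : ZMod l) * h2

lemma PS_id : 10 * (eP * Sg 3) = 30 * th ℤ (Sg 3) + Sg 1 - 21 * Sg 5 := by
  have h := thQ
  have hth : th ℤ eQ = 240 * th ℤ (Sg 3) := by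
    rw [eQ, map_add, Derivation.map_one_eq_zero, Derivation.leibniz, show th ℤ (240 : PowerSeries ℤ) = 0 from Derivation.map_natCast _ 240]
    simp
  rw [hth] at h
  have h2 : (24 : PowerSeries ℤ) * (10 * (eP * Sg 3) - (30 * th ℤ (Sg 3) + Sg 1 - 21 * Sg 5)) = 0 := by
    have e1 : eP * eQ = eP + 240 * (eP * Sg 3) := by rw [eQ]; ring
    rw [e1] at h
    have e2 : eP = 1 - 24 * Sg 1 := rfl
    have e3 : eR = 1 - 504 * Sg 5 := rfl
    linear_combination -h + e3 - e2
  exact sub_eq_zero.mp ((mul_eq_zero.mp h2).resolve_left (by norm_num))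

end SerreTau

open Polynomial
namespace SerreTau

lemma th_ofNat_mul (n : ℕ) [n.AtLeastTwo] (F : PowerSeries ℤ) :
    th ℤ (no_index (OfNat.ofNat n : PowerSeries ℤ) * F) = OfNat.ofNat n * th ℤ F := by
  have h0 : th ℤ (OfNat.ofNat n : PowerSeries ℤ) = 0 := by
    rw [← Nat.cast_ofNat]; exact Derivation.map_natCast _ n
  rw [Derivation.leibniz, h0]; simp

lemma th_mul (F G : PowerSeries ℤ) : th ℤ (F * G) = F * th ℤ G + G * th ℤ F := by
  rw [Derivation.leibniz]; simp

lemma thQ' : th ℤ eQ = 240 * th ℤ (Sg 3) := by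
  rw [eQ, map_add, Derivation.map_one_eq_zero, th_ofNat_mul]; ring
lemma thR' : th ℤ eR = - (504 * th ℤ (Sg 5)) := by
  rw [eR, map_sub, Derivation.map_one_eq_zero, th_ofNat_mul]; ring
lemma thP' : th ℤ eP = - (24 * th ℤ (Sg 1)) := by
  rw [eP, map_sub, Derivation.map_one_eq_zero, th_ofNat_mul]; ring

lemma eP_eq : eP = 1 - 24 * Sg 1 := rfl
lemma eQ_eq : eQ = 1 + 240 * Sg 3 := rfl
lemma eR_eq : eR = 1 - 504 * Sg 5 := rfl

lemma SP_id : 10 * (Sg 3 * th ℤ eP) = 6 * th ℤ (th ℤ (Sg 3)) - 7 * th ℤ (Sg 5) + th ℤ (Sg 1) := by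
  have h := congrArg (th ℤ) thQ
  rw [th_ofNat_mul, map_sub, th_mul] at h
  have h1 : 9 * th ℤ (th ℤ eQ) = 15 * (eQ * th ℤ eP) - 5 * th ℤ eR := by
    linear_combination 3 * h + eP * thQ + thR - eQ * thP
  rw [thQ', th_ofNat_mul, thR', eQ_eq] at h1
  have h2 : (360 : PowerSeries ℤ) * (10 * (Sg 3 * th ℤ eP) - (6 * th ℤ (th ℤ (Sg 3)) - 7 * th ℤ (Sg 5) + th ℤ (Sg 1))) = 0 := by
    linear_combination -h1 - 15 * thP'
  exact sub_eq_zero.mp ((mul_eq_zero.mp h2).resolve_left (by norm_num))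

lemma PSS_id : 2400 * (eP * Sg 3 ^ 2) = 30 * th ℤ (Sg 7) - 11 * Sg 9 + Sg 1 - 20 * (eP * Sg 3) := by
  have h := congrArg (th ℤ) Qsq
  rw [map_add, Derivation.map_one_eq_zero, th_ofNat_mul, sq, th_mul] at h
  have e1 : eP * eQ ^ 2 = eP + 480 * (eP * Sg 3) + 57600 * (eP * Sg 3 ^ 2) := by rw [eQ]; ring
  have h2 : (48 : PowerSeries ℤ) * (2400 * (eP * Sg 3 ^ 2) - (30 * th ℤ (Sg 7) - 11 * Sg 9 + Sg 1 - 20 * (eP * Sg 3))) = 0 := by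
    linear_combination 3 * h + 2 * QRmul - 2 * e1 - 2 * eP_eq - 2 * eQ * thQ
  exact sub_eq_zero.mp ((mul_eq_zero.mp h2).resolve_left (by norm_num))

lemma De5 : 6 * De = th ℤ (Sg 1) + 5 * th ℤ (eP * Sg 3) - 25 * (Sg 3 * th ℤ eP) + 600 * th ℤ (eP * Sg 3 ^ 2)
    - 3000 * (Sg 3 ^ 2 * th ℤ eP) - 1800 * (th ℤ (Sg 3) ^ 2) := by
  have h : (288 : PowerSeries ℤ) * (6 * De - (th ℤ (Sg 1) + 5 * th ℤ (eP * Sg 3) - 25 * (Sg 3 * th ℤ eP) + 600 * th ℤ (eP * Sg 3 ^ 2)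
    - 3000 * (Sg 3 ^ 2 * th ℤ eP) - 1800 * (th ℤ (Sg 3) ^ 2))) = 0 := by
    have h1 : 1728 * De = -12 * eQ ^ 2 * th ℤ eP + 6 * eP * eQ * th ℤ eQ - 9 * (th ℤ eQ) ^ 2 := by
      rw [De_eq]
      linear_combination -(eR + eP * eQ - 3 * th ℤ eQ) * thQ + eQ ^ 2 * thP
    rw [thQ', eQ_eq] at h1
    have e1 : th ℤ (eP * Sg 3 ^ 2) = 2 * eP * Sg 3 * th ℤ (Sg 3) + Sg 3 ^ 2 * th ℤ eP := by
      rw [sq, th_mul, th_mul]; ring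
    rw [th_mul, e1]
    linear_combination h1 - 12 * thP'
  exact sub_eq_zero.mp ((mul_eq_zero.mp h).resolve_left (by norm_num))

lemma De7 : 24 * De = 35 * (eQ * th ℤ (Sg 5)) - 11 * th ℤ (Sg 9) := by
  have e1 : 21 * (eQ * Sg 5) = 10 * Sg 3 + 11 * Sg 9 := by
    have h2 : (24 : PowerSeries ℤ) * (21 * (eQ * Sg 5) - (10 * Sg 3 + 11 * Sg 9)) = 0 := by
      have := QRmul
      rw [eR_eq] at this
      linear_combination eQ_eq - this
    exact sub_eq_zero.mp ((mul_eq_zero.mp h2).resolve_left (by norm_num))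
  have e2 := congrArg (th ℤ) e1
  rw [th_ofNat_mul, map_add, th_ofNat_mul, th_ofNat_mul, th_mul, thQ'] at e2
  have h : (72 : PowerSeries ℤ) * (24 * De - (35 * (eQ * th ℤ (Sg 5)) - 11 * th ℤ (Sg 9))) = 0 := by
    have h1 : 1728 * De = 3 * eR * th ℤ eQ - 2 * eQ * th ℤ eR := by
      rw [De_eq]
      linear_combination -eR * thQ + eQ * thR
    rw [thQ', thR', eR_eq] at h1
    linear_combination h1 - 72 * e2
  exact sub_eq_zero.mp ((mul_eq_zero.mp h).resolve_left (by norm_num))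

lemma crit5_aux : ∀ x : ZMod 25, 5 * x * (1 + x) - 10 * (6 * x^2 * (1+x^3) - 7 * x * (1 + x^5) + x * (1+x))
   + 30 * x^2 * (1+x^7) - 11 * x * (1 + x^9) = 0 → x = -1 ∨ 5 * x = 0 := by decide +kernel
lemma crit5_aux' : ∀ x : ZMod 125, 5 * x * (1 + x) - 10 * (6 * x^2 * (1+x^3) - 7 * x * (1 + x^5) + x * (1+x))
   + 30 * x^2 * (1+x^7) - 11 * x * (1 + x^9) = 0 → x = -1 ∨ 25 * x = 0 := by decide +kernel

lemma crit5 {p : ℕ} (hp : p.Prime) (h5 : p ≠ 5) (h0 : ramanujanTau p = 0) : (125 : ℤ) ∣ p + 1 := by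
  have ha := congrArg (PowerSeries.coeff p) PS_id
  have hb := congrArg (PowerSeries.coeff p) SP_id
  have hc := congrArg (PowerSeries.coeff p) PSS_id
  have hD := congrArg (PowerSeries.coeff p) De5
  simp only [map_add, map_sub, coeff_ofNat_mul, De_p h0, Sg_p hp, ofNat_p hp, coeff_th] at ha hb hc hD
  set a := PowerSeries.coeff p (eP * Sg 3)
  set b := PowerSeries.coeff p (Sg 3 * th ℤ eP)
  set c := PowerSeries.coeff p (eP * Sg 3 ^ 2)
  set d := PowerSeries.coeff p (th ℤ (Sg 3) ^ 2)
  set e := PowerSeries.coeff p (Sg 3 ^ 2 * th ℤ eP)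
  have key : 5 * (p:ℤ) * (1 + p) - 10 * (6 * p^2 * (1+p^3) - 7 * p * (1 + p^5) + p * (1+p))
   + 30 * p^2 * (1+p^7) - 11 * p * (1 + p^9) = 12000 * e + 7200 * d := by
    linear_combination -4 * hD + 10 * hb - p * hc
  have hp5 : ¬ (5:ℤ) ∣ p := by
    intro h
    have : (5:ℕ) ∣ p := by exact_mod_cast h
    exact h5 ((Nat.prime_dvd_prime_iff_eq (by norm_num) hp).mp this).symm
  have k1 : (25 : ℤ) ∣ p + 1 := by
    have h := congrArg (Int.cast : ℤ → ZMod 25) key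
    push_cast at h
    rcases crit5_aux (p : ZMod 25) (by rw [h, show (12000 : ZMod 25) = 0 by decide, show (7200 : ZMod 25) = 0 by decide]; ring) with h | h
    · have := (ZMod.intCast_zmod_eq_zero_iff_dvd ((p:ℤ)+1) 25).mp (by push_cast; rw [h]; ring)
      exact_mod_cast this
    · have := (ZMod.intCast_zmod_eq_zero_iff_dvd (5 * (p:ℤ)) 25).mp (by push_cast; exact h)
      push_cast at this; omega
  have hd : (5 : ℤ) ∣ d := by
    have h24 : (24 : ZMod 5) = -1 := by decide
    have hf : Fact (Nat.Prime 5) := ⟨by norm_num⟩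
    obtain ⟨W, U, hW, hU⟩ := split_mod 5 (th ℤ (Sg 3)) eP (by
      intro n hn
      have := n_sigma 5 3 rfl hn
      rw [coeff_th, coeff_Sg, eP_eq, map_sub, coeff_ofNat_mul, coeff_Sg, PowerSeries.coeff_one, if_neg (by rintro rfl; simp at hn)]
      rw [← ZMod.intCast_zmod_eq_zero_iff_dvd]
      push_cast
      rw [this, h24]; ring)
    have e1 : th ℤ (Sg 3) ^ 2 = 2 * (th ℤ (eP * Sg 3) - Sg 3 * th ℤ eP) - (eQ - 288 * th ℤ (Sg 1)) + W * W
        + 5 * (5 * U ^ 2 - 2 * U * W) := by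
      have h2 : eP ^ 2 = eQ - 288 * th ℤ (Sg 1) := by linear_combination -thP + 12 * thP'
      have h3 : th ℤ (Sg 3) - eP = 5 * U - W := by rw [hU]; simp; ring
      rw [th_mul, ← h2]
      linear_combination (th ℤ (Sg 3) - eP + 5 * U - W) * h3
    have e2 := congrArg (PowerSeries.coeff p) e1
    rw [eQ_eq] at e2
    have hWW := hW.mul hW p (by exact_mod_cast hp5)
    simp only [map_add, map_sub, map_neg, mul_neg, coeff_ofNat_mul, hWW, Sg_p hp, one_p hp, coeff_th] at e2
    change d = 2 * (p * a - b) - _ + _ + _ at e2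
    have a5 : (5:ℤ) ∣ a := by
      obtain ⟨m, hm⟩ := k1
      have : (p:ℤ) = 25 * m - 1 := by linarith
      have : (25:ℤ) ∣ 10 * a := by
        rw [ha, this]; ring_nf
        omega
      omega
    have b5 : (5:ℤ) ∣ b := by
      obtain ⟨m, hm⟩ := k1
      have : (p:ℤ) = 25 * m - 1 := by linarith
      have : (25:ℤ) ∣ 10 * b := by
        rw [hb, this]; ring_nf
        omega
      omega
    obtain ⟨a', ha'⟩ := a5
    obtain ⟨b', hb'⟩ := b5
    obtain ⟨m, hm⟩ := k1
    have hpm : (p:ℤ) = 25 * m - 1 := by linarith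
    rw [ha', hb', hpm] at e2
    rw [e2]
    push_cast
    ring_nf
    omega
  obtain ⟨d', hd'⟩ := hd
  rw [hd'] at key
  have h := congrArg (Int.cast : ℤ → ZMod 125) key
  push_cast at h
  rcases crit5_aux' (p : ZMod 125) (by rw [h, show (12000 : ZMod 125) = 0 by decide, show (7200 : ZMod 125) = 75 by decide]; ring_nf; rw [show (375 : ZMod 125) = 0 by decide]; ring) with h | h
  · have := (ZMod.intCast_zmod_eq_zero_iff_dvd ((p:ℤ)+1) 125).mp (by push_cast; rw [h]; ring)
    exact_mod_cast this
  · have := (ZMod.intCast_zmod_eq_zero_iff_dvd (25 * (p:ℤ)) 125).mp (by push_cast; exact h)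
    push_cast at this; omega

lemma sigma3_7 {i : ℕ} (h : (i : ZMod 7) ^ 3 = -1) : ((ArithmeticFunction.sigma 3 i : ℕ) : ZMod 7) = 0 := by
  have hu : ∀ x : ZMod 7, x ≠ 0 → x ^ 3 * x ^ 3 = 1 := by decide
  have h2 : ∀ x : ZMod 7, x = - x → x = 0 := by decide
  apply h2
  rw [sigma_cast]
  nth_rw 1 [← Nat.sum_div_divisors i (fun d => (d : ZMod 7) ^ 3)]
  rw [← Finset.sum_neg_distrib]
  refine Finset.sum_congr rfl (fun d hd => ?_)
  have hdn := Nat.dvd_of_mem_divisors hd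
  obtain ⟨e, rfl⟩ := hdn
  have hd0 : 0 < d := Nat.pos_of_ne_zero (by rintro rfl; simp at hd)
  rw [Nat.mul_div_cancel_left _ hd0]
  push_cast at h
  have h1 : (d : ZMod 7) ≠ 0 := by
    intro h1; rw [h1] at h; revert h; ring_nf; decide +revert
  have := hu _ h1
  linear_combination (d:ZMod 7)^3 * h - (e:ZMod 7)^3 * this

lemma crit7_aux : ∀ x : ZMod 49, 11 * x * (1 + x^9) = 0 → x = 19 ∨ x = 31 ∨ x = 48 ∨ 7 * x = 0 := by decide +kernel

lemma crit7 {p : ℕ} (hp : p.Prime) (h7 : p ≠ 7) (h0 : ramanujanTau p = 0) :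
    p % 49 = 19 ∨ p % 49 = 31 ∨ p % 49 = 48 := by
  have hD := congrArg (PowerSeries.coeff p) De7
  simp only [map_add, map_sub, coeff_ofNat_mul, De_p h0, Sg_p hp, ofNat_p hp, coeff_th] at hD
  set f := PowerSeries.coeff p (eQ * th ℤ (Sg 5))
  have hp7 : ¬ 7 ∣ p := by
    intro h
    exact h7 ((Nat.prime_dvd_prime_iff_eq (by norm_num) hp).mp h).symm
  have k1 : (p : ZMod 7) ^ 3 = -1 := by
    have h := congrArg (Int.cast : ℤ → ZMod 7) hD
    have hx : (p : ZMod 7) ≠ 0 := by rw [Ne, ZMod.natCast_eq_zero_iff]; exact hp7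
    push_cast at h
    rw [show (35 : ZMod 7) = 0 by decide] at h
    have : ∀ x y : ZMod 7, x ≠ 0 → 24 * 0 = 0 * y - 11 * (x * (1 + x ^ 9)) → x ^ 3 = -1 := by decide
    exact this _ _ hx h
  have hf : (7:ℤ) ∣ f := by
    have hF : Fact (Nat.Prime 7) := ⟨by norm_num⟩
    obtain ⟨W, U, hW, hU⟩ := split_mod 7 (th ℤ (Sg 5)) (2 * eP) (by
      intro n hn
      have := n_sigma 7 5 rfl hn
      rw [coeff_ofNat_mul, coeff_th, coeff_Sg, eP_eq, map_sub, coeff_ofNat_mul, coeff_Sg, PowerSeries.coeff_one, if_neg (by rintro rfl; simp at hn)]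
      rw [← ZMod.intCast_zmod_eq_zero_iff_dvd]
      push_cast
      rw [this, show (24 : ZMod 7) = 3 from rfl]; ring_nf
      rw [show (7 : ZMod 7) = 0 from rfl]; ring)
    have hQW : (7:ℤ) ∣ PowerSeries.coeff p (eQ * W) := by
      rw [PowerSeries.coeff_mul]
      refine Finset.dvd_sum (fun ij hij => ?_)
      have hs := Finset.HasAntidiagonal.mem_antidiagonal.mp hij
      by_cases hj : 7 ∣ ij.2
      · apply Dvd.dvd.mul_right
        have hi : (ij.1 : ZMod 7) = p := by
          rw [← hs]; push_cast; rw [(ZMod.natCast_eq_zero_iff _ _).mpr hj]; ring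
        have := sigma3_7 (i := ij.1) (by rw [hi, k1])
        have hi0 : ij.1 ≠ 0 := by
          intro h; rw [h] at hs; apply hp7; rw [← hs]; simpa using hj
        rw [eQ_eq, map_add, coeff_ofNat_mul, coeff_Sg, PowerSeries.coeff_one, if_neg hi0]
        rw [ZMod.natCast_eq_zero_iff] at this
        have h' : (7:ℤ) ∣ (ArithmeticFunction.sigma 3 ij.1 : ℕ) := by exact_mod_cast this
        rw [zero_add]
        exact h'.mul_left _
      · rw [hW _ hj, mul_zero]; exact dvd_zero _
    have e1 : eQ * th ℤ (Sg 5) = 2 * (3 * th ℤ eQ + eR) - eQ * W + 7 * (eQ * U) := by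
      rw [hU, thQ]; simp; ring
    have e2 := congrArg (PowerSeries.coeff p) e1
    rw [eR_eq, thQ'] at e2
    simp only [map_add, map_sub, map_neg, mul_neg, coeff_ofNat_mul, Sg_p hp, one_p hp, coeff_th] at e2
    change f = _ at e2
    rw [e2]
    have h3 : (7:ℤ) ∣ 1 + p^3 := by
      have := (ZMod.intCast_zmod_eq_zero_iff_dvd (1 + (p:ℤ)^3) 7).mp (by push_cast; rw [k1]; ring)
      exact_mod_cast this
    obtain ⟨u, hu⟩ := h3
    obtain ⟨v, hv⟩ := hQW
    rw [hu, hv]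
    exact ⟨2 * (3 * (240 * (p * u)) - 72 * (1 + p^5)) - v + PowerSeries.coeff p (eQ * U), by push_cast; ring⟩
  obtain ⟨g, hg⟩ := hf
  rw [hg] at hD
  have h := congrArg (Int.cast : ℤ → ZMod 49) hD
  push_cast at h
  have h2 : 11 * (p : ZMod 49) * (1 + (p:ZMod 49)^9) = 0 := by
    have : (245 : ZMod 49) = 0 := by decide
    linear_combination h + this * g
  rcases crit7_aux _ h2 with h | h | h | h
  · left; have := (ZMod.natCast_eq_natCast_iff' p 19 49).mp (by exact_mod_cast h); omega
  · right; left; have := (ZMod.natCast_eq_natCast_iff' p 31 49).mp (by exact_mod_cast h); omega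
  · right; right; have := (ZMod.natCast_eq_natCast_iff' p 48 49).mp (by exact_mod_cast h); omega
  · have := (ZMod.natCast_eq_zero_iff (7 * p) 49).mp (by push_cast; exact h)
    omega

end SerreTau

open Polynomial
namespace SerreTau

def Sol (p : ℕ) : Prop := ∃ X Y : ℤ, X ^ 2 + 23 * Y ^ 2 = 24 * p

lemma sol1 {p : ℕ} {x y : ℤ} (h : x ^ 2 + 23 * y ^ 2 = p) : Sol p :=
  ⟨x + 23 * y, x - y, by linear_combination 24 * h⟩

lemma mod3_pm {x y : ℤ} (h : (3:ℤ) ∣ x ^ 2 - y ^ 2) : (3:ℤ) ∣ x - y ∨ (3:ℤ) ∣ x - (-y) := by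
  have : (3:ℤ) ∣ (x - y) * (x - (-y)) := by convert h using 1; ring
  exact (Int.prime_three).dvd_or_dvd this

lemma sol3 {p : ℕ} {x y : ℤ} (h : x ^ 2 + 23 * y ^ 2 = 3 * p) : Sol p := by
  have key : ∀ y : ℤ, x ^ 2 + 23 * y ^ 2 = 3 * p → (3:ℤ) ∣ x - y → Sol p := by
    intro y h ⟨t, ht⟩
    have hx : x = y + 3 * t := by linarith
    subst hx
    refine ⟨10 * y + 7 * t, 2 * y - t, ?_⟩
    have : (3:ℤ) * ((10 * y + 7 * t) ^ 2 + 23 * (2 * y - t) ^ 2) = 3 * (24 * p) := by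
      linear_combination 24 * h
    linarith
  rcases mod3_pm (x := x) (y := y) ⟨p - 8 * y^2, by linarith⟩ with h1 | h1
  · exact key y h h1
  · exact key (-y) (by rw [neg_sq, h]) h1

lemma sol9 {p : ℕ} {x y : ℤ} (h : x ^ 2 + 23 * y ^ 2 = 9 * p) : Sol p := by
  have key : ∀ y : ℤ, x ^ 2 + 23 * y ^ 2 = 9 * p → (3:ℤ) ∣ x - y → Sol p := by
    intro y h ⟨t, ht⟩
    have hx : x = y + 3 * t := by linarith
    subst hx
    refine ⟨8 * y + t, -t, ?_⟩
    have : (9:ℤ) * ((8 * y + t) ^ 2 + 23 * (-t) ^ 2) = 9 * (24 * p) := by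
      linear_combination 24 * h
    linarith
  rcases mod3_pm (x := x) (y := y) ⟨3 * p - 8 * y^2, by linarith⟩ with h1 | h1
  · exact key y h h1
  · exact key (-y) (by rw [neg_sq, h]) h1

lemma sq8 (x : ℤ) : x ^ 2 % 8 = 0 ∧ x % 4 = 0 ∨ x ^ 2 % 8 = 4 ∧ x % 4 = 2 ∨ x ^ 2 % 8 = 1 ∧ (x % 4 = 1 ∨ x % 4 = 3) := by
  have : x % 8 = 0 ∨ x % 8 = 1 ∨ x % 8 = 2 ∨ x % 8 = 3 ∨ x % 8 = 4 ∨ x % 8 = 5 ∨ x % 8 = 6 ∨ x % 8 = 7 := by omega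
  rcases this with h | h | h | h | h | h | h | h <;> simp [sq, Int.mul_emod, h] <;> omega

lemma sol4 {p : ℕ} (hp : p % 2 = 1) {x y : ℤ} (h : x ^ 2 + 23 * y ^ 2 = 4 * p) : Sol p := by
  have hx := sq8 x
  have hy := sq8 y
  obtain ⟨x', rfl⟩ : (2:ℤ) ∣ x := by omega
  obtain ⟨y', rfl⟩ : (2:ℤ) ∣ y := by omega
  exact sol1 (x := x') (y := y') (by linarith)

lemma no2 {p : ℕ} (hp : p % 2 = 1) {x y : ℤ} (h : x ^ 2 + 23 * y ^ 2 = 2 * p) : False := by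
  have hx := sq8 x
  have hy := sq8 y
  omega
lemma no6 {p : ℕ} (hp : p % 2 = 1) {x y : ℤ} (h : x ^ 2 + 23 * y ^ 2 = 6 * p) : False := by
  have hx := sq8 x
  have hy := sq8 y
  omega

lemma sol8 {p : ℕ} (hp : p % 2 = 1) {x y : ℤ} (h : x ^ 2 + 23 * y ^ 2 = 8 * p) : Sol p := by
  have key : ∀ y : ℤ, x ^ 2 + 23 * y ^ 2 = 8 * p → (4:ℤ) ∣ x - y → Sol p := by
    intro y h ⟨t, ht⟩
    have hx : x = y + 4 * t := by linarith
    subst hx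
    refine ⟨7 * y + 5 * t, y - t, ?_⟩
    have : (2:ℤ) * ((7 * y + 5 * t) ^ 2 + 23 * (y - t) ^ 2) = 2 * (24 * p) := by
      linear_combination 6 * h
    linarith
  have hx := sq8 x
  have hy := sq8 y
  by_cases hx2 : (2:ℤ) ∣ x
  · obtain ⟨x', rfl⟩ := hx2
    obtain ⟨y', rfl⟩ : (2:ℤ) ∣ y := by omega
    exact (no2 hp (x := x') (y := y') (by linarith)).elim
  · have : (4:ℤ) ∣ x - y ∨ (4:ℤ) ∣ x - (-y) := by omega
    rcases this with h1 | h1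
    · exact key y h h1
    · exact key (-y) (by rw [neg_sq, h]) h1

lemma thue {p : ℕ} (hp : p.Prime) (z : ZMod p) : ∃ x y : ℤ, (x ≠ 0 ∨ y ≠ 0) ∧ x ^ 2 ≤ 5 * p ∧ 5 * y ^ 2 ≤ p ∧
    (x : ZMod p) = z * y := by
  have : NeZero p := ⟨hp.ne_zero⟩
  set A := Nat.sqrt (5 * p)
  set B := Nat.sqrt (p / 5)
  have hA := Nat.lt_succ_sqrt (5 * p)
  have hB := Nat.lt_succ_sqrt (p / 5)
  have hA' := Nat.sqrt_le (5 * p)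
  have hB' := Nat.sqrt_le (p / 5)
  have hcard : p < (A + 1) * (B + 1) := by
    have h1 : p + 1 ≤ 5 * ((B + 1) * (B + 1)) := by
      have : p / 5 < (B + 1) * (B + 1) := hB
      omega
    have h2 : 5 * p < (A + 1) * (A + 1) := hA
    by_contra hcon
    push Not at hcon
    have : ((A + 1) * (B + 1)) * ((A + 1) * (B + 1)) ≤ p * p := Nat.mul_le_mul hcon hcon
    nlinarith
  obtain ⟨⟨u, v⟩, h1, ⟨u', v'⟩, h2, hne, heq⟩ := Finset.exists_ne_map_eq_of_card_lt_of_maps_to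
    (s := Finset.range (A + 1) ×ˢ Finset.range (B + 1)) (t := (Finset.univ : Finset (ZMod p)))
    (f := fun q => (q.1 : ZMod p) - z * q.2) (by simp [ZMod.card, hcard]) (by intro _ _; simp)
  simp only [Finset.coe_product, Finset.mem_coe, Finset.mem_product, Finset.mem_range, Set.mem_prod] at h1 h2
  refine ⟨(u:ℤ) - u', (v:ℤ) - v', ?_, ?_, ?_, ?_⟩
  · by_contra hcon
    push Not at hcon
    apply hne
    ext <;> simp <;> omega
  · have : ((A * A : ℕ) : ℤ) ≤ ((5 * p : ℕ) : ℤ) := by exact_mod_cast hA'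
    push_cast at this
    have := abs_le_of_sq_le_sq' (a := (u:ℤ) - u') (b := A)
    have a1 : (u:ℤ) - u' ≤ A := by omega
    have a2 : -(A:ℤ) ≤ (u:ℤ) - u' := by omega
    nlinarith
  · have : ((B * B : ℕ) : ℤ) ≤ ((p / 5 : ℕ) : ℤ) := by exact_mod_cast hB'
    have h3 : (5 : ℤ) * ((p / 5 : ℕ) : ℤ) ≤ p := by omega
    push_cast at this h3
    have a1 : (v:ℤ) - v' ≤ B := by omega
    have a2 : -(B:ℤ) ≤ (v:ℤ) - v' := by omega
    nlinarith
  · push_cast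
    linear_combination heq

lemma exists_sol {p : ℕ} (hp : p.Prime) (h4 : p % 4 = 3) (h23 : p ≠ 23) (hl : legendreSym 23 p = 1)
  [Fact p.Prime] : Sol p := by
  have hl2 : legendreSym p (-23) = 1 := by
    have h1 : legendreSym p 23 = -1 := by
      have := legendreSym.quadratic_reciprocity_three_mod_four (p := p) (q := 23) h4 (by norm_num)
      push_cast at this
      rw [hl] at this; linarith
    have h2 : legendreSym p (-1) = -1 := by
      rw [legendreSym.at_neg_one (by omega), ZMod.χ₄_nat_three_mod_four h4]
    rw [show (-23 : ℤ) = (-1) * 23 by norm_num, legendreSym.mul, h1, h2]; norm_num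
  have h0 : ((-23 : ℤ) : ZMod p) ≠ 0 := by
    intro h
    rw [(legendreSym.eq_zero_iff p (-23)).mpr h] at hl2
    exact absurd hl2 (by norm_num)
  obtain ⟨z, hz⟩ := (legendreSym.eq_one_iff p h0).mp hl2
  have h0' : ((p : ℤ) : ZMod 23) ≠ 0 := by
    intro h
    rw [(legendreSym.eq_zero_iff 23 p).mpr h] at hl
    exact absurd hl (by norm_num)
  obtain ⟨w, hw⟩ := (legendreSym.eq_one_iff 23 h0').mp hl
  rw [hw] at h0'
  obtain ⟨x, y, hne, hx, hy, hxy⟩ := thue hp z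
  have hd : (p : ℤ) ∣ x ^ 2 + 23 * y ^ 2 := by
    rw [← ZMod.intCast_zmod_eq_zero_iff_dvd]
    push_cast at hz ⊢
    rw [hxy]
    linear_combination -(y : ZMod p) ^ 2 * hz
  obtain ⟨k, hk⟩ := hd
  have hp0 : (0:ℤ) < p := by exact_mod_cast hp.pos
  have hk0 : 0 < k := by
    have : 0 < x ^ 2 + 23 * y ^ 2 := by
      rcases hne with h | h
      · have := sq_nonneg y; have := sq_pos_of_ne_zero h; linarith
      · have := sq_nonneg x; have := sq_pos_of_ne_zero h; linarith
    rw [hk] at this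
    exact pos_of_mul_pos_right this hp0.le
  have hk9 : k ≤ 9 := by
    by_contra hcon
    push Not at hcon
    have : (p:ℤ) * 10 ≤ p * k := mul_le_mul_of_nonneg_left (by linarith) hp0.le
    linarith
  have h23' := congrArg (Int.cast : ℤ → ZMod 23) hk
  push_cast at h23' hw
  rw [hw, show (23 : ZMod 23) = 0 from rfl] at h23'
  have hpo : p % 2 = 1 := by omega
  have n5 : ∀ w x : ZMod 23, w * w ≠ 0 → x ^ 2 ≠ 5 * (w * w) := by decide +kernel
  have n7 : ∀ w x : ZMod 23, w * w ≠ 0 → x ^ 2 ≠ 7 * (w * w) := by decide +kernel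
  interval_cases k
  · exact sol1 (by rw [hk]; ring)
  · exact (no2 hpo (by rw [hk]; ring)).elim
  · exact sol3 (by rw [hk]; ring)
  · exact sol4 hpo (by rw [hk]; ring)
  · exact (n5 w x h0' (by push_cast at h23'; linear_combination h23')).elim
  · exact (no6 hpo (by rw [hk]; ring)).elim
  · exact (n7 w x h0' (by push_cast at h23'; linear_combination h23')).elim
  · exact sol8 hpo (by rw [hk]; ring)
  · exact sol9 (by rw [hk]; ring)

/-- comparison of two solutions -/
lemma two_sol {p : ℕ} (hp : p.Prime) (hp3 : 3 < p) {X Y X' Y' : ℤ} (h : X ^ 2 + 23 * Y ^ 2 = 24 * p)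
    (h' : X' ^ 2 + 23 * Y' ^ 2 = 24 * p) : ∃ Z n m : ℤ, (Z = Y' ∨ Z = -Y') ∧
    X * X' + 23 * Y * Z = p * n ∧ X * Z - X' * Y = p * m ∧ n ^ 2 + 23 * m ^ 2 = 576 := by
  have hpp : Prime (p : ℤ) := Nat.prime_iff_prime_int.mp hp
  have hp0 : (p:ℤ) ≠ 0 := by exact_mod_cast hp.ne_zero
  have key : ∀ Z : ℤ, X' ^ 2 + 23 * Z ^ 2 = 24 * p → (p:ℤ) ∣ X * Z - X' * Y → ∃ n m : ℤ,
    X * X' + 23 * Y * Z = p * n ∧ X * Z - X' * Y = p * m ∧ n ^ 2 + 23 * m ^ 2 = 576 := by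
    rintro Z hZ ⟨m, hm⟩
    have h1 : (X * X' + 23 * Y * Z) ^ 2 = p * (p * (576 - 23 * m ^ 2)) := by
      have : (X * X' + 23 * Y * Z) ^ 2 + 23 * (X * Z - X' * Y) ^ 2 = 24 * p * (24 * p) := by
        linear_combination (X' ^ 2 + 23 * Z ^ 2) * h + 24 * p * hZ
      rw [hm] at this
      linear_combination this
    obtain ⟨n, hn⟩ := hpp.dvd_of_dvd_pow (Dvd.intro _ h1.symm)
    refine ⟨n, m, hn, hm, ?_⟩
    rw [hn] at h1
    have : (p:ℤ) * (p * (n ^ 2 + 23 * m ^ 2 - 576)) = 0 := by linear_combination h1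
    have := (mul_eq_zero.mp ((mul_eq_zero.mp this).resolve_left hp0)).resolve_left hp0
    linarith
  have h2 : (p:ℤ) ∣ (X * Y' - X' * Y) * (X * (-Y') - X' * Y) :=
    ⟨24 * (Y ^ 2 - Y' ^ 2), by linear_combination Y ^ 2 * h' - Y' ^ 2 * h⟩
  rcases hpp.dvd_or_dvd h2 with h3 | h3
  · obtain ⟨n, m, h4⟩ := key Y' h' h3
    exact ⟨Y', n, m, Or.inl rfl, h4⟩
  · obtain ⟨n, m, h4⟩ := key (-Y') (by rw [neg_sq, h']) h3
    exact ⟨-Y', n, m, Or.inr rfl, h4⟩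

def nmT : Finset (ℤ × ℤ) := {(24, 0), (-24, 0), (22, 2), (22, -2), (-22, 2), (-22, -2), (1, 5), (1, -5), (-1, 5), (-1, -5)}

lemma nm_mem {n m : ℤ} (h : n ^ 2 + 23 * m ^ 2 = 576) : (n, m) ∈ nmT := by
  have hm1 : m ≤ 5 := by nlinarith
  have hm2 : -5 ≤ m := by nlinarith
  have hn1 : n ≤ 24 := by nlinarith
  have hn2 : -24 ≤ n := by nlinarith
  have : ∀ m ∈ Finset.Icc (-5 : ℤ) 5, ∀ n ∈ Finset.Icc (-24 : ℤ) 24, n ^ 2 + 23 * m ^ 2 = 576 → (n, m) ∈ nmT := by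
    decide +kernel
  exact this m (Finset.mem_Icc.mpr ⟨hm2, hm1⟩) n (Finset.mem_Icc.mpr ⟨hn2, hn1⟩) h

lemma X_eq {p : ℕ} (hp : p.Prime) {X Y X' Z n m : ℤ} (h : X ^ 2 + 23 * Y ^ 2 = 24 * p)
    (h1 : X * X' + 23 * Y * Z = p * n) (h2 : X * Z - X' * Y = p * m) : 24 * X' = n * X - 23 * m * Y ∧
    24 * Z = n * Y + m * X := by
  have hp0 : (p:ℤ) ≠ 0 := by exact_mod_cast hp.ne_zero
  constructor <;> apply mul_left_cancel₀ hp0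
  · linear_combination -X' * h + X * h1 - 23 * Y * h2
  · linear_combination -Z * h + Y * h1 + X * h2

/-- all solutions have the same sign -/
lemma same_sign {p : ℕ} (hp : p.Prime) (hp2 : p % 2 = 1) (hp3 : 3 < p) {a b a' b' : ℤ}
    (h : (6 * a - 1) ^ 2 + 23 * (6 * b - 1) ^ 2 = 24 * p)
    (h' : (6 * a' - 1) ^ 2 + 23 * (6 * b' - 1) ^ 2 = 24 * p) : (a + b) % 2 = (a' + b') % 2 := by
  obtain ⟨Z, n, m, hZ, h1, h2, h3⟩ := two_sol hp hp3 h h'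
  obtain ⟨e1, e2⟩ := X_eq hp h h1 h2
  have hT := nm_mem h3
  have hno : ∀ t : ℤ, 6 * a - 1 = 5 * (6 * b - 1) + 24 * t ∨ 6 * a - 1 = -5 * (6 * b - 1) + 24 * t → False := by
    intro t ht
    have : ∃ s : ℤ, (6 * a - 1) ^ 2 = 25 * (6 * b - 1) ^ 2 + 48 * s := by
      rcases ht with ht | ht
      · exact ⟨5 * (6 * b - 1) * t + 12 * t ^ 2, by rw [ht]; ring⟩
      · exact ⟨-5 * (6 * b - 1) * t + 12 * t ^ 2, by rw [ht]; ring⟩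
    obtain ⟨s, hs⟩ := this
    rw [hs] at h
    have : (2:ℤ) * ((6 * b - 1) ^ 2 + s) = p := by linarith
    omega
  simp only [nmT, Finset.mem_insert, Finset.mem_singleton, Prod.mk.injEq] at hT
  rcases hT with ⟨rfl, rfl⟩ | ⟨rfl, rfl⟩ | ⟨rfl, rfl⟩ | ⟨rfl, rfl⟩ | ⟨rfl, rfl⟩ | ⟨rfl, rfl⟩ | ⟨rfl, rfl⟩ | ⟨rfl, rfl⟩ | ⟨rfl, rfl⟩ | ⟨rfl, rfl⟩
  · omega
  · omega
  · omega
  · omega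
  · omega
  · omega
  · exact (hno (6 * a' - 1 + 5 * (6 * b - 1)) (by omega)).elim
  · exact (hno (6 * a' - 1 - 5 * (6 * b - 1)) (by omega)).elim
  · exact (hno (-(6 * a' - 1) - 5 * (6 * b - 1)) (by omega)).elim
  · exact (hno (-(6 * a' - 1) + 5 * (6 * b - 1)) (by omega)).elim

end SerreTau

open Polynomial
namespace SerreTau

lemma prod_trunc {R : Type*} [CommRing R] (N : ℕ) (T : Finset ℕ) (hT : ∀ k ∈ T, N ≤ k) (G : PowerSeries R) (i : ℕ) (hi : i ≤ N) :
    PowerSeries.coeff i ((∏ k ∈ T, (1 - PowerSeries.X ^ (k + 1))) * G) = PowerSeries.coeff i G := by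
  classical
  induction T using Finset.induction_on with
  | empty => simp
  | insert a s ha ih =>
    rw [Finset.prod_insert ha, mul_assoc, sub_mul, one_mul, map_sub, ih (fun k hk => hT k (Finset.mem_insert_of_mem hk)),
      PowerSeries.coeff_X_pow_mul', if_neg, sub_zero]
    have := hT a (Finset.mem_insert_self a s)
    omega

lemma coeff_prod_pent (R : Type*) [CommRing R] (N i : ℕ) (hi : i ≤ N) :
    PowerSeries.coeff i (∏ k ∈ Finset.range N, (1 - PowerSeries.X ^ (k + 1) : PowerSeries R)) =
    PowerSeries.coeff i (PowerSeries.pentagonalSeries R) := by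
  obtain ⟨s0, hs⟩ := Filter.eventually_atTop.mp (PowerSeries.coeff_prod_one_sub_X_pow_eventually_eq R i)
  rw [← hs (s0 ∪ Finset.range N) Finset.subset_union_left]
  rw [show s0 ∪ Finset.range N = (s0 \ Finset.range N) ∪ Finset.range N by simp, Finset.prod_union Finset.sdiff_disjoint,
    prod_trunc N _ _ _ i hi]
  intro k hk
  simp at hk
  exact hk.2

lemma tau23 (p : ℕ) (hp : p ≠ 0) : ((ramanujanTau p : ℤ) : ZMod 23) =
    PowerSeries.coeff (p - 1) (PowerSeries.pentagonalSeries (ZMod 23) *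
      (PowerSeries.pentagonalSeries (ZMod 23)).expand 23 (by norm_num)) := by
  rw [tau_eq_DN, ← eq_intCast (Int.castRingHom (ZMod 23)), ← PowerSeries.coeff_map]
  have hfac : ∀ i : ℕ, (1 - (PowerSeries.X : PowerSeries (ZMod 23)) ^ i) ^ 24 =
    (1 - PowerSeries.X ^ i) * PowerSeries.expand 23 (by norm_num) (1 - (PowerSeries.X : PowerSeries (ZMod 23)) ^ i) := by
    intro i
    rw [pow_succ', map_sub, map_one, map_pow, PowerSeries.expand_X]
    congr 1
    have : CharP (PowerSeries (ZMod 23)) 23 := charP_of_injective_ringHom (PowerSeries.C_injective (R := ZMod 23)) 23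
    rw [sub_pow_char, one_pow, ← pow_mul, ← pow_mul, mul_comm]
  have h1 : PowerSeries.map (Int.castRingHom (ZMod 23)) (DN p) = PowerSeries.X *
    ((∏ k ∈ Finset.range p, (1 - PowerSeries.X ^ (k + 1))) * PowerSeries.expand 23 (by norm_num) (∏ k ∈ Finset.range p, (1 - PowerSeries.X ^ (k + 1)))) := by
    rw [DN, map_mul, map_prod, map_prod, ← Finset.prod_mul_distrib, PowerSeries.map_X]
    congr 1
    rw [Finset.range_eq_Ico, Finset.prod_Ico_add' (fun k => (1 - (PowerSeries.X : PowerSeries (ZMod 23)) ^ k) * PowerSeries.expand 23 (by norm_num) (1 - (PowerSeries.X : PowerSeries (ZMod 23)) ^ k)) 0 p 1]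
    refine Finset.prod_congr (by ext; simp) (fun i _ => ?_)
    rw [← hfac]; simp
  obtain ⟨m, rfl⟩ : ∃ m, p = m + 1 := ⟨p - 1, by omega⟩
  rw [h1, PowerSeries.coeff_succ_X_mul, Nat.add_sub_cancel, PowerSeries.coeff_mul, PowerSeries.coeff_mul]
  refine Finset.sum_congr rfl (fun ij hij => ?_)
  have hs := Finset.HasAntidiagonal.mem_antidiagonal.mp hij
  rw [coeff_prod_pent _ _ _ (by omega)]
  congr 1
  rw [PowerSeries.coeff_expand, PowerSeries.coeff_expand]
  split_ifs
  · rw [coeff_prod_pent _ _ _]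
    have := Nat.div_le_self ij.2 23
    omega
  · rfl

lemma pent_sq (a : ℤ) : 24 * (pentagonal a : ℤ) + 1 = (6 * a - 1) ^ 2 := by
  linear_combination 12 * two_mul_natCast_pentagonal a

lemma norm6 {x : ℤ} (h : x % 2 = 1) (h3 : x % 3 ≠ 0) : ∃ a : ℤ, x ^ 2 = (6 * a - 1) ^ 2 := by
  have : x % 6 = 1 ∨ x % 6 = 5 := by omega
  rcases this with h | h
  · exact ⟨-(x / 6), by rw [show 6 * (-(x / 6)) - 1 = -x by omega]; ring⟩
  · exact ⟨x / 6 + 1, by rw [show 6 * (x / 6 + 1) - 1 = x by omega]⟩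

lemma sol_norm {p : ℕ} (hp2 : p % 2 = 1) (hp3 : p % 3 ≠ 0) (h : Sol p) :
    ∃ a b : ℤ, (6 * a - 1) ^ 2 + 23 * (6 * b - 1) ^ 2 = 24 * p := by
  obtain ⟨X, Y, h⟩ := h
  have hX := sq8 X
  have hY := sq8 Y
  have sq3 : ∀ x : ℤ, x ^ 2 % 3 = 0 ∧ x % 3 = 0 ∨ x ^ 2 % 3 = 1 ∧ x % 3 ≠ 0 := by
    intro x
    have : x % 3 = 0 ∨ x % 3 = 1 ∨ x % 3 = 2 := by omega
    rcases this with h | h | h <;> simp [sq, Int.mul_emod, h]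
  have hX2 : X % 2 = 1 := by
    by_contra hc
    obtain ⟨x', rfl⟩ : (2:ℤ) ∣ X := by omega
    obtain ⟨y', rfl⟩ : (2:ℤ) ∣ Y := by omega
    exact no6 hp2 (x := x') (y := y') (by linarith)
  have h3 : ¬ (X % 3 = 0 ∧ Y % 3 = 0) := by
    rintro ⟨h1, h2⟩
    obtain ⟨x', rfl⟩ : (3:ℤ) ∣ X := by omega
    obtain ⟨y', rfl⟩ : (3:ℤ) ∣ Y := by omega
    have : (3:ℤ) * (x' ^ 2 + 23 * y' ^ 2) = 8 * p := by linarith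
    omega
  have hX3 := sq3 X
  have hY3 := sq3 Y
  obtain ⟨a, ha⟩ := norm6 hX2 (by omega)
  obtain ⟨b, hb⟩ := norm6 (x := Y) (by omega) (by omega)
  exact ⟨a, b, by rw [← ha, ← hb, h]⟩


lemma crit23 {p : ℕ} (hp : p.Prime) (h4 : p % 4 = 3) (hp23 : 23 < p) (h0 : ramanujanTau p = 0) :
    legendreSym 23 p = -1 := by
  classical
  have hF : Fact p.Prime := ⟨hp⟩
  have hne : ((p : ℤ) : ZMod 23) ≠ 0 := by
    intro h
    have : 23 ∣ p := by
      rw [← ZMod.natCast_eq_zero_iff]; exact_mod_cast h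
    have := (Nat.prime_dvd_prime_iff_eq (by norm_num) hp).mp this
    omega
  rcases legendreSym.eq_one_or_neg_one 23 hne with hl | hl
  swap
  · exact hl
  exfalso
  have hp3 : p % 3 ≠ 0 := by
    intro h
    have := (Nat.prime_dvd_prime_iff_eq (by norm_num) hp).mp (Nat.dvd_of_mod_eq_zero h)
    omega
  have hp2 : p % 2 = 1 := by omega
  obtain ⟨a, b, hab⟩ := sol_norm hp2 hp3 (exists_sol hp h4 (by omega) hl)
  have ht := tau23 p hp.ne_zero
  rw [h0, Int.cast_zero, PowerSeries.coeff_mul] at ht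
  set f : ℕ × ℕ → ZMod 23 := fun ij => PowerSeries.coeff ij.1 (PowerSeries.pentagonalSeries (ZMod 23)) *
    PowerSeries.coeff ij.2 ((PowerSeries.pentagonalSeries (ZMod 23)).expand 23 (by norm_num)) with hf
  set ε : ZMod 23 := (((Int.negOnePow (a + b) : ℤˣ) : ℤ) : ZMod 23) with hε
  set T := (Finset.HasAntidiagonal.antidiagonal (p - 1)).filter (fun ij => f ij ≠ 0) with hT
  have hterm : ∀ ij ∈ T, ∃ a' b' : ℤ, pentagonal a' = ij.1 ∧ 23 * pentagonal b' = ij.2 ∧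
      (6 * a' - 1) ^ 2 + 23 * (6 * b' - 1) ^ 2 = 24 * (p:ℤ) := by
    intro ij hij
    rw [hT, Finset.mem_filter] at hij
    have hs := Finset.HasAntidiagonal.mem_antidiagonal.mp hij.1
    have h1 := left_ne_zero_of_mul hij.2
    have h2 := right_ne_zero_of_mul hij.2
    rw [PowerSeries.coeff_expand] at h2
    split_ifs at h2 with hd
    · obtain ⟨a', ha'⟩ : ij.1 ∈ Set.range pentagonal := by
        by_contra hc; exact h1 (PowerSeries.coeff_pentagonalSeries_eq_zero _ hc)
      obtain ⟨b', hb'⟩ : ij.2 / 23 ∈ Set.range pentagonal := by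
        by_contra hc; exact h2 (PowerSeries.coeff_pentagonalSeries_eq_zero _ hc)
      have h3 : 23 * pentagonal b' = ij.2 := by rw [hb']; exact Nat.mul_div_cancel' hd
      refine ⟨a', b', ha', h3, ?_⟩
      rw [← pent_sq, ← pent_sq]
      have := hp.pos
      have : (ij.1 : ℤ) + ij.2 = p - 1 := by omega
      rw [← ha', ← h3] at this
      push_cast at this
      linarith
    · exact absurd rfl h2
  have hval : ∀ ij ∈ T, f ij = ε := by
    intro ij hij
    obtain ⟨a', b', ha', hb', hab'⟩ := hterm ij hij
    have hss := same_sign hp hp2 (by omega) hab hab'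
    simp only [hf]
    rw [← ha', ← hb', PowerSeries.coeff_expand_mul, PowerSeries.coeff_pentagonalSeries_pentagonal, PowerSeries.coeff_pentagonalSeries_pentagonal,
      hε, (Int.negOnePow_eq_iff (a + b) (a' + b')).mpr (by rw [Int.even_iff]; omega), Int.negOnePow_add]
    push_cast; rfl
  have hsum : ∑ ij ∈ Finset.HasAntidiagonal.antidiagonal (p - 1), f ij = T.card * ε := by
    rw [← Finset.sum_filter_ne_zero, Finset.sum_congr rfl hval, Finset.sum_const, nsmul_eq_mul]
  rw [← ht] at hsum
  have hε0 : ε ≠ 0 := by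
    rcases Int.units_eq_one_or (Int.negOnePow (a + b)) with h | h <;> rw [hε, h] <;> decide
  have hc : (T.card : ZMod 23) = 0 := (mul_eq_zero.mp hsum.symm).resolve_right hε0
  rw [ZMod.natCast_eq_zero_iff] at hc
  have hTne : 0 < T.card := by
    apply Finset.card_pos.mpr
    refine ⟨(pentagonal a, 23 * pentagonal b), ?_⟩
    rw [hT, Finset.mem_filter, Finset.HasAntidiagonal.mem_antidiagonal]
    constructor
    · have := pent_sq a
      have := pent_sq b
      simp only
      omega
    · simp only [hf]
      rw [PowerSeries.coeff_expand_mul, PowerSeries.coeff_pentagonalSeries_pentagonal, PowerSeries.coeff_pentagonalSeries_pentagonal]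
      rcases Int.units_eq_one_or (Int.negOnePow a) with h | h <;> 
      rcases Int.units_eq_one_or (Int.negOnePow b) with h' | h' <;> rw [h, h'] <;> decide
  have hTle : T.card ≤ 10 := by
    have hsub : T ⊆ nmT.image (fun nm => 
      let i : ℕ := ((((nm.1 * (6 * a - 1) - 23 * nm.2 * (6 * b - 1)) / 24) ^ 2 - 1) / 24).toNat
      (i, p - 1 - i)) := by
      intro ij hij
      obtain ⟨a', b', ha', hb', hab'⟩ := hterm ij hij
      obtain ⟨Z, n, m, hZ, h1, h2, h3⟩ := two_sol hp (by omega) hab hab'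
      obtain ⟨e1, e2⟩ := X_eq hp hab h1 h2
      rw [Finset.mem_image]
      refine ⟨(n, m), nm_mem h3, ?_⟩
      rw [hT, Finset.mem_filter] at hij
      have hs := Finset.HasAntidiagonal.mem_antidiagonal.mp hij.1
      have : ((((n * (6 * a - 1) - 23 * m * (6 * b - 1)) / 24) ^ 2 - 1) / 24).toNat = ij.1 := by
        rw [← e1, Int.mul_ediv_cancel_left _ (by norm_num), ← pent_sq, add_sub_cancel_right,
          Int.mul_ediv_cancel_left _ (by norm_num), Int.toNat_natCast, ha']
      simp only [this]
      ext
      · rfl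
      · simp only; omega
    calc T.card ≤ _ := Finset.card_le_card hsub
      _ ≤ nmT.card := Finset.card_image_le
      _ = 10 := by decide
  have := Nat.le_of_dvd hTne hc
  omega

end SerreTau

open Polynomial
namespace SerreTau
open Complex Filter Topology
open UpperHalfPlane hiding I

open Classical in
/-- sum over positive squares -/
noncomputable def r0 : PowerSeries ℤ := PowerSeries.mk fun n => if ∃ k : ℕ, (k + 1) ^ 2 = n then 1 else 0
open Classical in
/-- sum over triangular numbers -/
noncomputable def tH : PowerSeries ℤ := PowerSeries.mk fun n => if ∃ k : ℕ, k * (k + 1) = 2 * n then 1 else 0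
/-- theta series -/
noncomputable def tA : PowerSeries ℤ := 1 + 2 * r0

lemma coeff_X_mul' {R : Type*} [CommRing R] (F : PowerSeries R) (n : ℕ) : PowerSeries.coeff n (PowerSeries.X * F) =
    if n = 0 then 0 else PowerSeries.coeff (n - 1) F := by
  cases n with
  | zero => simp
  | succ n => rw [PowerSeries.coeff_succ_X_mul]; simp

lemma r0_split : r0 = r0.expand 4 (by norm_num) + PowerSeries.X * tH.expand 8 (by norm_num) := by
  classical
  ext n
  rw [map_add, PowerSeries.coeff_expand, coeff_X_mul', PowerSeries.coeff_expand, r0, tH]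
  simp only [PowerSeries.coeff_mk]
  rcases Nat.even_or_odd n with hn | hn
  · obtain ⟨m, rfl⟩ := hn
    have h8 : m + m ≠ 0 → ¬ 8 ∣ (m + m - 1) := by omega
    have e1 : (if m + m = 0 then (0:ℤ) else if 8 ∣ (m + m - 1) then (if ∃ k : ℕ, k * (k + 1) = 2 * ((m + m - 1) / 8) then 1 else 0) else 0) = 0 := by
      split_ifs with h1 h2 <;> first | rfl | exact absurd h2 (h8 h1)
    rw [e1, add_zero]
    by_cases hk : ∃ k : ℕ, (k + 1) ^ 2 = m + m
    · obtain ⟨k, hk⟩ := hk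
      have hkp : Even ((k + 1) ^ 2) := ⟨m, hk⟩
      rw [Nat.even_pow] at hkp
      obtain ⟨j, hj⟩ := hkp.1
      have h4 : m + m = 4 * (j ^ 2) := by rw [← hk, hj]; ring
      rw [if_pos ⟨k, hk⟩, h4, if_pos (Dvd.intro _ rfl), if_pos]
      refine ⟨j - 1, ?_⟩
      rw [Nat.mul_div_cancel_left _ (by norm_num), Nat.sub_add_cancel (by omega)]
    · rw [if_neg hk]
      split_ifs with h1 h2
      · obtain ⟨j, hj⟩ := h2
        exact (hk ⟨2 * (j + 1) - 1, by
          rw [Nat.sub_add_cancel (by omega), mul_pow, hj]; omega⟩).elim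
      · rfl
      · rfl
  · obtain ⟨m, rfl⟩ := hn
    rw [if_neg (show ¬ 4 ∣ 2 * m + 1 by omega), if_neg (show 2 * m + 1 ≠ 0 by omega), zero_add, Nat.add_sub_cancel]
    by_cases hk : ∃ k : ℕ, (k + 1) ^ 2 = 2 * m + 1
    · obtain ⟨k, hk⟩ := hk
      have hkp : Odd ((k + 1) ^ 2) := ⟨m, hk⟩
      obtain ⟨j, hj⟩ := Nat.Odd.of_mul_left (n := k + 1) (by rw [← sq]; exact hkp)
      have h4 : 2 * m = 4 * (j * (j + 1)) := by
        have : 2 * m + 1 = 4 * (j * (j + 1)) + 1 := by rw [← hk, hj]; ring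
        omega
      obtain ⟨t, ht⟩ := Nat.even_mul_succ_self j
      rw [if_pos ⟨k, hk⟩, if_pos (by omega), if_pos]
      exact ⟨j, by omega⟩
    · rw [if_neg hk]
      split_ifs with h1 h2
      · obtain ⟨j, hj⟩ := h2
        refine (hk ⟨2 * j, ?_⟩).elim
        have : 2 * m = 4 * (j * (j + 1)) := by omega
        rw [this]; ring
      · rfl
      · rfl

lemma expand_ofNat {R : Type*} [CommRing R] (m : ℕ) (hm : m ≠ 0) (n : ℕ) [n.AtLeastTwo] :
    PowerSeries.expand m hm (no_index (OfNat.ofNat n : PowerSeries R)) = OfNat.ofNat n := map_ofNat _ n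

lemma tA_split : tA = tA.expand 4 (by norm_num) + 2 * (PowerSeries.X * tH.expand 8 (by norm_num)) := by
  rw [tA, map_add, map_one, map_mul, map_ofNat]
  linear_combination 2 * r0_split

lemma QC_bdd {F : PowerSeries ℂ} (h : ∀ n, ‖PowerSeries.coeff n F‖ ≤ 1) : QC F := by
  intro r h0 h1
  refine Summable.of_nonneg_of_le (fun n => by positivity) (fun n => ?_) (summable_geometric_of_lt_one h0 h1)
  have := h n
  have : 0 ≤ r ^ n := by positivity
  nlinarith

lemma QC_r0 : QC (cz r0) := by
  apply QC_bdd
  intro n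
  rw [coeff_cz, r0, PowerSeries.coeff_mk]
  split_ifs <;> simp
lemma QC_H : QC (cz tH) := by
  apply QC_bdd
  intro n
  rw [coeff_cz, tH, PowerSeries.coeff_mk]
  split_ifs <;> simp
lemma QC_A : QC (cz tA) := by
  rw [tA, map_add, map_one, map_mul, map_ofNat]
  exact QC.one.add ((QC.ofNat 2).mul QC_r0)

lemma ev_A {z : ℂ} (hz : 0 < z.im) : ev (cz tA) z = jacobiTheta (2 * z) := by
  have hz2 : 0 < (2 * z).im := by simp [hz]
  have h1 := hasSum_nat_jacobiTheta hz2
  have h2 : ev (cz r0) z = (jacobiTheta (2 * z) - 1) / 2 := by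
    have h3 := QC_r0.hasSum (qq_lt hz)
    have hinj : Function.Injective (fun k : ℕ => (k + 1) ^ 2) := by
      intro a b hab
      have := Nat.pow_left_injective (n := 2) (by norm_num) hab
      omega
    rw [← hinj.hasSum_iff] at h3
    · refine h3.unique ?_
      refine h1.congr_fun ?_
      intro k
      simp only [Function.comp]
      rw [coeff_cz, r0, PowerSeries.coeff_mk, if_pos ⟨k, rfl⟩, qq, ← Complex.exp_nat_mul]
      simp only [Int.cast_one, one_mul]
      congr 1
      push_cast; ring
    · intro n hn
      rw [coeff_cz, r0, PowerSeries.coeff_mk, if_neg]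
      · simp
      · rintro ⟨k, hk⟩; exact hn ⟨k, hk⟩
  rw [tA, map_add, map_one, map_mul, map_ofNat, ev_add QC.one ((QC.ofNat 2).mul QC_r0) hz, ev_one,
    ev_mul (QC.ofNat 2) QC_r0 hz, ev_ofNat, h2]
  ring

/-- analytic theta functions -/
noncomputable def al (z : ℂ) : ℂ := ev (cz tA) z
noncomputable def be (z : ℂ) : ℂ := 2 * qq (z / 4) * ev (cz tH) (2 * z)
noncomputable def sr (z : ℂ) : ℂ := (-I * z / 2) ^ (1 / 2 : ℂ)

lemma al_quarter {z : ℂ} (hz : 0 < z.im) : al (z / 4) = al z + be z := by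
  have h := congrArg (fun F => ev (cz F) (z / 4)) tA_split
  have hz4 : 0 < (z / 4).im := by simp [hz]
  simp only [map_add, map_mul, map_ofNat, cz_X, cz_expand] at h
  rw [ev_add (QC_A.expand _ _) ((QC.ofNat 2).mul (QC.X.mul (QC_H.expand _ _))) hz4,
    ev_mul (QC.ofNat 2) (QC.X.mul (QC_H.expand _ _)) hz4, ev_mul QC.X (QC_H.expand _ _) hz4,
    ev_expand, ev_expand, ev_ofNat, ev_X] at h
  rw [al, al, be, h]
  push_cast
  rw [show (4:ℂ) * (z / 4) = z by ring, show (8:ℂ) * (z / 4) = 2 * z by ring]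
  ring

lemma al_S {z : ℂ} (hz : 0 < z.im) : al (-1 / z) = sr z * (al z + be z) := by
  have hz0 : z ≠ 0 := by rintro rfl; simp at hz
  have hz2 : 0 < (z / 2).im := by simp [hz]
  have h := jacobiTheta_S_smul ⟨z / 2, hz2⟩
  rw [UpperHalfPlane.modular_S_smul] at h
  simp only [UpperHalfPlane.coe_mk] at h
  rw [← al_quarter hz, al, al, ev_A (im_S hz), ev_A (by simp [hz]), sr]
  rw [show 2 * (z / 4) = z / 2 by ring, show -I * z / 2 = -I * (z / 2) by ring, ← h]
  congr 1
  field_simp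

lemma sr_sq (z : ℂ) : sr z ^ 2 = -I * z / 2 := by
  rw [sr, ← Complex.cpow_nat_mul]; simp

lemma sr_scale {c : ℝ} (hc : 0 ≤ c) (z : ℂ) : sr ((c ^ 2 : ℝ) * z) = c * sr z := by
  rw [sr, sr, show -I * (((c ^ 2 : ℝ) : ℂ) * z) / 2 = ((c ^ 2 : ℝ) : ℂ) * (-I * z / 2) by ring]
  have hh : (1 / 2 : ℂ) ≠ 0 := by norm_num
  by_cases hw : -I * z / 2 = 0
  · rw [hw, mul_zero, Complex.zero_cpow hh, mul_zero]
  rcases hc.eq_or_lt with rfl | hc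
  · simp [Complex.zero_cpow]
  have hc2 : 0 < c ^ 2 := by positivity
  rw [Complex.cpow_def_of_ne_zero (mul_ne_zero (by exact_mod_cast hc2.ne') hw), Complex.cpow_def_of_ne_zero hw,
    Complex.log_ofReal_mul hc2 hw, add_mul, Complex.exp_add]
  congr 1
  rw [Real.log_pow]
  have : (((2:ℕ) * Real.log c : ℝ) : ℂ) * (1 / 2) = (Real.log c : ℝ) := by push_cast; ring
  rw [this, ← Complex.ofReal_exp, Real.exp_log hc]

lemma be_S {z : ℂ} (hz : 0 < z.im) : be (-1 / z) = sr z * (al z - be z) := by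
  have h1 := al_quarter (im_S hz)
  have h4 : 0 < (4 * z).im := by simp [hz]
  have h2 : al (-1 / z / 4) = sr (4 * z) * al z := by
    rw [show -1 / z / 4 = -1 / (4 * z) by rw [div_div]; ring, al_S h4, ← al_quarter h4]
    congr 2; ring
  have h3 : sr (4 * z) = 2 * sr z := by
    have := sr_scale (c := 2) (by norm_num) z
    norm_num at this; exact this
  rw [h2, h3, al_S hz] at h1
  linear_combination -h1

end SerreTau

open Polynomial
namespace SerreTau
open Complex Filter Topology
open UpperHalfPlane hiding I

/-- F converges and has value v at z -/
def EV (z : ℂ) (F : PowerSeries ℂ) (v : ℂ) : Prop := QC F ∧ ev F z = v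

lemma EV.add {z v w : ℂ} (hz : 0 < z.im) {F G : PowerSeries ℂ} (hF : EV z F v) (hG : EV z G w) : EV z (F + G) (v + w) :=
  ⟨hF.1.add hG.1, by rw [ev_add hF.1 hG.1 hz, hF.2, hG.2]⟩
lemma EV.sub {z v w : ℂ} (hz : 0 < z.im) {F G : PowerSeries ℂ} (hF : EV z F v) (hG : EV z G w) : EV z (F - G) (v - w) :=
  ⟨hF.1.sub hG.1, by rw [ev_sub hF.1 hG.1 hz, hF.2, hG.2]⟩
lemma EV.mul {z v w : ℂ} (hz : 0 < z.im) {F G : PowerSeries ℂ} (hF : EV z F v) (hG : EV z G w) : EV z (F * G) (v * w) :=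
  ⟨hF.1.mul hG.1, by rw [ev_mul hF.1 hG.1 hz, hF.2, hG.2]⟩
lemma EV.pow {z v : ℂ} (hz : 0 < z.im) {F : PowerSeries ℂ} (hF : EV z F v) (n : ℕ) : EV z (F ^ n) (v ^ n) :=
  ⟨hF.1.pow n, by rw [ev_pow hF.1 n hz, hF.2]⟩
lemma EV.cmul {z v : ℂ} (hz : 0 < z.im) {F : PowerSeries ℂ} (n : ℕ) [n.AtLeastTwo] (hF : EV z F v) :
    EV z (OfNat.ofNat n * F) (OfNat.ofNat n * v) :=
  ⟨(QC.ofNat n).mul hF.1, by rw [ev_mul (QC.ofNat n) hF.1 hz, ev_ofNat, hF.2]⟩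
lemma EV.expand {z v : ℂ} {F : PowerSeries ℂ} (m : ℕ) (hm : m ≠ 0) (hF : EV (m * z) F v) : EV z (F.expand m hm) v :=
  ⟨hF.1.expand m hm, by rw [ev_expand, hF.2]⟩
lemma EV.X (z : ℂ) : EV z PowerSeries.X (qq z) := ⟨QC.X, ev_X z⟩

lemma Md_of_EV {k : ℕ} {F : PowerSeries ℂ} (f : ℂ → ℂ) (h : ∀ z : ℂ, 0 < z.im → EV z F (f z))
    (hf : ∀ z : ℂ, 0 < z.im → f (-1 / z) = z ^ k * f z) : Md k F :=
  ⟨(h I (by simp)).1, fun z hz => by rw [(h z hz).2, (h _ (im_S hz)).2, hf z hz]⟩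

lemma EV_A (z : ℂ) : EV z (cz tA) (al z) := ⟨QC_A, rfl⟩
lemma EV_H (z : ℂ) : EV z (cz tH) (ev (cz tH) z) := ⟨QC_H, rfl⟩

/-- fourth power of the second theta, divided by 16 -/
noncomputable def tB : PowerSeries ℤ := PowerSeries.X * (tH.expand 2 (by norm_num)) ^ 4

lemma qq_pow (z : ℂ) (n : ℕ) : qq z ^ n = qq (n * z) := by
  rw [qq, qq, ← Complex.exp_nat_mul]; congr 1; ring

lemma EV_B {z : ℂ} (hz : 0 < z.im) : EV z (cz tB) (be z ^ 4 / 16) := by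
  have h := (EV.X z).mul hz (((EV_H (((2:ℕ):ℂ) * z)).expand 2 (by norm_num)).pow hz 4)
  have e : be z ^ 4 / 16 = qq z * ev (cz tH) (((2:ℕ):ℂ) * z) ^ 4 := by
    rw [be, mul_pow, mul_pow, qq_pow]
    rw [show ((4:ℕ):ℂ) * (z / 4) = z by push_cast; ring]
    push_cast; ring
  rw [e, tB, map_mul, map_pow, cz_X, cz_expand]
  exact h

lemma sr8 (z : ℂ) : sr z ^ 8 = z ^ 4 / 16 := by
  rw [show sr z ^ 8 = (sr z ^ 2) ^ 4 by ring, sr_sq, div_pow, mul_pow, neg_pow, I_pow_four]; norm_num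
lemma sr4 (z : ℂ) : sr z ^ 4 = -z ^ 2 / 4 := by
  rw [show sr z ^ 4 = (sr z ^ 2) ^ 2 by ring, sr_sq, div_pow, mul_pow, neg_pow, I_sq]; norm_num
lemma sr12 (z : ℂ) : sr z ^ 12 = -z ^ 6 / 64 := by
  rw [show sr z ^ 12 = (sr z ^ 4) ^ 3 by ring, sr4]; ring

lemma cc_A : PowerSeries.constantCoeff tA = 1 := by
  classical
  rw [tA, map_add, map_one, map_mul, ← PowerSeries.coeff_zero_eq_constantCoeff_apply r0, r0, PowerSeries.coeff_mk, if_neg]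
  · simp
  · rintro ⟨k, hk⟩; exact absurd hk (by positivity)
lemma cc_B : PowerSeries.constantCoeff tB = 0 := by
  simp [tB]
lemma cc_H : PowerSeries.constantCoeff tH = 1 := by
  classical
  rw [← PowerSeries.coeff_zero_eq_constantCoeff_apply tH, tH, PowerSeries.coeff_mk, if_pos ⟨0, by simp⟩]

lemma Q_theta : eQ = tA ^ 8 + 224 * (tA ^ 4 * tB) + 256 * tB ^ 2 := by
  rw [← sub_eq_zero]
  refine zsturm (k := 4) ?_ (by norm_num) ?_ (Or.inl (by norm_num))
  · simp only [map_sub, map_add, map_mul, map_ofNat, map_pow]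
    refine Md_Q.sub (Md_of_EV _ (fun z hz => (((EV_A z).pow hz 8).add hz
      ((((EV_A z).pow hz 4).mul hz (EV_B hz)).cmul hz 224)).add hz (((EV_B hz).pow hz 2).cmul hz 256)) fun z hz => ?_)
    simp only [al_S hz, be_S hz]
    linear_combination (16 * (al z ^ 8 + 14 * al z ^ 4 * be z ^ 4 + be z ^ 8)) * sr8 z
  · simp only [eQ, map_sub, map_add, map_mul, map_pow, cc_A, cc_B, c0_Sg, cc_ofNat, map_one]; norm_num

lemma R_theta : eR = tA ^ 12 - 528 * (tA ^ 8 * tB) - 8448 * (tA ^ 4 * tB ^ 2) + 4096 * tB ^ 3 := by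
  rw [← sub_eq_zero]
  refine zsturm (k := 6) ?_ (by norm_num) ?_ (Or.inl (by norm_num))
  · simp only [map_sub, map_add, map_mul, map_ofNat, map_pow]
    refine Md_R.sub (Md_of_EV _ (fun z hz => ((((EV_A z).pow hz 12).sub hz
      ((((EV_A z).pow hz 8).mul hz (EV_B hz)).cmul hz 528)).sub hz
      ((((EV_A z).pow hz 4).mul hz ((EV_B hz).pow hz 2)).cmul hz 8448)).add hz
      (((EV_B hz).pow hz 3).cmul hz 4096)) fun z hz => ?_)
    simp only [al_S hz, be_S hz]
    linear_combination (-64 * (al z ^ 12 - 33 * al z ^ 8 * be z ^ 4 - 33 * al z ^ 4 * be z ^ 8 + be z ^ 12)) * sr12 z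
  · simp only [eR, map_sub, map_add, map_mul, map_pow, cc_A, cc_B, c0_Sg, cc_ofNat, map_one]; norm_num

/-- Jacobi defect -/
noncomputable def tJ : PowerSeries ℤ := tH ^ 4 - tA.expand 2 (by norm_num) * tH.expand 4 (by norm_num) *
  (tA.expand 2 (by norm_num) ^ 2 + 4 * (PowerSeries.X * tH.expand 4 (by norm_num) ^ 2))

/-- analytic defect -/
noncomputable def Fj (z : ℂ) : ℂ := be (z / 2) ^ 4 - al (z / 2) ^ 4 + (al (2 * z) - be (2 * z)) ^ 4

lemma al_half {z : ℂ} (hz : 0 < z.im) : al (z / 2) = al (2 * z) + be (2 * z) := by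
  rw [← al_quarter (by simp [hz])]; congr 1; ring

lemma EV_J {z : ℂ} (hz : 0 < z.im) : EV z (cz tJ) (Fj z / (16 * qq (z / 2))) := by
  have h := ((EV_H z).pow hz 4).sub hz ((((EV_A (((2:ℕ):ℂ) * z)).expand 2 (by norm_num)).mul hz
    ((EV_H (((4:ℕ):ℂ) * z)).expand 4 (by norm_num))).mul hz
    ((((EV_A (((2:ℕ):ℂ) * z)).expand 2 (by norm_num)).pow hz 2).add hz
      (((EV.X z).mul hz (((EV_H (((4:ℕ):ℂ) * z)).expand 4 (by norm_num)).pow hz 2)).cmul hz 4)))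
  have hq : qq (z / 2) ≠ 0 := Complex.exp_ne_zero _
  have hq2 : qq z = qq (z / 2) ^ 2 := by rw [qq_pow]; congr 1; push_cast; ring
  have hq8 : qq (z / 2 / 4) ^ 4 = qq (z / 2) := by rw [qq_pow]; congr 1; push_cast; ring
  rw [tJ]
  simp only [map_sub, map_mul, map_add, map_pow, map_ofNat, cz_X, cz_expand]
  convert h using 1
  rw [div_eq_iff (by simpa using hq), Fj, al_half hz, be, be, hq2]
  push_cast
  rw [show 2 * z / 4 = z / 2 by ring, show 2 * (z / 2) = z by ring, show 2 * (2 * z) = 4 * z by ring, mul_pow, mul_pow, hq8]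
  ring

lemma Fj_S {z : ℂ} (hz : 0 < z.im) : Fj (-1 / z) = -z ^ 2 * Fj z := by
  have hz2 : 0 < (2 * z).im := by simp [hz]
  have hzh : 0 < (z / 2).im := by simp [hz]
  have hz0 : z ≠ 0 := by rintro rfl; simp at hz
  have e1 : -1 / z / 2 = -1 / (2 * z) := by rw [div_div]; ring
  have e2 : 2 * (-1 / z) = -1 / (z / 2) := by field_simp
  have h3 : sr (2 * z) = 2 * sr (z / 2) := by
    have := sr_scale (c := 2) (by norm_num) (z / 2)
    norm_num at this; rw [← this]; congr 1; ring
  have h4 := sr4 (2 * z)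
  rw [Fj, Fj, e1, e2, al_S hz2, be_S hz2, al_S hzh, be_S hzh, al_half hz]
  rw [h3] at h4 ⊢
  linear_combination ((al (2 * z) - be (2 * z)) ^ 4 - (al (2 * z) + be (2 * z)) ^ 4 + be (z / 2) ^ 4) * h4

lemma jacobi : tJ = 0 := by
  have h : PowerSeries.X * tJ ^ 2 = 0 := by
    refine zsturm (k := 4) ?_ (by norm_num) (by simp) (Or.inl (by norm_num))
    simp only [map_mul, map_pow, cz_X]
    refine Md_of_EV (fun z => Fj z ^ 2 / 256) (fun z hz => ?_) (fun z hz => ?_)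
    · have hq : qq (z / 2) ≠ 0 := Complex.exp_ne_zero _
      have hq2 : qq z = qq (z / 2) ^ 2 := by rw [qq_pow]; congr 1; push_cast; ring
      convert (EV.X z).mul hz ((EV_J hz).pow hz 2) using 1
      rw [hq2]; field_simp; norm_num
    · simp only [Fj_S hz]; ring
  rcases mul_eq_zero.mp h with h | h
  · exact absurd h PowerSeries.X_ne_zero
  · exact pow_eq_zero_iff (by norm_num) |>.mp h

end SerreTau

open Polynomial
namespace SerreTau

/-- support in a residue class -/
def Su (m r : ℕ) (F : PowerSeries ℤ) : Prop := ∀ n, n % m ≠ r % m → PowerSeries.coeff n F = 0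

lemma Su.mul {m r s : ℕ} {F G : PowerSeries ℤ} (hF : Su m r F) (hG : Su m s G) : Su m (r + s) (F * G) := by
  intro n hn
  rw [PowerSeries.coeff_mul]
  refine Finset.sum_eq_zero (fun p hp => ?_)
  have := Finset.HasAntidiagonal.mem_antidiagonal.mp hp
  by_cases h1 : p.1 % m = r % m
  · have h2 : p.2 % m ≠ s % m := fun h2 => hn (by rw [← this, Nat.add_mod, h1, h2, ← Nat.add_mod])
    rw [hG _ h2, mul_zero]
  · rw [hF _ h1, zero_mul]
lemma Su.add {m r : ℕ} {F G : PowerSeries ℤ} (hF : Su m r F) (hG : Su m r G) : Su m r (F + G) := fun n hn => by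
  rw [map_add, hF n hn, hG n hn, add_zero]
lemma Su.sub {m r : ℕ} {F G : PowerSeries ℤ} (hF : Su m r F) (hG : Su m r G) : Su m r (F - G) := fun n hn => by
  rw [map_sub, hF n hn, hG n hn, sub_zero]
lemma Su.neg {m r : ℕ} {F : PowerSeries ℤ} (hF : Su m r F) : Su m r (-F) := fun n hn => by
  rw [map_neg, hF n hn, neg_zero]
lemma Su.cast {m r s : ℕ} {F : PowerSeries ℤ} (hF : Su m r F) (h : r % m = s % m) : Su m s F := fun n hn =>
  hF n (by rwa [h])
lemma Su.C (m : ℕ) (c : ℤ) : Su m 0 (PowerSeries.C c) := fun n hn => by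
  rw [PowerSeries.coeff_C, if_neg]; rintro rfl; exact hn rfl
lemma Su.ofNat (m n : ℕ) [n.AtLeastTwo] : Su m 0 (OfNat.ofNat n) := by
  rw [← map_ofNat (PowerSeries.C (R := ℤ)) n]; exact Su.C m _
lemma Su.one (m : ℕ) : Su m 0 1 := by rw [← map_one (PowerSeries.C (R := ℤ))]; exact Su.C m _
lemma Su.cmul {m r : ℕ} (n : ℕ) [n.AtLeastTwo] {F : PowerSeries ℤ} (hF : Su m r F) : Su m r (OfNat.ofNat n * F) := by
  simpa using (Su.ofNat m n).mul hF
lemma Su.pow {m r : ℕ} {F : PowerSeries ℤ} (hF : Su m r F) (k : ℕ) : Su m (r * k) (F ^ k) := by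
  induction k with
  | zero => rw [pow_zero, mul_zero]; exact Su.one m
  | succ k ih => rw [pow_succ, mul_add, mul_one]; exact ih.mul hF
lemma Su.pow0 {m : ℕ} {F : PowerSeries ℤ} (hF : Su m 0 F) (k : ℕ) : Su m 0 (F ^ k) := by
  simpa using hF.pow k
lemma Su.mul0 {m r : ℕ} {F G : PowerSeries ℤ} (hF : Su m r F) (hG : Su m 0 G) : Su m r (F * G) := hF.mul hG
lemma Su.expand (F : PowerSeries ℤ) (m k : ℕ) (hk : k ≠ 0) (h : m ∣ k) : Su m 0 (F.expand k hk) := fun n hn => by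
  apply PowerSeries.coeff_expand_of_not_dvd
  intro h2; exact hn (by rw [Nat.mod_eq_zero_of_dvd (h.trans h2), Nat.zero_mod])
lemma Su.X (m : ℕ) : Su m 1 PowerSeries.X := fun n hn => by
  rw [PowerSeries.coeff_X, if_neg]; rintro rfl; exact hn rfl

/-- even part -/
noncomputable def xx : PowerSeries ℤ := tA.expand 4 (by norm_num)
/-- odd part -/
noncomputable def yy : PowerSeries ℤ := PowerSeries.X * tH.expand 8 (by norm_num)

lemma A_xy : tA = xx + 2 * yy := tA_split
lemma B_xy : tB = xx * yy * (xx ^ 2 + 4 * yy ^ 2) := by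
  have h := congrArg (PowerSeries.expand 2 (by norm_num)) jacobi
  rw [tJ] at h
  simp only [map_sub, map_mul, map_add, map_pow, expand_ofNat, PowerSeries.expand_X, map_zero] at h
  rw [← PowerSeries.expand_mul, ← PowerSeries.expand_mul] at h
  norm_num at h
  rw [tB, xx, yy]
  linear_combination PowerSeries.X * h

lemma Su_x : Su 16 0 (xx.expand 4 (by norm_num)) ∧ Su 4 0 xx := by
  refine ⟨?_, Su.expand _ _ _ _ (by norm_num)⟩
  rw [xx, ← PowerSeries.expand_mul]; exact Su.expand _ _ _ _ (by norm_num)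
lemma Su_y : Su 8 1 yy := (Su.X 8).mul (Su.expand _ _ _ _ (by norm_num))
lemma Su_y4 : Su 4 1 yy := (Su.X 4).mul (Su.expand _ _ _ _ (by norm_num))

/- polynomials in u = x^4, v = y^4 -/
def pD0 {R : Type*} [CommRing R] (u v : R) : R :=
  -1472*(u^5*v^1) + 143360*(u^4*v^2) - 3833856*(u^3*v^3) + 36700160*(u^2*v^4) - 96468992*(u^1*v^5)
def pD1 {R : Type*} [CommRing R] (u v : R) : R :=
  1*(u^5) + 4784*(u^4*v^1) - 296448*(u^3*v^2) + 5005312*(u^2*v^3) - 27983872*(u^1*v^4) + 66060288*(v^5)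
def pD2 {R : Type*} [CommRing R] (u v : R) : R :=
  -24*(u^5) - 4992*(u^4*v^1) + 86016*(u^3*v^2) + 1376256*(u^2*v^3) - 20447232*(u^1*v^4) - 25165824*(v^5)
def pD3 {R : Type*} [CommRing R] (u v : R) : R :=
  252*(u^5) - 27328*(u^4*v^1) + 1251328*(u^3*v^2) - 18972672*(u^2*v^3) + 78381056*(u^1*v^4) + 4194304*(v^5)
def pE0 {R : Type*} [CommRing R] (u v : R) : R :=
  691*(u^6) + 274945015392*(u^5*v^1) + 552089658137856*(u^4*v^2) + 30829038398947328*(u^3*v^3) + 141334952483291136*(u^2*v^4) + 18018796528730112*(u^1*v^5) + 11593056256*(v^6)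
def pE1 {R : Type*} [CommRing R] (u v : R) : R :=
  1*(u^5) + 48828080*(u^4*v^1) + 29525768704*(u^3*v^2) + 872744771584*(u^2*v^3) + 2017163804672*(u^1*v^4) + 46438285312*(v^5)
def pE2 {R : Type*} [CommRing R] (u v : R) : R :=
  2049*(u^5) + 362886096*(u^4*v^1) + 86983033344*(u^3*v^2) + 1391728533504*(u^2*v^3) + 1486381449216*(u^1*v^4) + 2148532224*(v^5)
def pE3 {R : Type*} [CommRing R] (u v : R) : R :=
  177148*(u^5) + 1969886528*(u^4*v^1) + 218186192896*(u^3*v^2) + 1889649197056*(u^2*v^3) + 799999262720*(u^1*v^4) + 4194304*(v^5)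

lemma poly_D {R : Type*} [CommRing R] (x y Q S A B : R) (hA : A = x + 2 * y) (hB : B = x * y * (x ^ 2 + 4 * y ^ 2))
    (hQ : Q = A ^ 8 + 224 * (A ^ 4 * B) + 256 * B ^ 2)
    (hS : S = A ^ 12 - 528 * (A ^ 8 * B) - 8448 * (A ^ 4 * B ^ 2) + 4096 * B ^ 3) :
    Q ^ 3 - S ^ 2 = 1728 * (pD0 (x ^ 4) (y ^ 4) + x ^ 3 * y * pD1 (x ^ 4) (y ^ 4) +
      x ^ 2 * y ^ 2 * pD2 (x ^ 4) (y ^ 4) + x * y ^ 3 * pD3 (x ^ 4) (y ^ 4)) := by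
  have h1 : Q ^ 3 - S ^ 2 = 1728 * (A ^ 4 * B * (A ^ 4 - 16 * B) ^ 4) := by rw [hQ, hS]; ring
  rw [h1, hB, hA]; simp only [pD0, pD1, pD2, pD3]; ring

lemma poly_E {R : Type*} [CommRing R] (x y Q S A B : R) (hA : A = x + 2 * y) (hB : B = x * y * (x ^ 2 + 4 * y ^ 2))
    (hQ : Q = A ^ 8 + 224 * (A ^ 4 * B) + 256 * B ^ 2)
    (hS : S = A ^ 12 - 528 * (A ^ 8 * B) - 8448 * (A ^ 4 * B ^ 2) + 4096 * B ^ 3) :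
    441 * Q ^ 3 + 250 * S ^ 2 = pE0 (x ^ 4) (y ^ 4) + 65520 * (x ^ 3 * y * pE1 (x ^ 4) (y ^ 4) +
      x ^ 2 * y ^ 2 * pE2 (x ^ 4) (y ^ 4) + x * y ^ 3 * pE3 (x ^ 4) (y ^ 4)) := by
  have hQ' : Q = (1) * (x ^ 8 * y ^ 0) + (240) * (x ^ 7 * y ^ 1) + (2160) * (x ^ 6 * y ^ 2) + (6720) * (x ^ 5 * y ^ 3) + (17504) * (x ^ 4 * y ^ 4) + (26880) * (x ^ 3 * y ^ 5) + (34560) * (x ^ 2 * y ^ 6) + (15360) * (x ^ 1 * y ^ 7) + (256) * (x ^ 0 * y ^ 8) := by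
    rw [hQ, hB, hA]; ring
  have hS' : S = (1) * (x ^ 12 * y ^ 0) + (-504) * (x ^ 11 * y ^ 1) + (-16632) * (x ^ 10 * y ^ 2) + (-122976) * (x ^ 9 * y ^ 3) + (-532752) * (x ^ 8 * y ^ 4) + (-1564416) * (x ^ 7 * y ^ 5) + (-3725568) * (x ^ 6 * y ^ 6) + (-6257664) * (x ^ 5 * y ^ 7) + (-8524032) * (x ^ 4 * y ^ 8) + (-7870464) * (x ^ 3 * y ^ 9) + (-4257792) * (x ^ 2 * y ^ 10) + (-516096) * (x ^ 1 * y ^ 11) + (4096) * (x ^ 0 * y ^ 12) := by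
    rw [hS, hB, hA]; ring
  rw [hQ', hS']; simp only [pE0, pE1, pE2, pE3]; ring

lemma De_xy : De = pD0 (xx ^ 4) (yy ^ 4) + xx ^ 3 * yy * pD1 (xx ^ 4) (yy ^ 4) +
      xx ^ 2 * yy ^ 2 * pD2 (xx ^ 4) (yy ^ 4) + xx * yy ^ 3 * pD3 (xx ^ 4) (yy ^ 4) := by
  have h := poly_D xx yy eQ eR tA tB A_xy B_xy Q_theta R_theta
  rw [← De_eq] at h
  exact mul_left_cancel₀ (by norm_num) h

lemma S_xy : 691 + 65520 * Sg 11 = pE0 (xx ^ 4) (yy ^ 4) + 65520 * (xx ^ 3 * yy * pE1 (xx ^ 4) (yy ^ 4) +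
      xx ^ 2 * yy ^ 2 * pE2 (xx ^ 4) (yy ^ 4) + xx * yy ^ 3 * pE3 (xx ^ 4) (yy ^ 4)) := by
  rw [← E12]
  exact poly_E xx yy eQ eR tA tB A_xy B_xy Q_theta R_theta

lemma Su_v : Su 4 0 (yy ^ 4) := (Su_y4.pow 4).cast rfl
lemma Su_u : Su 4 0 (xx ^ 4) := Su_x.2.pow0 4

lemma Su_uv (i j : ℕ) : Su 4 0 ((xx ^ 4) ^ i * (yy ^ 4) ^ j) := (Su_u.pow0 i).mul0 (Su_v.pow0 j)

lemma Su_p' {u v : PowerSeries ℤ} (hu : Su 4 0 u) (hv : Su 4 0 v) : Su 4 0 (pD0 u v) ∧ Su 4 0 (pD1 u v) ∧ Su 4 0 (pD2 u v) ∧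
    Su 4 0 (pD3 u v) ∧ Su 4 0 (pE0 u v) ∧ Su 4 0 (pE1 u v) ∧ Su 4 0 (pE2 u v) ∧ Su 4 0 (pE3 u v) := by
  refine ⟨?_, ?_, ?_, ?_, ?_, ?_, ?_, ?_⟩ <;>
  simp only [pD0, pD1, pD2, pD3, pE0, pE1, pE2, pE3] <;>
  repeat' with_reducible first
    | exact hu
    | exact hv
    | apply Su.add
    | apply Su.sub
    | apply Su.neg
    | apply Su.mul0
    | apply Su.pow0
    | exact Su.one _
    | exact Su.ofNat _ _

lemma Su_p : Su 4 0 (pD0 (xx ^ 4) (yy ^ 4)) ∧ Su 4 0 (pD1 (xx ^ 4) (yy ^ 4)) ∧ Su 4 0 (pD2 (xx ^ 4) (yy ^ 4)) ∧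
    Su 4 0 (pD3 (xx ^ 4) (yy ^ 4)) ∧ Su 4 0 (pE0 (xx ^ 4) (yy ^ 4)) ∧ Su 4 0 (pE1 (xx ^ 4) (yy ^ 4)) ∧
    Su 4 0 (pE2 (xx ^ 4) (yy ^ 4)) ∧ Su 4 0 (pE3 (xx ^ 4) (yy ^ 4)) := Su_p' Su_u Su_v

/-- the class pieces have the right support -/
lemma Su_cls {G : PowerSeries ℤ} (hG : Su 4 0 G) :
    Su 4 1 (xx ^ 3 * yy * G) ∧ Su 4 2 (xx ^ 2 * yy ^ 2 * G) ∧ Su 4 3 (xx * yy ^ 3 * G) := by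
  refine ⟨?_, ?_, ?_⟩
  · exact (((Su_x.2.pow0 3).mul Su_y4).mul0 hG).cast rfl
  · exact (((Su_x.2.pow0 2).mul (Su_y4.pow 2)).mul0 hG).cast rfl
  · exact ((Su_x.2.mul (Su_y4.pow 3)).mul0 hG).cast rfl

lemma De_cls1 {n : ℕ} (hn : n % 4 = 1) : PowerSeries.coeff n De = PowerSeries.coeff n (xx ^ 3 * yy * pD1 (xx ^ 4) (yy ^ 4)) := by
  obtain ⟨h0, h1, h2, h3, -⟩ := Su_p
  rw [De_xy, map_add, map_add, map_add, h0 n (by omega), (Su_cls h2).2.1 n (by omega), (Su_cls h3).2.2 n (by omega)]; ring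
lemma De_cls3 {n : ℕ} (hn : n % 4 = 3) : PowerSeries.coeff n De = PowerSeries.coeff n (xx * yy ^ 3 * pD3 (xx ^ 4) (yy ^ 4)) := by
  obtain ⟨h0, h1, h2, h3, -⟩ := Su_p
  rw [De_xy, map_add, map_add, map_add, h0 n (by omega), (Su_cls h1).1 n (by omega), (Su_cls h2).2.1 n (by omega)]; ring
lemma S_cls1 {n : ℕ} (hn : n % 4 = 1) : PowerSeries.coeff n (Sg 11) = PowerSeries.coeff n (xx ^ 3 * yy * pE1 (xx ^ 4) (yy ^ 4)) := by
  obtain ⟨-, -, -, -, h0, h1, h2, h3⟩ := Su_p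
  have h := congrArg (PowerSeries.coeff n) S_xy
  simp only [map_add, coeff_ofNat_mul] at h
  rw [Su.ofNat 4 691 n (by omega), h0 n (by omega), (Su_cls h2).2.1 n (by omega), (Su_cls h3).2.2 n (by omega)] at h
  linarith
lemma S_cls3 {n : ℕ} (hn : n % 4 = 3) : PowerSeries.coeff n (Sg 11) = PowerSeries.coeff n (xx * yy ^ 3 * pE3 (xx ^ 4) (yy ^ 4)) := by
  obtain ⟨-, -, -, -, h0, h1, h2, h3⟩ := Su_p
  have h := congrArg (PowerSeries.coeff n) S_xy
  simp only [map_add, coeff_ofNat_mul] at h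
  rw [Su.ofNat 4 691 n (by omega), h0 n (by omega), (Su_cls h1).1 n (by omega), (Su_cls h2).2.1 n (by omega)] at h
  linarith

end SerreTau

open Polynomial
namespace SerreTau

lemma pE1_mod {R : Type*} [CommRing R] (u v : R) : ∃ w, pE1 u v = pD1 u v + 8 * w :=
  ⟨6102912*(u^4*v^1) + 3690758144*(u^3*v^2) + 109092470784*(u^2*v^3) + 252148973568*(u^1*v^4) + 5796528128*(v^5), by simp only [pE1, pD1]; ring⟩
lemma pD3_mod {R : Type*} [CommRing R] (u v : R) : ∃ w, pD3 u v = 705 * pE3 u v - 124889088 * u ^ 5 - 1388770029568 * (u ^ 4 * v) + 16384 * w :=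
  ⟨-9388504928*(u^3*v^2) - 81311200128*(u^2*v^3) - 34423791616*(u^1*v^4) - 180224*(v^5), by simp only [pE3, pD3]; ring⟩
lemma pE3_mod {R : Type*} [CommRing R] (u v : R) : ∃ w, pE3 u v = 177148 * u ^ 5 + 64 * w :=
  ⟨30779477*(u^4*v^1) + 3409159264*(u^3*v^2) + 29525768704*(u^2*v^3) + 12499988480*(u^1*v^4) + 65536*(v^5), by simp only [pE3]; ring⟩

lemma mod4 {p : ℕ} (hp : p.Prime) (h2 : p ≠ 2) (h0 : ramanujanTau p = 0) : p % 4 = 3 := by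
  by_contra hne
  have hodd := hp.eq_two_or_odd
  have h1 : p % 4 = 1 := by omega
  obtain ⟨w, hw⟩ := pE1_mod (xx ^ 4) (yy ^ 4)
  have e := S_cls1 h1
  rw [hw, Sg_p hp, mul_add, show xx ^ 3 * yy * (8 * w) = 8 * (xx ^ 3 * yy * w) by ring, map_add, coeff_ofNat_mul, ← De_cls1 h1, De_p h0] at e
  have h3 : (p : ℤ) ≡ 1 [ZMOD 4] := by
    have : (p : ℤ) % 4 = 1 := by omega
    exact this
  have h4 : (p : ℤ) ^ 11 % 4 = 1 := by
    have h := h3.pow 11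
    rw [one_pow] at h; exact h
  omega

lemma xx_r : ∃ r : PowerSeries ℤ, xx = 1 + 2 * r :=
  ⟨r0.expand 4 (by norm_num), by rw [xx, tA, map_add, map_one, map_mul, expand_ofNat]⟩

lemma y4_eq : yy ^ 4 = xx.expand 4 (by norm_num) * yy.expand 4 (by norm_num) * (xx.expand 4 (by norm_num) ^ 2 + 4 * yy.expand 4 (by norm_num) ^ 2) := by
  have h := congrArg (PowerSeries.expand 4 (by norm_num)) B_xy
  rw [tB] at h
  simp only [map_mul, map_add, map_pow, expand_ofNat, PowerSeries.expand_X] at h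
  rw [← PowerSeries.expand_mul] at h
  norm_num at h
  rw [← h, yy]; ring
lemma x_eq : xx = xx.expand 4 (by norm_num) + 2 * yy.expand 4 (by norm_num) := by
  have h := congrArg (PowerSeries.expand 4 (by norm_num)) A_xy
  rw [map_add, map_mul, expand_ofNat] at h
  exact h

lemma Su_V : Su 8 4 (yy.expand 4 (by norm_num)) := by
  rw [yy, map_mul, PowerSeries.expand_X, ← PowerSeries.expand_mul]
  exact ((Su.X 8).pow 4).mul0 (Su.expand _ _ _ _ (by norm_num))
lemma Su_U : Su 8 0 (xx.expand 4 (by norm_num)) := by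
  rw [xx, ← PowerSeries.expand_mul]; exact Su.expand _ _ _ _ (by norm_num)

lemma xy3 {n : ℕ} (hn : n % 8 = 7) : PowerSeries.coeff n (xx * yy ^ 3) = 2 * PowerSeries.coeff n (yy.expand 4 (by norm_num) * yy ^ 3) := by
  rw [x_eq, add_mul, mul_assoc, map_add, coeff_ofNat_mul, Su_U.mul (Su_y.pow 3) n (by omega), zero_add]

lemma xy7 {n : ℕ} (hn : n % 8 = 7) : ∃ t, PowerSeries.coeff n (xx * yy ^ 7) = PowerSeries.coeff n (yy.expand 4 (by norm_num) * yy ^ 3) + 4 * t := by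
  obtain ⟨r, hr⟩ := xx_r
  have h1 : xx.expand 4 (by norm_num) = 1 + 2 * r.expand 4 (by norm_num) := by
    rw [hr, map_add, map_one, map_mul, expand_ofNat]
  have h2 := Su_U
  have h3 := Su_V
  have h4 := x_eq
  have h5 := y4_eq
  have h6 := Su_y.pow 3
  set u := xx.expand 4 (by norm_num)
  set V := yy.expand 4 (by norm_num)
  set s := r.expand 4 (by norm_num)
  have e : xx * yy ^ 7 = V * yy ^ 3 + 2 * (u ^ 3 * V ^ 2 * yy ^ 3) +
      4 * ((2 * s + 6 * s ^ 2 + 8 * s ^ 3 + 4 * s ^ 4) * V * yy ^ 3 + xx * u * V ^ 3 * yy ^ 3) := by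
    have : (1 + 2 * s) ^ 4 = u ^ 4 := by rw [h1]
    calc xx * yy ^ 7 = xx * (yy ^ 4) * yy ^ 3 := by ring
      _ = xx * (u * V * (u ^ 2 + 4 * V ^ 2)) * yy ^ 3 := by rw [h5]
      _ = (u + 2 * V) * u ^ 3 * V * yy ^ 3 + 4 * (xx * u * V ^ 3 * yy ^ 3) := by rw [← h4]; ring
      _ = _ := by linear_combination -(V * yy ^ 3) * this
  refine ⟨PowerSeries.coeff n ((2 * s + 6 * s ^ 2 + 8 * s ^ 3 + 4 * s ^ 4) * V * yy ^ 3 + xx * u * V ^ 3 * yy ^ 3), ?_⟩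
  · rw [e, map_add, map_add, coeff_ofNat_mul, coeff_ofNat_mul, ((h2.pow0 3).mul (h3.pow 2)).mul h6 n (by omega), mul_zero, add_zero]

lemma x4_eq : ∃ s, xx ^ 4 = 1 + 8 * s := by
  obtain ⟨r, hr⟩ := xx_r
  exact ⟨r + 3 * r ^ 2 + 4 * r ^ 3 + 2 * r ^ 4, by rw [hr]; ring⟩

lemma odd_factor {p : ℤ} (h : p % 2 = 1) : (p ^ 10 - p ^ 9 + p ^ 8 - p ^ 7 + p ^ 6 - p ^ 5 + p ^ 4 - p ^ 3 + p ^ 2 - p + 1) % 2 = 1 := by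
  have h3 : p ≡ 1 [ZMOD 2] := h
  have := (((((((((h3.pow 10).sub (h3.pow 9)).add (h3.pow 8)).sub (h3.pow 7)).add (h3.pow 6)).sub (h3.pow 5)).add
    (h3.pow 4)).sub (h3.pow 3)).add (h3.pow 2)).sub h3 |>.add_right 1
  exact this

lemma p11_two {p : ℤ} (h : p % 2 = 1) (k : ℕ) (hd : (2:ℤ) ^ k ∣ 1 + p ^ 11) : (2:ℤ) ^ k ∣ p + 1 := by
  have e : 1 + p ^ 11 = (p + 1) * (p ^ 10 - p ^ 9 + p ^ 8 - p ^ 7 + p ^ 6 - p ^ 5 + p ^ 4 - p ^ 3 + p ^ 2 - p + 1) := by ring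
  rw [e] at hd
  refine IsCoprime.dvd_of_dvd_mul_right (IsCoprime.pow_left ?_) hd
  have h1 := odd_factor h
  generalize p ^ 10 - p ^ 9 + p ^ 8 - p ^ 7 + p ^ 6 - p ^ 5 + p ^ 4 - p ^ 3 + p ^ 2 - p + 1 = F at *
  exact ⟨-(F / 2), 1, by omega⟩

lemma crit2 {p : ℕ} (hp : p.Prime) (h2 : p ≠ 2) (h0 : ramanujanTau p = 0) : (16384 : ℤ) ∣ p + 1 := by
  have h3 := mod4 hp h2 h0
  obtain ⟨w1, hw1⟩ := pD3_mod (xx ^ 4) (yy ^ 4)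
  obtain ⟨w2, hw2⟩ := pE3_mod (xx ^ 4) (yy ^ 4)
  have e1 := De_cls3 h3
  rw [hw1, De_p h0, show ∀ E u v : PowerSeries ℤ, xx * yy ^ 3 * (705 * E - 124889088 * u ^ 5 - 1388770029568 * (u ^ 4 * v) + 16384 * w1) =
    705 * (xx * yy ^ 3 * E) - 124889088 * (xx * yy ^ 3 * u ^ 5) - 1388770029568 * (xx * yy ^ 3 * (u ^ 4 * v)) + 16384 * (xx * yy ^ 3 * w1) by intros; ring,
    map_add, map_sub, map_sub] at e1
  simp only [coeff_ofNat_mul] at e1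
  rw [← S_cls3 h3, Sg_p hp] at e1
  have e2 := S_cls3 h3
  rw [hw2, Sg_p hp, show ∀ u : PowerSeries ℤ, xx * yy ^ 3 * (177148 * u ^ 5 + 64 * w2) =
    177148 * (xx * yy ^ 3 * u ^ 5) + 64 * (xx * yy ^ 3 * w2) by intros; ring, map_add] at e2
  simp only [coeff_ofNat_mul] at e2
  obtain ⟨s, hs⟩ := x4_eq
  have e3 : xx * yy ^ 3 * (xx ^ 4) ^ 5 = xx * yy ^ 3 + 8 * (xx * yy ^ 3 * (5 * s + 80 * s ^ 2 + 640 * s ^ 3 + 2560 * s ^ 4 + 4096 * s ^ 5)) := by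
    rw [hs]; ring
  have e4 : xx * yy ^ 3 * ((xx ^ 4) ^ 4 * yy ^ 4) = xx * yy ^ 7 + 8 * (xx * yy ^ 7 * (4 * s + 48 * s ^ 2 + 256 * s ^ 3 + 512 * s ^ 4)) := by
    rw [hs]; ring
  have e3' := congrArg (PowerSeries.coeff p) e3
  have e4' := congrArg (PowerSeries.coeff p) e4
  rw [map_add, coeff_ofNat_mul] at e3' e4'
  generalize PowerSeries.coeff p (xx * yy ^ 3 * (xx ^ 4) ^ 5) = T3 at *
  generalize PowerSeries.coeff p (xx * yy ^ 3 * ((xx ^ 4) ^ 4 * yy ^ 4)) = T7 at *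
  have hodd : (p : ℤ) % 2 = 1 := by omega
  have h11 : (2:ℤ) ^ 11 ∣ 1 + (p:ℤ) ^ 11 := by norm_num; omega
  have h11' := p11_two hodd 11 h11
  norm_num at h11 h11'
  have h8 : p % 8 = 7 := by omega
  obtain ⟨t, ht⟩ := xy7 h8
  have hx := xy3 h8
  have h14 : (2:ℤ) ^ 14 ∣ 1 + (p:ℤ) ^ 11 := by
    norm_num
    have a1 : (16:ℤ) ∣ T3 := by omega
    have a2 : (4:ℤ) ∣ PowerSeries.coeff p (yy.expand 4 (by norm_num) * yy ^ 3) := by omega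
    have a3 : (4:ℤ) ∣ T7 := by omega
    omega
  have := p11_two hodd 14 h14
  norm_num at this
  exact this

end SerreTau

open Polynomial
namespace SerreTau
open Complex Filter Topology
open UpperHalfPlane hiding I

/-- squares prime to 3 -/
noncomputable def rC : PowerSeries ℤ := r0 - r0.expand 9 (by norm_num)
/-- triangular numbers divisible by 3 -/
noncomputable def hC : PowerSeries ℤ := tH - PowerSeries.X * tH.expand 9 (by norm_num)

lemma Su_rC : Su 3 1 rC := by
  classical
  intro n hn
  rw [rC, map_sub, PowerSeries.coeff_expand, r0]
  simp only [PowerSeries.coeff_mk]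
  rw [sub_eq_zero]
  by_cases hk : ∃ k : ℕ, (k + 1) ^ 2 = n
  · rw [if_pos hk]
    obtain ⟨k, rfl⟩ := hk
    have h3 : 3 ∣ k + 1 := by
      by_contra hd
      have : (k + 1) % 3 = 1 ∨ (k + 1) % 3 = 2 := by omega
      apply hn
      rcases this with h | h <;> rw [Nat.pow_mod, h]
    obtain ⟨j, hj⟩ := h3
    rw [hj, mul_pow, if_pos ⟨j ^ 2, rfl⟩, if_pos]
    refine ⟨j - 1, ?_⟩
    rw [Nat.sub_add_cancel (by omega), show 3 ^ 2 = 9 by norm_num, Nat.mul_div_cancel_left _ (by norm_num)]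
  · rw [if_neg hk]
    split_ifs with h1 h2
    · obtain ⟨j, hj⟩ := h2
      refine (hk ⟨3 * (j + 1) - 1, ?_⟩).elim
      rw [Nat.sub_add_cancel (by omega), mul_pow, hj]; omega
    · rfl
    · rfl

lemma Su_hC : Su 3 0 hC := by
  classical
  intro n hn
  rw [hC, map_sub, coeff_X_mul', PowerSeries.coeff_expand, tH]
  simp only [PowerSeries.coeff_mk]
  have hn0 : n ≠ 0 := by rintro rfl; exact hn rfl
  rw [if_neg hn0, sub_eq_zero]
  by_cases hk : ∃ k : ℕ, k * (k + 1) = 2 * n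
  · rw [if_pos hk]
    obtain ⟨k, hk⟩ := hk
    have h3 : k % 3 = 1 := by
      by_contra hd
      have h4 : k % 3 = 0 ∨ k % 3 = 2 := by omega
      have h5 : (k * (k + 1)) % 3 = 0 := by
        rcases h4 with h | h
        · rw [Nat.mul_mod, h]; simp
        · rw [Nat.mul_mod, Nat.add_mod, h]
      omega
    obtain ⟨j, hj⟩ : ∃ j, k = 3 * j + 1 := ⟨k / 3, by omega⟩
    have e : 2 * n = 9 * (j * (j + 1)) + 2 := by rw [← hk, hj]; ring
    obtain ⟨t, ht⟩ := Nat.even_mul_succ_self j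
    rw [if_pos (by omega), if_pos]
    exact ⟨j, by omega⟩
  · rw [if_neg hk]
    split_ifs with h1 h2
    · obtain ⟨j, hj⟩ := h2
      refine (hk ⟨3 * j + 1, ?_⟩).elim
      have : 2 * n = 9 * (j * (j + 1)) + 2 := by
        have : n ≠ 0 := by rintro rfl; exact hn rfl
        omega
      rw [this]; ring
    · rfl
    · rfl

/-- cubic theta series -/
noncomputable def ta : PowerSeries ℤ := tA * tA.expand 3 (by norm_num) +
  4 * (PowerSeries.X * (tH.expand 2 (by norm_num) * tH.expand 6 (by norm_num)))
noncomputable def ty : PowerSeries ℤ := rC * tA.expand 3 (by norm_num) +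
  2 * (PowerSeries.X * (hC.expand 2 (by norm_num) * tH.expand 6 (by norm_num)))
noncomputable def tx : PowerSeries ℤ := ta.expand 3 (by norm_num)

lemma ta_eq : ta = tx + 2 * ty := by
  rw [tx, ta, ty, rC, hC]
  simp only [map_add, map_sub, map_mul, expand_ofNat, PowerSeries.expand_X, ← PowerSeries.expand_mul]
  norm_num
  have h9 : tA.expand 9 (by norm_num) = 1 + 2 * r0.expand 9 (by norm_num) := by
    rw [tA, map_add, map_one, map_mul, expand_ofNat]
  rw [h9]
  have : tA = 1 + 2 * r0 := rfl
  linear_combination tA.expand 3 (by norm_num) * this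

lemma Su_expand {m r : ℕ} {F : PowerSeries ℤ} (hF : Su m r F) (k : ℕ) (hk : k ≠ 0) : Su m (k * r) (F.expand k hk) := by
  intro n hn
  rw [PowerSeries.coeff_expand]
  split_ifs with h
  · obtain ⟨j, rfl⟩ := h
    rw [Nat.mul_div_cancel_left _ (Nat.pos_of_ne_zero hk)]
    apply hF
    intro h2
    exact hn (by rw [Nat.mul_mod, h2, ← Nat.mul_mod])
  · rfl

lemma Su_ty : Su 3 1 ty := by
  rw [ty]
  refine Su.add (Su_rC.mul0 (Su.expand _ _ _ _ (by norm_num))) (Su.cmul 2 ((Su.X 3).mul0 (Su.mul0 ?_ (Su.expand _ _ _ _ (by norm_num)))))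
  exact Su_expand Su_hC 2 (by norm_num)
lemma Su_tx : Su 3 0 tx := Su.expand _ _ _ _ (by norm_num)

/-- cube of c -/
noncomputable def tt : PowerSeries ℤ := PowerSeries.mk fun n => PowerSeries.coeff (3 * n) (ty ^ 3)

lemma tt_expand : tt.expand 3 (by norm_num) = ty ^ 3 := by
  ext n
  rw [PowerSeries.coeff_expand]
  split_ifs with h
  · obtain ⟨j, rfl⟩ := h
    rw [Nat.mul_div_cancel_left _ (by norm_num), tt, PowerSeries.coeff_mk]
  · exact ((Su_ty.pow 3) n (by omega)).symm

lemma QC_r : QC (cz rC) := by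
  rw [rC, map_sub, cz_expand]; exact QC_r0.sub (QC_r0.expand _ _)
lemma QC_hC : QC (cz hC) := by
  rw [hC, map_sub, map_mul, cz_expand, cz_X]; exact QC_H.sub (QC.X.mul (QC_H.expand _ _))
lemma QC_ty : QC (cz ty) := by
  rw [ty]; simp only [map_add, map_mul, map_ofNat, cz_X, cz_expand]
  exact (QC_r.mul (QC_A.expand _ _)).add ((QC.ofNat 2).mul (QC.X.mul ((QC_hC.expand _ _).mul (QC_H.expand _ _))))
lemma QC_tt : QC (cz tt) := by
  intro r h0 h1
  have hs : (r ^ ((1:ℝ) / 3)) ^ 3 = r := by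
    rw [← Real.rpow_natCast, ← Real.rpow_mul h0]; norm_num
  have hs0 : 0 ≤ r ^ ((1:ℝ) / 3) := Real.rpow_nonneg h0 _
  have h2 := (QC_ty.pow 3) _ hs0 (Real.rpow_lt_one h0 h1 (by norm_num))
  have h3 := h2.comp_injective (i := fun n : ℕ => 3 * n) (fun a b hab => by simpa using hab)
  refine h3.congr (fun n => ?_)
  simp only [Function.comp]
  rw [pow_mul, hs, coeff_cz, tt, PowerSeries.coeff_mk, ← map_pow, coeff_cz]

/-- analytic a -/
noncomputable def aa (z : ℂ) : ℂ := al z * al (3 * z) + be z * be (3 * z)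
noncomputable def cc (z : ℂ) : ℂ := (aa (z / 3) - aa z) / 2

lemma EV_a {z : ℂ} (hz : 0 < z.im) : EV z (cz ta) (aa z) := by
  have h := ((EV_A z).mul hz ((EV_A (((3:ℕ):ℂ) * z)).expand 3 (by norm_num))).add hz
    (((EV.X z).mul hz (((EV_H (((2:ℕ):ℂ) * z)).expand 2 (by norm_num)).mul hz ((EV_H (((6:ℕ):ℂ) * z)).expand 6 (by norm_num)))).cmul hz 4)
  rw [ta]; simp only [map_add, map_mul, map_ofNat, cz_X, cz_expand]
  convert h using 1
  have h1 : qq z = qq (z / 4) * qq (3 * z / 4) := by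
    rw [qq, qq, qq, ← Complex.exp_add]; congr 1; ring
  rw [aa, be, be, h1]
  push_cast
  rw [show 2 * (3 * z) = 6 * z by ring]
  ring

lemma EV_y {z : ℂ} (hz : 0 < z.im) : EV z (cz ty) (cc (3 * z)) := by
  refine ⟨QC_ty, ?_⟩
  have h := congrArg (fun F => ev (cz F) z) ta_eq
  have h3 : 0 < (((3:ℕ):ℂ) * z).im := by simp [hz]
  simp only [map_add, map_mul, map_ofNat, tx, cz_expand] at h
  rw [(EV_a hz).2, (((EV_a h3).expand 3 (by norm_num)).add hz (EV.cmul hz 2 (⟨QC_ty, rfl⟩ : EV z (cz ty) (ev (cz ty) z)))).2] at h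
  rw [cc, show 3 * z / 3 = z by ring, h]
  push_cast; ring

lemma EV_t {z : ℂ} (hz : 0 < z.im) : EV z (cz tt) (cc z ^ 3) := by
  refine ⟨QC_tt, ?_⟩
  have hz3 : 0 < (z / 3).im := by simp [hz]
  have h := congrArg (fun F => ev (cz F) (z / 3)) tt_expand
  simp only [cz_expand, map_pow] at h
  rw [ev_expand, ((EV_y hz3).pow hz3 3).2] at h
  push_cast at h
  rw [show 3 * (z / 3) = z by ring] at h
  exact h

lemma aa_S {z : ℂ} (hz : 0 < z.im) : aa (-1 / z) = (-I / (Real.sqrt 3 : ℝ)) * z * aa (z / 3) := by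
  have hz0 : z ≠ 0 := by rintro rfl; simp at hz
  have hz3 : 0 < (z / 3).im := by simp [hz]
  have hs := sr_sq (z / 3)
  have h3 : sr z = (Real.sqrt 3 : ℝ) * sr (z / 3) := by
    rw [← sr_scale (Real.sqrt_nonneg 3), Real.sq_sqrt (by norm_num)]; congr 1; push_cast; ring
  have hq : ((Real.sqrt 3 : ℝ) : ℂ) ^ 2 = 3 := by
    rw [← Complex.ofReal_pow, Real.sq_sqrt (by norm_num)]; norm_num
  have hq0 : ((Real.sqrt 3 : ℝ) : ℂ) ≠ 0 := by
    intro h; rw [h] at hq; norm_num at hq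
  have e : 3 * (-1 / z) = -1 / (z / 3) := by field_simp
  rw [aa, aa, e, al_S hz, be_S hz, al_S hz3, be_S hz3, h3, show 3 * (z / 3) = z by ring]
  have hk : -I / (Real.sqrt 3 : ℝ) * z = 2 * ((Real.sqrt 3 : ℝ) * sr (z / 3) ^ 2) := by
    rw [hs]; field_simp; linear_combination (1:ℂ) * hq
  rw [hk]; ring

lemma aa_S' {z : ℂ} (hz : 0 < z.im) : aa (-1 / z) = (-I / (Real.sqrt 3 : ℝ)) * z * (aa z + 2 * cc z) := by
  rw [aa_S hz, cc]; ring
lemma cc_S {z : ℂ} (hz : 0 < z.im) : cc (-1 / z) = (-I / (Real.sqrt 3 : ℝ)) * z * (aa z - cc z) := by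
  have h3 : 0 < (3 * z).im := by simp [hz]
  rw [cc, show -1 / z / 3 = -1 / (3 * z) by rw [div_div]; ring, aa_S h3, aa_S hz, show 3 * z / 3 = z by ring, cc]
  ring

lemma k2 : (-I / (Real.sqrt 3 : ℝ)) ^ 2 = (-1 / 3 : ℂ) := by
  rw [div_pow, neg_pow, I_sq, ← Complex.ofReal_pow, Real.sq_sqrt (by norm_num)]; norm_num

lemma cc_ta : PowerSeries.constantCoeff ta = 1 := by
  simp [ta, cc_A]
lemma cc_ty : PowerSeries.constantCoeff ty = 0 := by
  rw [← PowerSeries.coeff_zero_eq_constantCoeff_apply]; exact Su_ty 0 (by norm_num)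
lemma cc_tt : PowerSeries.constantCoeff tt = 0 := by
  rw [← PowerSeries.coeff_zero_eq_constantCoeff_apply, tt, PowerSeries.coeff_mk, mul_zero,
    PowerSeries.coeff_zero_eq_constantCoeff_apply, map_pow, cc_ty]; norm_num

lemma Q_cub : eQ = ta ^ 4 + 8 * (ta * tt) := by
  rw [← sub_eq_zero]
  refine zsturm (k := 4) ?_ (by norm_num) ?_ (Or.inl (by norm_num))
  · simp only [map_sub, map_add, map_mul, map_ofNat, map_pow]
    refine Md_Q.sub (Md_of_EV _ (fun z hz => ((EV_a hz).pow hz 4).add hz (((EV_a hz).mul hz (EV_t hz)).cmul hz 8)) fun z hz => ?_)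
    simp only [aa_S' hz, cc_S hz]
    have k4 : (-I / (Real.sqrt 3 : ℝ)) ^ 4 = (1 / 9 : ℂ) := by
      rw [show (-I / (Real.sqrt 3 : ℝ)) ^ 4 = ((-I / (Real.sqrt 3 : ℝ)) ^ 2) ^ 2 by ring, k2]; norm_num
    generalize (-I / (Real.sqrt 3 : ℝ)) = k at *
    linear_combination (z ^ 4 * 9 * (aa z ^ 4 + 8 * (aa z * cc z ^ 3))) * k4
  · simp only [eQ, map_sub, map_add, map_mul, map_pow, cc_ta, cc_tt, c0_Sg, cc_ofNat, map_one]; norm_num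

lemma R_cub : eR = ta ^ 6 - 20 * (ta ^ 3 * tt) - 8 * tt ^ 2 := by
  rw [← sub_eq_zero]
  refine zsturm (k := 6) ?_ (by norm_num) ?_ (Or.inl (by norm_num))
  · simp only [map_sub, map_add, map_mul, map_ofNat, map_pow]
    refine Md_R.sub (Md_of_EV _ (fun z hz => (((EV_a hz).pow hz 6).sub hz ((((EV_a hz).pow hz 3).mul hz (EV_t hz)).cmul hz 20)).sub hz
      (((EV_t hz).pow hz 2).cmul hz 8)) fun z hz => ?_)
    simp only [aa_S' hz, cc_S hz]
    have k6 : (-I / (Real.sqrt 3 : ℝ)) ^ 6 = (-1 / 27 : ℂ) := by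
      rw [show (-I / (Real.sqrt 3 : ℝ)) ^ 6 = ((-I / (Real.sqrt 3 : ℝ)) ^ 2) ^ 3 by ring, k2]; norm_num
    generalize (-I / (Real.sqrt 3 : ℝ)) = k at *
    linear_combination (z ^ 6 * (-27) * (aa z ^ 6 - 20 * (aa z ^ 3 * cc z ^ 3) - 8 * (cc z ^ 3) ^ 2)) * k6
  · simp only [eR, map_sub, map_add, map_mul, map_pow, cc_ta, cc_tt, c0_Sg, cc_ofNat, map_one]; norm_num

end SerreTau

open Polynomial
namespace SerreTau

lemma th_expand (F : PowerSeries ℤ) : th ℤ (F.expand 3 (by norm_num)) = 3 * (th ℤ F).expand 3 (by norm_num) := by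
  ext n
  rw [coeff_ofNat_mul, coeff_th, PowerSeries.coeff_expand, PowerSeries.coeff_expand]
  split_ifs with h
  · obtain ⟨j, rfl⟩ := h
    rw [Nat.mul_div_cancel_left _ (by norm_num), coeff_th]; push_cast; ring
  · simp

lemma th_pow (F : PowerSeries ℤ) (n : ℕ) : th ℤ (F ^ n) = n * F ^ (n - 1) * th ℤ F := by
  rw [Derivation.leibniz_pow, smul_eq_mul, nsmul_eq_mul]; ring

lemma ne_of_cc {F : PowerSeries ℤ} (h : PowerSeries.constantCoeff F ≠ 0) : F ≠ 0 := by
  rintro rfl; exact h (map_zero _)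

lemma th_ta_tt : 12 * th ℤ ta = eP * ta - ta ^ 3 + 4 * tt ∧ 4 * th ℤ tt = tt * (eP + 3 * ta ^ 2) := by
  have h1 := thQ
  have h2 := thR
  rw [Q_cub, R_cub] at h1
  rw [R_cub, Q_cub] at h2
  simp only [map_add, map_sub, th_ofNat_mul, th_mul, th_pow] at h1 h2
  norm_num at h1 h2
  have hd : (ta ^ 3 - tt) ^ 2 ≠ 0 := ne_of_cc (by simp [cc_ta, cc_tt])
  constructor
  · rw [← sub_eq_zero]
    refine (mul_eq_zero.mp (?_ : (128 * (ta ^ 3 - tt) ^ 2) * _ = 0)).resolve_left (mul_ne_zero (by norm_num) hd)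
    linear_combination (-4 * (-20 * ta ^ 3 - 16 * tt)) * h1 + (6 * (8 * ta)) * h2
  · rw [← sub_eq_zero]
    refine (mul_eq_zero.mp (?_ : (384 * (ta ^ 3 - tt) ^ 2) * _ = 0)).resolve_left (mul_ne_zero (by norm_num) hd)
    linear_combination (4 * (6 * ta ^ 5 - 60 * ta ^ 2 * tt)) * h1 - (6 * (4 * ta ^ 3 + 8 * tt)) * h2

/-- P at q^3 -/
noncomputable def P3 : PowerSeries ℤ := eP.expand 3 (by norm_num)

lemma ty_ne : ty ≠ 0 := by
  classical
  intro h
  have h1 := congrArg (PowerSeries.coeff 1) h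
  have e1 : PowerSeries.coeff 1 rC = 1 := by
    rw [rC, map_sub, PowerSeries.coeff_expand, if_neg (by norm_num), r0, PowerSeries.coeff_mk, if_pos ⟨0, by norm_num⟩]; norm_num
  have e2 : PowerSeries.constantCoeff rC = 0 := by
    rw [← PowerSeries.coeff_zero_eq_constantCoeff_apply]; exact Su_rC 0 (by norm_num)
  have e3 : PowerSeries.constantCoeff hC = 1 := by simp [hC, cc_H]
  rw [ty, map_add, coeff_ofNat_mul, coeff1_mul, coeff_X_mul', e1, e2] at h1
  simp [cc_A, e3, cc_H] at h1

lemma th_tx : 12 * th ℤ tx = 3 * (P3 * tx - tx ^ 3 + 4 * ty ^ 3) := by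
  have h := congrArg (PowerSeries.expand 3 (by norm_num)) th_ta_tt.1
  simp only [map_add, map_sub, map_mul, map_pow, expand_ofNat] at h
  rw [tt_expand] at h
  rw [tx, th_expand, P3]
  linear_combination 3 * h

lemma th_ty : 4 * th ℤ ty = ty * (P3 + 3 * tx ^ 2) := by
  have h := congrArg (PowerSeries.expand 3 (by norm_num)) th_ta_tt.2
  simp only [map_add, map_sub, map_mul, map_pow, expand_ofNat] at h
  have h2 := th_expand tt
  rw [tt_expand, th_pow] at h2
  rw [tt_expand] at h
  have h3 : (3 * ty ^ 2) * (4 * th ℤ ty) = (3 * ty ^ 2) * (ty * (P3 + 3 * tx ^ 2)) := by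
    rw [tx, P3]
    norm_num at h2
    linear_combination 3 * h + 4 * h2
  exact mul_left_cancel₀ (mul_ne_zero (by norm_num) (pow_ne_zero 2 ty_ne)) h3

lemma t4 : 4 * tt = (3 * P3 - eP) * ta + ta ^ 3 - 3 * tx ^ 3 + 18 * tx ^ 2 * ty + 12 * ty ^ 3 := by
  have h1 := th_ta_tt.1
  have h2 : th ℤ ta = th ℤ tx + 2 * th ℤ ty := by
    rw [ta_eq, map_add, th_ofNat_mul]
  have h3 := th_tx
  have h4 := th_ty
  have h5 := ta_eq
  linear_combination -h1 + 12 * h2 + h3 + 6 * h4 - (3 * P3) * h5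

lemma th_P3 : 12 * th ℤ P3 = 3 * (P3 ^ 2 - (tx ^ 4 + 8 * (tx * ty ^ 3))) := by
  have h := congrArg (PowerSeries.expand 3 (by norm_num)) thP
  rw [Q_cub] at h
  simp only [map_add, map_sub, map_mul, map_pow, expand_ofNat] at h
  rw [tt_expand] at h
  rw [P3, th_expand, tx]
  linear_combination 3 * h

lemma cc_P : PowerSeries.constantCoeff eP = 1 := by
  simp only [eP, map_sub, map_mul, map_one, c0_Sg, mul_zero, sub_zero]

lemma key_poly {R : Type*} [CommRing R] (a x y t P P3 dx dy dt dP dP3 : R) (ha : a = x + 2 * y)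
    (h1 : 4 * dt = t * (P + 3 * a ^ 2)) (hx : 12 * dx = 3 * (P3 * x - x ^ 3 + 4 * y ^ 3))
    (hy : 4 * dy = y * (P3 + 3 * x ^ 2)) (h4 : 4 * t = (3 * P3 - P) * a + a ^ 3 - 3 * x ^ 3 + 18 * x ^ 2 * y + 12 * y ^ 3)
    (hP3 : 12 * dP3 = 3 * (P3 ^ 2 - (x ^ 4 + 8 * (x * y ^ 3)))) (hP : 12 * dP = P ^ 2 - (a ^ 4 + 8 * (a * t)))
    (ht : 4 * dt = (3 * dP3 - dP) * a + (3 * P3 - P) * (dx + 2 * dy) + 3 * a ^ 2 * (dx + 2 * dy)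
     - 9 * x ^ 2 * dx + 36 * x * y * dx + 18 * x ^ 2 * dy + 36 * y ^ 2 * dy) :
    (3 * P3 - P - 2 * a ^ 2) * (2 * a * (3 * P3 - P) + 4 * a ^ 3 - 16 * (x - y) ^ 3) = 0 := by
  subst ha
  linear_combination -12 * ht - 3 * (x + 2 * y) * hP3 + (x + 2 * y) * hP
    - (3 * P3 - P + 3 * (x + 2 * y) ^ 2 - 9 * x ^ 2 + 36 * x * y) * hx
    - 3 * (2 * (3 * P3 - P) + 6 * (x + 2 * y) ^ 2 + 18 * x ^ 2 + 36 * y ^ 2) * hy + 12 * h1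
    + (3 * (P + 3 * (x + 2 * y) ^ 2) - 2 * (x + 2 * y) ^ 2) * h4

lemma g_eq : 3 * P3 - eP = 2 * ta ^ 2 := by
  have h1 := th_ta_tt.2
  have hx := th_tx
  have hy := th_ty
  have h4 := t4
  have hP3 := th_P3
  have hP := thP
  rw [Q_cub] at hP
  have ht : 4 * th ℤ tt = (3 * th ℤ P3 - th ℤ eP) * ta + (3 * P3 - eP) * (th ℤ tx + 2 * th ℤ ty) + 3 * ta ^ 2 * (th ℤ tx + 2 * th ℤ ty)
     - 9 * tx ^ 2 * th ℤ tx + 36 * tx * ty * th ℤ tx + 18 * tx ^ 2 * th ℤ ty + 36 * ty ^ 2 * th ℤ ty := by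
    have h2 : th ℤ ta = th ℤ tx + 2 * th ℤ ty := by
      rw [ta_eq, map_add, th_ofNat_mul]
    have h := congrArg (th ℤ) h4
    simp only [map_add, map_sub, th_ofNat_mul, th_mul, th_pow, mul_assoc] at h
    rw [h2] at h
    norm_num at h
    linear_combination h
  have ha := ta_eq
  have key : (3 * P3 - eP - 2 * ta ^ 2) * (2 * ta * (3 * P3 - eP) + 4 * ta ^ 3 - 16 * (tx - ty) ^ 3) = 0 := by
    exact key_poly _ _ _ _ _ _ _ _ _ _ _ ha h1 hx hy h4 hP3 hP ht
  rcases mul_eq_zero.mp key with h | h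
  · linear_combination h
  · refine absurd h (ne_of_cc ?_)
    have : PowerSeries.constantCoeff tx = 1 := by rw [tx, PowerSeries.constantCoeff_expand, cc_ta]
    have h3 : PowerSeries.constantCoeff P3 = 1 := by rw [P3, PowerSeries.constantCoeff_expand, cc_P]
    simp only [map_add, map_sub, map_mul, map_pow, cc_ta, cc_ty, cc_P, this, h3, cc_ofNat]
    norm_num

lemma tt_eq : tt = 9 * (ty * (tx ^ 2 + tx * ty + ty ^ 2)) := by
  have h := t4
  rw [g_eq, ta_eq] at h
  refine mul_left_cancel₀ (show (4 : PowerSeries ℤ) ≠ 0 by norm_num) ?_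
  linear_combination h

end SerreTau

open Polynomial
namespace SerreTau

lemma dvd_of_map {F : PowerSeries ℤ} (h : PowerSeries.map (Int.castRingHom (ZMod 3)) F = 0) : ∃ G : PowerSeries ℤ, F = 3 * G := by
  refine ⟨PowerSeries.mk fun n => PowerSeries.coeff n F / 3, ?_⟩
  ext n
  rw [coeff_ofNat_mul, PowerSeries.coeff_mk]
  have h1 := congrArg (PowerSeries.coeff n) h
  rw [PowerSeries.coeff_map, map_zero, eq_intCast, ZMod.intCast_zmod_eq_zero_iff_dvd] at h1
  have h2 : (3:ℤ) ∣ PowerSeries.coeff n F := by exact_mod_cast h1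
  omega

/-- S1 at q^3 -/
noncomputable def S13 : PowerSeries ℤ := (Sg 1).expand 3 (by norm_num)

lemma P3_eq : P3 = 1 - 24 * S13 := by
  rw [P3, eP, map_sub, map_one, map_mul, expand_ofNat, S13]

lemma ta_sq : ta ^ 2 = 1 + 12 * (Sg 1 - 3 * S13) := by
  have h := g_eq
  rw [P3_eq, eP] at h
  refine mul_left_cancel₀ (show (2 : PowerSeries ℤ) ≠ 0 by norm_num) ?_
  linear_combination -h

lemma ta_L : ∃ L : PowerSeries ℤ, ta = 1 + 6 * L := by
  obtain ⟨b, hb⟩ : ∃ b : PowerSeries ℤ, ta = 1 + 2 * b := by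
    refine ⟨r0 + r0.expand 3 (by norm_num) + 2 * (r0 * r0.expand 3 (by norm_num)) +
      2 * (PowerSeries.X * (tH.expand 2 (by norm_num) * tH.expand 6 (by norm_num))), ?_⟩
    rw [ta, tA, map_add, map_one, map_mul, expand_ofNat]
    ring
  have hq : b * (b + 1) = 3 * (Sg 1 - 3 * S13) := by
    have h := ta_sq
    rw [hb] at h
    refine mul_left_cancel₀ (show (4 : PowerSeries ℤ) ≠ 0 by norm_num) ?_
    linear_combination h
  have hc : PowerSeries.constantCoeff b = 0 := by
    have h := cc_ta
    rw [hb, map_add, map_one, map_mul, cc_ofNat] at h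
    omega
  have h1 := congrArg (PowerSeries.map (Int.castRingHom (ZMod 3))) hq
  have h3 : (3 : PowerSeries (ZMod 3)) = 0 := by
    rw [← map_ofNat (PowerSeries.C (R := ZMod 3)) 3, show (OfNat.ofNat 3 : ZMod 3) = 0 from rfl, map_zero]
  rw [map_mul, map_mul, map_ofNat, h3, zero_mul] at h1
  rcases mul_eq_zero.mp h1 with h | h
  · obtain ⟨L, rfl⟩ := dvd_of_map h
    exact ⟨L, by rw [hb]; ring⟩
  · exfalso
    have h2 := congrArg (PowerSeries.coeff 0) h
    rw [PowerSeries.coeff_map] at h2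
    simp [hc] at h2

lemma prod_De {R : Type*} [CommRing R] (x y Q S a t : R) (ha : a = x + 6 * y) (ht : t = 27 * (y * (x ^ 2 + 3 * x * y + 9 * y ^ 2)))
    (hQ : Q = a ^ 4 + 8 * (a * t)) (hS : S = a ^ 6 - 20 * (a ^ 3 * t) - 8 * t ^ 2) :
    Q ^ 3 - S ^ 2 = 1728 * (y * (x ^ 2 + 3 * x * y + 9 * y ^ 2) * (x - 3 * y) ^ 9) := by
  have h : Q ^ 3 - S ^ 2 = 64 * t * (a ^ 3 - t) ^ 3 := by rw [hQ, hS]; ring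
  have h2 : a ^ 3 - t = (x - 3 * y) ^ 3 := by rw [ha, ht]; ring
  rw [h, h2, ht]; ring

def qD0 {R : Type*} [CommRing R] (u v : R) : R :=
  252*(u^3*v^1) - 20412*(u^2*v^2) + 373977*(u^1*v^3) - 177147*(v^4)
def qD1 {R : Type*} [CommRing R] (u v : R) : R :=
  1*(u^3) - 1539*(u^2*v^1) + 61236*(u^1*v^2) - 551124*(v^3)
def qD2 {R : Type*} [CommRing R] (u v : R) : R :=
  -24*(u^3) + 6318*(u^2*v^1) - 170586*(u^1*v^2) + 472392*(v^3)
def qE0 {R : Type*} [CommRing R] (u v : R) : R :=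
  691*(u^4) + 11606687208*(u^3*v^1) + 23120621218368*(u^2*v^2) + 1068005498126976*(u^1*v^3) + 1504233121680000*(v^4)
def qE1 {R : Type*} [CommRing R] (u v : R) : R :=
  1*(u^3) + 4196286*(u^2*v^1) + 1759117824*(u^1*v^2) + 29867141664*(v^3)
def qE2 {R : Type*} [CommRing R] (u v : R) : R :=
  2049*(u^3) + 48701088*(u^2*v^1) + 6301604304*(u^1*v^2) + 35580565440*(v^3)

lemma poly_D3 {R : Type*} [CommRing R] (x y : R) :
    y * (x ^ 2 + 3 * x * y + 9 * y ^ 2) * (x - 3 * y) ^ 9 = qD0 (x ^ 3) (y ^ 3) + x ^ 2 * y * qD1 (x ^ 3) (y ^ 3) +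
      x * y ^ 2 * qD2 (x ^ 3) (y ^ 3) := by
  simp only [qD0, qD1, qD2]; ring

lemma poly_E3 {R : Type*} [CommRing R] (x y Q S a t : R) (ha : a = x + 6 * y) (ht : t = 27 * (y * (x ^ 2 + 3 * x * y + 9 * y ^ 2)))
    (hQ : Q = a ^ 4 + 8 * (a * t)) (hS : S = a ^ 6 - 20 * (a ^ 3 * t) - 8 * t ^ 2) :
    441 * Q ^ 3 + 250 * S ^ 2 = qE0 (x ^ 3) (y ^ 3) + 65520 * (x ^ 2 * y * qE1 (x ^ 3) (y ^ 3) +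
      x * y ^ 2 * qE2 (x ^ 3) (y ^ 3)) := by
  rw [hQ, hS, ht, ha]; simp only [qE0, qE1, qE2]; ring

lemma Su_q' {u v : PowerSeries ℤ} (hu : Su 3 0 u) (hv : Su 3 0 v) : Su 3 0 (qD0 u v) ∧ Su 3 0 (qD1 u v) ∧ Su 3 0 (qD2 u v) ∧
    Su 3 0 (qE0 u v) ∧ Su 3 0 (qE1 u v) ∧ Su 3 0 (qE2 u v) := by
  refine ⟨?_, ?_, ?_, ?_, ?_, ?_⟩ <;>
  simp only [qD0, qD1, qD2, qE0, qE1, qE2] <;>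
  repeat' with_reducible first
    | exact hu
    | exact hv
    | apply Su.add
    | apply Su.sub
    | apply Su.neg
    | apply Su.mul0
    | apply Su.pow0
    | exact Su.one _
    | exact Su.ofNat _ _

lemma qDE {R : Type*} [CommRing R] (u v : R) : ∃ w, 683 * qD2 u v + 8 * qE2 u v = 393923898 * (u ^ 2 * v) + 2187 * w :=
  ⟨22997862*(u^1*v^2) + 130300488*(v^3), by simp only [qD2, qE2]; ring⟩

end SerreTau

open Polynomial
namespace SerreTau

lemma three_factor {p : ℤ} (h : p % 3 = 2) : (p ^ 10 - p ^ 9 + p ^ 8 - p ^ 7 + p ^ 6 - p ^ 5 + p ^ 4 - p ^ 3 + p ^ 2 - p + 1) % 3 = 2 := by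
  have h3 : p ≡ -1 [ZMOD 3] := by
    show p % 3 = -1 % 3
    omega
  have := (((((((((h3.pow 10).sub (h3.pow 9)).add (h3.pow 8)).sub (h3.pow 7)).add (h3.pow 6)).sub (h3.pow 5)).add
    (h3.pow 4)).sub (h3.pow 3)).add (h3.pow 2)).sub h3 |>.add_right 1
  exact this

lemma p11_three {p : ℤ} (h : p % 3 = 2) (k : ℕ) (hd : (3:ℤ) ^ k ∣ 1 + p ^ 11) : (3:ℤ) ^ k ∣ p + 1 := by
  have e : 1 + p ^ 11 = (p + 1) * (p ^ 10 - p ^ 9 + p ^ 8 - p ^ 7 + p ^ 6 - p ^ 5 + p ^ 4 - p ^ 3 + p ^ 2 - p + 1) := by ring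
  rw [e] at hd
  refine IsCoprime.dvd_of_dvd_mul_right (IsCoprime.pow_left ?_) hd
  have h1 := three_factor h
  generalize p ^ 10 - p ^ 9 + p ^ 8 - p ^ 7 + p ^ 6 - p ^ 5 + p ^ 4 - p ^ 3 + p ^ 2 - p + 1 = F at *
  exact ⟨F / 3 + 1, -1, by omega⟩

/-- all structural facts at level 3 -/
lemma level3 : ∃ L w Y w3 S19 T : PowerSeries ℤ, L = w + Y ∧ tx = 1 + 6 * w ∧ Su 3 0 w ∧ Su 3 1 Y ∧
    ta = tx + 6 * Y ∧ tt = 27 * (Y * (tx ^ 2 + 3 * tx * Y + 9 * Y ^ 2)) ∧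
    Sg 1 = L + 3 * L ^ 2 + 3 * S13 ∧ S13 = w + 3 * w ^ 2 + 3 * S19 ∧ S19 = w3 + 3 * T ∧
    (∃ G, Y ^ 3 = (w - w3) + 3 * G) ∧ 4 * th ℤ Y = Y * (P3 + 3 * tx ^ 2) := by
  obtain ⟨L, hL⟩ := ta_L
  have hx : tx = 1 + 6 * L.expand 3 (by norm_num) := by
    rw [tx, hL, map_add, map_one, map_mul, expand_ofNat]
  have hS : Sg 1 = L + 3 * L ^ 2 + 3 * S13 := by
    have h := ta_sq
    rw [hL] at h
    refine mul_left_cancel₀ (show (12 : PowerSeries ℤ) ≠ 0 by norm_num) ?_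
    linear_combination -h
  have hy : ty = 3 * (L - L.expand 3 (by norm_num)) := by
    have h := ta_eq
    rw [hx, hL] at h
    refine mul_left_cancel₀ (show (2 : PowerSeries ℤ) ≠ 0 by norm_num) ?_
    linear_combination -h
  have hS13 : S13 = L.expand 3 (by norm_num) + 3 * (L.expand 3 (by norm_num)) ^ 2 + 3 * S13.expand 3 (by norm_num) := by
    have h := congrArg (PowerSeries.expand 3 (by norm_num)) hS
    rw [map_add, map_add, map_mul, map_pow, map_mul, expand_ofNat] at h
    exact h
  have hS19 := congrArg (PowerSeries.expand 3 (by norm_num)) hS13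
  rw [map_add, map_add, map_mul, map_pow, map_mul, expand_ofNat] at hS19
  have ht := tt_eq
  rw [hy] at ht
  have hty := th_ty
  rw [hy, th_ofNat_mul] at hty
  have hsy : Su 3 1 (L - L.expand 3 (by norm_num)) := by
    intro n hn
    have h := Su_ty n hn
    rw [hy, coeff_ofNat_mul] at h
    omega
  have h27 : (L - L.expand 3 (by norm_num)) ^ 3 = (L - L.expand 3 (by norm_num)).expand 3 (by norm_num) *
      (tx.expand 3 (by norm_num) ^ 2 + 3 * tx.expand 3 (by norm_num) * (L - L.expand 3 (by norm_num)).expand 3 (by norm_num)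
        + 9 * (L - L.expand 3 (by norm_num)).expand 3 (by norm_num) ^ 2) := by
    have h := congrArg (PowerSeries.expand 3 (by norm_num)) ht
    rw [tt_expand, hy] at h
    refine mul_left_cancel₀ (show (27 : PowerSeries ℤ) ≠ 0 by norm_num) ?_
    generalize L - L.expand 3 (by norm_num) = Y at h ⊢
    simp only [map_add, map_mul, map_pow, expand_ofNat] at h
    linear_combination h
  refine ⟨L, L.expand 3 (by norm_num), L - L.expand 3 (by norm_num), (L.expand 3 (by norm_num)).expand 3 (by norm_num),
    S13.expand 3 (by norm_num), ((L.expand 3 (by norm_num)).expand 3 (by norm_num)) ^ 2 + (S13.expand 3 (by norm_num)).expand 3 (by norm_num),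
    by ring, hx, Su.expand _ _ _ _ (by norm_num), hsy, ?_, ?_, hS, hS13, ?_, ?_, ?_⟩
  · rw [hx, hL]; ring
  · rw [ht]; ring
  · linear_combination hS19
  · have hx3 : tx.expand 3 (by norm_num) = 1 + 6 * (L.expand 3 (by norm_num)).expand 3 (by norm_num) := by
      rw [hx, map_add, map_one, map_mul, expand_ofNat]
    rw [hx3, map_sub] at h27
    generalize L.expand 3 (by norm_num) = w at h27 ⊢
    generalize w.expand 3 (by norm_num) = w3 at h27 ⊢
    refine ⟨(w - w3) * (4 * w3 + 12 * w3 ^ 2 + (1 + 6 * w3) * (w - w3) + 3 * (w - w3) ^ 2), ?_⟩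
    rw [h27]; ring
  · refine mul_left_cancel₀ (show (3 : PowerSeries ℤ) ≠ 0 by norm_num) ?_
    linear_combination hty

lemma crit3 {p : ℕ} (hp : p.Prime) (hp3 : p ≠ 3) (h0 : ramanujanTau p = 0) : (2187 : ℤ) ∣ p + 1 := by
  have hnd : p % 3 ≠ 0 := by
    intro h
    exact hp3 ((Nat.prime_dvd_prime_iff_eq Nat.prime_three hp).mp (Nat.dvd_of_mod_eq_zero h)).symm
  obtain ⟨L, w, Y, w3, S19, T, hL, hx, hw, hY, ha, ht, hS, hS13, hS19, ⟨G, hG⟩, hth⟩ := level3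
  have hxs := Su_tx
  have hS13s : Su 3 0 S13 := Su.expand _ _ _ _ (by norm_num)
  have hDe : De = Y * (tx ^ 2 + 3 * tx * Y + 9 * Y ^ 2) * (tx - 3 * Y) ^ 9 := by
    have h := prod_De tx Y eQ eR ta tt ha ht Q_cub R_cub
    rw [← De_eq] at h
    exact mul_left_cancel₀ (by norm_num) h
  have hS1p := congrArg (PowerSeries.coeff p) hS
  rw [Sg_p hp, map_add, map_add, coeff_ofNat_mul, coeff_ofNat_mul, hS13s p (by omega), hL, map_add, hw p (by omega), pow_one] at hS1p
  -- mod 3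
  have hmod : p % 3 = 2 := by
    by_contra hne
    obtain ⟨W, hW⟩ : ∃ W, De = Y + 3 * W := by
      have h1 : ∃ W, De = Y * tx ^ 11 + 3 * W := by
        rw [hDe, poly_D3]; simp only [qD0, qD1, qD2]
        refine ⟨(-8) * (tx ^ 10 * Y ^ 2) + (84) * (tx ^ 9 * Y ^ 3) + (-513) * (tx ^ 8 * Y ^ 4) + (2106) * (tx ^ 7 * Y ^ 5) + (-6804) * (tx ^ 6 * Y ^ 6) + (20412) * (tx ^ 5 * Y ^ 7) + (-56862) * (tx ^ 4 * Y ^ 8) + (124659) * (tx ^ 3 * Y ^ 9) + (-183708) * (tx ^ 2 * Y ^ 10) + (157464) * (tx ^ 1 * Y ^ 11) + (-59049) * (tx ^ 0 * Y ^ 12), ?_⟩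
        ring
      obtain ⟨W, hW⟩ := h1
      have h2 : ∃ V, tx ^ 11 = 1 + 3 * V := by
        obtain ⟨V, hV⟩ : (6 * w) ∣ tx ^ 11 - 1 := by
          have := sub_dvd_pow_sub_pow tx 1 11
          rw [one_pow] at this
          convert this using 1
          rw [hx]; ring
        exact ⟨2 * w * V, by linear_combination hV⟩
      obtain ⟨V, hV⟩ := h2
      exact ⟨Y * V + W, by rw [hW, hV]; ring⟩
    have h3 := congrArg (PowerSeries.coeff p) hW
    rw [De_p h0, map_add, coeff_ofNat_mul] at h3
    omega
  have hY2 : Su 3 2 (Y ^ 2) := hY.pow 2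
  have hY3 : Su 3 0 (Y ^ 3) := (hY.pow 3).cast rfl
  have hY4 : Su 3 1 (Y ^ 4) := (hY.pow 4).cast rfl
  obtain ⟨d0, d1, d2, e0, e1, e2⟩ := Su_q' (hxs.pow0 3) hY3
  have c1 : ∀ G, Su 3 0 G → PowerSeries.coeff p (tx ^ 2 * Y * G) = 0 := fun G hG =>
    ((((hxs.pow0 2).mul hY).mul0 hG).cast (s := 1) rfl) p (by omega)
  -- comparison of De and Sg 11
  have hD := congrArg (PowerSeries.coeff p) hDe
  rw [poly_D3, map_add, map_add, De_p h0, d0 p (by omega), c1 _ d1] at hD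
  have hE := congrArg (PowerSeries.coeff p) E12
  rw [poly_E3 tx Y eQ eR ta tt ha ht Q_cub R_cub, map_add, coeff_ofNat_mul, map_add, map_add, coeff_ofNat_mul, Sg_p hp,
    ofNat_p hp, e0 p (by omega), c1 _ e1] at hE
  obtain ⟨W, hW⟩ := qDE (tx ^ 3) (Y ^ 3)
  have hK : 8 * (1 + (p : ℤ) ^ 11) = 393923898 * PowerSeries.coeff p (tx ^ 7 * Y ^ 5) +
      2187 * PowerSeries.coeff p (tx * Y ^ 2 * W) := by
    have h := congrArg (PowerSeries.coeff p) (show 683 * (tx * Y ^ 2 * qD2 (tx ^ 3) (Y ^ 3)) +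
      8 * (tx * Y ^ 2 * qE2 (tx ^ 3) (Y ^ 3)) = 393923898 * (tx ^ 7 * Y ^ 5) + 2187 * (tx * Y ^ 2 * W) by
        linear_combination (tx * Y ^ 2) * hW)
    rw [map_add, map_add, coeff_ofNat_mul, coeff_ofNat_mul, coeff_ofNat_mul, coeff_ofNat_mul] at h
    linarith
  have h729 : (729 : ℤ) ∣ p + 1 := by
    have := p11_three (p := p) (by omega) 6 (by norm_num; omega)
    norm_num at this; exact this
  obtain ⟨m, hm⟩ := h729
  -- Y^2
  have hwY : PowerSeries.coeff p (w * Y) = 0 := ((hw.mul hY).cast (s := 1) rfl) p (by omega)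
  have hB : 1 + (p : ℤ) = 3 * PowerSeries.coeff p (Y ^ 2) := by
    rw [show (w + Y) ^ 2 = w ^ 2 + 2 * (w * Y) + Y ^ 2 by ring, map_add, map_add, coeff_ofNat_mul, hwY,
      (hw.pow0 2) p (by omega), hY p (by omega)] at hS1p
    linarith
  -- weight 4
  have hA : 108 * PowerSeries.coeff p ((w + 3 * w ^ 2) * Y ^ 2) = 1 + (p : ℤ) ^ 3 - 3 * (1 + (p : ℤ)) := by
    have h : 1 + 240 * Sg 3 = tx ^ 4 + 240 * (tx ^ 2 * Y * tx) + 2160 * (Y ^ 2 + 12 * ((w + 3 * w ^ 2) * Y ^ 2)) +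
        6696 * (tx * Y ^ 3) + 12960 * Y ^ 4 := by
      rw [← eQ_eq, Q_cub, ht, ha, hx]; ring
    have h := congrArg (PowerSeries.coeff p) h
    rw [map_add, map_add, map_add, map_add, map_add, coeff_ofNat_mul, coeff_ofNat_mul, coeff_ofNat_mul, coeff_ofNat_mul,
      coeff_ofNat_mul, map_add, coeff_ofNat_mul, c1 _ hxs, one_p hp, Sg_p hp, (hxs.pow0 4) p (by omega), hY4 p (by omega),
      (hxs.mul0 hY3) p (by omega)] at h
    linarith
  have hA9 : (9 : ℤ) ∣ PowerSeries.coeff p ((w + 3 * w ^ 2) * Y ^ 2) := by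
    have hk : 1 + (p : ℤ) ^ 3 - 3 * (1 + (p : ℤ)) = 531441 * (m ^ 2 * (729 * m - 3)) := by
      have : (p : ℤ) = 729 * m - 1 := by linarith
      rw [this]; ring
    rw [hk] at hA
    generalize m ^ 2 * (729 * m - 3) = k at hA
    omega
  -- derivative
  have hC : 2 * ((p : ℤ) * PowerSeries.coeff p (Y ^ 2)) = 4 * PowerSeries.coeff p (Y ^ 2) +
      12 * PowerSeries.coeff p ((w + 3 * w ^ 2) * Y ^ 2) - 72 * PowerSeries.coeff p (S19 * Y ^ 2) := by
    have h : 2 * th ℤ (Y ^ 2) = 4 * Y ^ 2 + 12 * ((w + 3 * w ^ 2) * Y ^ 2) - 72 * (S19 * Y ^ 2) := by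
      refine mul_left_cancel₀ (show (2 : PowerSeries ℤ) ≠ 0 by norm_num) ?_
      rw [P3_eq, hS13, hx] at hth
      rw [pow_two, th_mul]
      linear_combination 2 * Y * hth
    have h := congrArg (PowerSeries.coeff p) h
    rw [map_sub, map_add, coeff_ofNat_mul, coeff_ofNat_mul, coeff_ofNat_mul, coeff_ofNat_mul, coeff_th] at h
    exact_mod_cast h
  have hb : PowerSeries.coeff p (Y ^ 2) = 243 * m := by linarith
  have hS3 : (3 : ℤ) ∣ PowerSeries.coeff p (S19 * Y ^ 2) := by
    rw [hb, show (p : ℤ) * (243 * m) = 243 * (p * m) by ring] at hC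
    generalize (p : ℤ) * m = k at hC
    omega
  -- fifth power
  have h5 : (3 : ℤ) ∣ PowerSeries.coeff p (tx ^ 7 * Y ^ 5) := by
    obtain ⟨V, hV⟩ : (6 * w) ∣ tx ^ 7 - 1 := by
      have := sub_dvd_pow_sub_pow tx 1 7
      rw [one_pow] at this
      convert this using 1
      rw [hx]; ring
    have h : tx ^ 7 * Y ^ 5 = (w + 3 * w ^ 2) * Y ^ 2 - S19 * Y ^ 2 +
        3 * (G * Y ^ 2 - w ^ 2 * Y ^ 2 + T * Y ^ 2 + 2 * w * V * Y ^ 5) := by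
      have hV' : tx ^ 7 = 1 + 6 * w * V := by linear_combination hV
      rw [hV']
      linear_combination Y ^ 2 * hG + Y ^ 2 * hS19
    rw [h, map_add, map_sub, coeff_ofNat_mul]
    omega
  have := p11_three (p := p) (by omega) 7 (by norm_num; omega)
  norm_num at this; exact this

end SerreTau

open Polynomial

namespace SerreTau

lemma crit_big {p : ℕ} (hp : p.Prime) (h0 : ramanujanTau p = 0) : 690 ≤ p := by
  have hd : 691 ∣ p + 1 := by exact_mod_cast crit691 hp h0
  have := Nat.le_of_dvd (by omega) hd
  omega

lemma combine {n : ℕ} (d1 : 691 ∣ n) (d2 : 16384 ∣ n) (d3 : 2187 ∣ n) (d5 : 125 ∣ n) : 3094972416000 ∣ n := by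
  have e1 := Nat.Coprime.mul_dvd_of_dvd_of_dvd (by norm_num) d2 d3
  have e2 := Nat.Coprime.mul_dvd_of_dvd_of_dvd (by norm_num) e1 d5
  have e3 := Nat.Coprime.mul_dvd_of_dvd_of_dvd (by norm_num) e2 d1
  norm_num at e3
  exact e3

lemma final_mod49 {p h : ℤ} (hz : p = h * 3094972416000 - 1) (h49 : p % 49 = 19 ∨ p % 49 = 31 ∨ p % 49 = 48) :
    h % 49 = 0 ∨ h % 49 = 30 ∨ h % 49 = 48 := by
  have h1 : p = 49 * (h * 63162702367) + 17 * h - 1 := by rw [hz]; ring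
  generalize h * 63162702367 = t at h1
  have h2 : h = 26 * (p + 1) + 49 * (-(26 * t) - 9 * h) := by rw [h1]; ring
  generalize -(26 * t) - 9 * h = s at h2
  clear hz h1
  rcases h49 with h49 | h49 | h49 <;> omega

lemma final_mod23 {p h : ℤ} (hz : p = h * 3094972416000 - 1) (h23 : legendreSym 23 p = -1) :
    legendreSym 23 (h + 1) = 1 := by
  have hm : (h + 1) % (23 : ℕ) = (-1 * p) % (23 : ℕ) := by push_cast; omega
  rw [legendreSym.mod, hm, ← legendreSym.mod, legendreSym.mul, h23, legendreSym.at_neg_one (by norm_num)]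
  rw [show ZMod.χ₄ ((23 : ℕ) : ZMod 4) = -1 from by decide]
  norm_num

lemma final_M : (3094972416000 : ℤ) = 2 ^ 14 * 3 ^ 7 * 5 ^ 3 * 691 := by norm_num

end SerreTau

/-- Serre's criterion: if `p` is a prime with `τ(p) = 0`, then `p = h·M − 1` with
`M = 2^14·3^7·5^3·691`, the Legendre symbol of `h+1` mod `23` equals `1`, and
`h mod 49 ∈ {0, 30, 48}`. -/
theorem serre_criterion_tau_eq_zero (p : ℕ) (hp : p.Prime) (h0 : ramanujanTau p = 0) :
    ∃ h : ℕ, 0 < h ∧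
      (p : ℤ) = (h : ℤ) * (2 ^ 14 * 3 ^ 7 * 5 ^ 3 * 691) - 1 ∧
      legendreSym 23 ((h : ℤ) + 1) = 1 ∧
      (h % 49 = 0 ∨ h % 49 = 30 ∨ h % 49 = 48) := by
  have hbig := SerreTau.crit_big hp h0
  have h2 : p ≠ 2 := by omega
  have h3 : p ≠ 3 := by omega
  have h5 : p ≠ 5 := by omega
  have h7 : p ≠ 7 := by omega
  have h23 := SerreTau.crit23 hp (SerreTau.mod4 hp h2 h0) (by omega) h0
  have h49 := SerreTau.crit7 hp h7 h0
  obtain ⟨h, hh⟩ := SerreTau.combine (n := p + 1) (by exact_mod_cast SerreTau.crit691 hp h0)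
    (by exact_mod_cast SerreTau.crit2 hp h2 h0) (by exact_mod_cast SerreTau.crit3 hp h3 h0)
    (by exact_mod_cast SerreTau.crit5 hp h5 h0)
  have hz : (p : ℤ) = (h : ℤ) * 3094972416000 - 1 := by
    have : ((p + 1 : ℕ) : ℤ) = ((3094972416000 * h : ℕ) : ℤ) := by rw [hh]
    push_cast at this
    linarith
  clear hh
  refine ⟨h, ?_, ?_, SerreTau.final_mod23 hz h23, ?_⟩
  · rcases Nat.eq_zero_or_pos h with rfl | hpos
    · exfalso
      push_cast at hz
    · exact hpos
  · rw [hz, SerreTau.final_M]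
  · have h49' : (p : ℤ) % 49 = 19 ∨ (p : ℤ) % 49 = 31 ∨ (p : ℤ) % 49 = 48 := by exact_mod_cast h49
    have := SerreTau.final_mod49 hz h49'
    exact_mod_cast this
end

section
/- Let K be a field and x, y ∈ K with x ≠ 0, y ≠ 0, y ≠ 1 and x·y ≠ 1. Set r = (x²y − xy + y − 1)/(x(xy−1)) and s = (xy − y + 1)/(xy). Then rs − 2r + 1 ≠ 0, s² − s − r + 1 ≠ 0, and (s − r)/(rs − 2r + 1) = x and (rs − 2r + 1)/(s² − s − r + 1) = y. Explicitly, s − r = −(y−1)²/(xy(xy−1)), rs − 2r + 1 = −(y−1)²/(x²y(xy−1)), and s² − s − r + 1 = −(y−1)²/(x²y²(xy−1)). -/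
/-- The substitutions between the coordinates `(r, s)` and `(x, y)` on `X₁(N)` are
mutually inverse: with `r = (x²y − xy + y − 1)/(x(xy−1))` and `s = (xy − y + 1)/(xy)`,
one has explicit formulas for `s − r`, `rs − 2r + 1`, `s² − s − r + 1`, and
`(s − r)/(rs − 2r + 1) = x`, `(rs − 2r + 1)/(s² − s − r + 1) = y`. -/
theorem xy_rs_birational_inverse (K : Type*) [Field K] (x y : K)
    (hx : x ≠ 0) (hy : y ≠ 0) (hy1 : y ≠ 1) (hxy : x * y ≠ 1) :
    let r := (x ^ 2 * y - x * y + y - 1) / (x * (x * y - 1))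
    let s := (x * y - y + 1) / (x * y)
    r * s - 2 * r + 1 ≠ 0 ∧
    s ^ 2 - s - r + 1 ≠ 0 ∧
    (s - r) / (r * s - 2 * r + 1) = x ∧
    (r * s - 2 * r + 1) / (s ^ 2 - s - r + 1) = y ∧
    s - r = -(y - 1) ^ 2 / (x * y * (x * y - 1)) ∧
    r * s - 2 * r + 1 = -(y - 1) ^ 2 / (x ^ 2 * y * (x * y - 1)) ∧
    s ^ 2 - s - r + 1 = -(y - 1) ^ 2 / (x ^ 2 * y ^ 2 * (x * y - 1)) := by
  intro r s
  have hd : x * y - 1 ≠ 0 := sub_ne_zero.mpr hxy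
  have he : y - 1 ≠ 0 := sub_ne_zero.mpr hy1
  have h1 : s - r = -(y - 1) ^ 2 / (x * y * (x * y - 1)) := by
    simp only [r, s]
    field_simp
    ring
  have h2 : r * s - 2 * r + 1 = -(y - 1) ^ 2 / (x ^ 2 * y * (x * y - 1)) := by
    simp only [r, s]
    field_simp
    ring
  have h3 : s ^ 2 - s - r + 1 = -(y - 1) ^ 2 / (x ^ 2 * y ^ 2 * (x * y - 1)) := by
    simp only [r, s]
    field_simp
    ring
  have hn : -(y - 1) ^ 2 ≠ 0 := neg_ne_zero.mpr (pow_ne_zero 2 he)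
  refine ⟨?_, ?_, ?_, ?_, h1, h2, h3⟩
  · rw [h2]
    exact div_ne_zero hn (by simp [hx, hy, hd])
  · rw [h3]
    exact div_ne_zero hn (by simp [hx, hy, hd])
  · rw [h1, h2]
    field_simp
    exact div_self (by rwa [mul_comm] at hd)
  · rw [h2, h3]
    field_simp
    exact div_self (by rwa [mul_comm] at hd)
end
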